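/- Let (ρ̄,(ū,0),p̄,Φ₀) be the subsonic background solution on N, fix α∈(1/2,1) and μ∈(2,∞), and suppose Φ_bd satisfies ∂_{x₂}Φ_bd = 0 at Γ̄_w ∩ (Γ̄₀ ∪ Γ̄_L). Then there exists σ₄>0, depending only on the data, α and μ, such that if ω₁(b)+ω₂(S_en,B_en)+ω₃(Φ_bd,p_ex)+ω₄(S_en,B_en,Φ_bd) ≤ σ₄, where ω₄ := ‖(S_en, B_en−Φ_bd)−(S₀,B₀)‖_{W^{2,μ}(Γ₀)}, then the solution U=(φ,ψ,Φ,S,K) of the reformulated boundary value problem satisfying the existence estimate is unique. -/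

import Mathlib

open Real Set Metric MeasureTheory
open scoped ENNReal

noncomputable section

abbrev Pt : Type := ℝ × ℝ

/-- partial derivative in the `x₁` direction -/
def pd1 (f : Pt → ℝ) : Pt → ℝ := fun x => fderiv ℝ f x (1, 0)

/-- partial derivative in the `x₂` direction -/
def pd2 (f : Pt → ℝ) : Pt → ℝ := fun x => fderiv ℝ f x (0, 1)

/-- mixed partial derivative `∂₁^i ∂₂^j` -/
def Dmix (i j : ℕ) (f : Pt → ℝ) : Pt → ℝ := pd1^[i] (pd2^[j] f)

/-- Laplacian -/
def lap (f : Pt → ℝ) : Pt → ℝ := fun x => pd1 (pd1 f) x + pd2 (pd2 f) x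

/-- the nozzle `N = (0,L) × (0,1)` -/
def Noz (L : ℝ) : Set Pt := Ioo 0 L ×ˢ Ioo 0 1

/-- the entrance `Γ₀ = {0} × [0,1]` -/
def Gam0 : Set Pt := {0} ×ˢ Icc 0 1

/-- the exit `Γ_L = {L} × [0,1]` -/
def GamL (L : ℝ) : Set Pt := {L} ×ˢ Icc 0 1

/-- the insulated walls `Γ_w = (0,L) × {0,1}` -/
def GamW (L : ℝ) : Set Pt := Ioo 0 L ×ˢ ({0, 1} : Set ℝ)

/-- the closed walls `Γ̄_w = [0,L] × {0,1}` -/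
def GamWbar (L : ℝ) : Set Pt := Icc 0 L ×ˢ ({0, 1} : Set ℝ)

/-- `f` is `C^m` on an open neighborhood of `K` (encoding of "`C^m` up to the boundary") -/
def UpTo (m : ℕ) (f : Pt → ℝ) (K : Set Pt) : Prop :=
  ∃ U : Set Pt, IsOpen U ∧ K ⊆ U ∧ ContDiffOn ℝ m f U

/-! ### Hölder norms (ℝ≥0∞–valued) -/

def supAbs (Ω : Set Pt) (g : Pt → ℝ) : ℝ≥0∞ := ⨆ x ∈ Ω, ENNReal.ofReal |g x|

def hSemi (α : ℝ) (Ω : Set Pt) (g : Pt → ℝ) : ℝ≥0∞ :=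
  ⨆ x ∈ Ω, ⨆ y ∈ Ω, ⨆ _ : x ≠ y, ENNReal.ofReal (|g x - g y| / ‖x - y‖ ^ α)

def idxLe (m : ℕ) : Finset (ℕ × ℕ) :=
  (Finset.range (m+1) ×ˢ Finset.range (m+1)).filter (fun p => p.1 + p.2 ≤ m)

def idxEq (m : ℕ) : Finset (ℕ × ℕ) :=
  (Finset.range (m+1) ×ˢ Finset.range (m+1)).filter (fun p => p.1 + p.2 = m)

/-- the Hölder norm `‖f‖_{m,α,Ω}` -/
def hNorm (m : ℕ) (α : ℝ) (Ω : Set Pt) (f : Pt → ℝ) : ℝ≥0∞ :=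
  ∑ p ∈ idxLe m, supAbs Ω (Dmix p.1 p.2 f) + ∑ p ∈ idxEq m, hSemi α Ω (Dmix p.1 p.2 f)

/-- the `C^k` sup norm `‖f‖_{k,Ω}` -/
def ckNorm (k : ℕ) (Ω : Set Pt) (f : Pt → ℝ) : ℝ≥0∞ :=
  ∑ p ∈ idxLe k, supAbs Ω (Dmix p.1 p.2 f)

def wSup (k : ℝ) (Γ Ω : Set Pt) (d : ℕ) (g : Pt → ℝ) : ℝ≥0∞ :=
  ⨆ x ∈ Ω, ENNReal.ofReal (infDist x Γ ^ (max ((d : ℝ) + k) 0) * |g x|)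

def wSemi (m : ℕ) (α k : ℝ) (Γ Ω : Set Pt) (g : Pt → ℝ) : ℝ≥0∞ :=
  ⨆ x ∈ Ω, ⨆ y ∈ Ω, ⨆ _ : x ≠ y,
    ENNReal.ofReal ((min (infDist x Γ) (infDist y Γ)) ^ (max ((m : ℝ) + α + k) 0) *
      (|g x - g y| / ‖x - y‖ ^ α))

/-- the weighted Hölder norm `‖f‖^{(k,Γ)}_{m,α,Ω}` -/
def whNorm (m : ℕ) (α k : ℝ) (Γ Ω : Set Pt) (f : Pt → ℝ) : ℝ≥0∞ :=
  ∑ p ∈ idxLe m, wSup k Γ Ω (p.1 + p.2) (Dmix p.1 p.2 f)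
  + ∑ p ∈ idxEq m, wSemi m α k Γ Ω (Dmix p.1 p.2 f)

/-! ### one–dimensional versions, for norms of boundary data -/

def supAbs1 (Ω : Set ℝ) (g : ℝ → ℝ) : ℝ≥0∞ := ⨆ x ∈ Ω, ENNReal.ofReal |g x|

def hSemi1 (α : ℝ) (Ω : Set ℝ) (g : ℝ → ℝ) : ℝ≥0∞ :=
  ⨆ x ∈ Ω, ⨆ y ∈ Ω, ⨆ _ : x ≠ y, ENNReal.ofReal (|g x - g y| / |x - y| ^ α)

/-- the one–dimensional Hölder norm `‖f‖_{m,α,Ω}` -/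
def h1Norm (m : ℕ) (α : ℝ) (Ω : Set ℝ) (f : ℝ → ℝ) : ℝ≥0∞ :=
  ∑ i ∈ Finset.range (m+1), supAbs1 Ω (deriv^[i] f) + hSemi1 α Ω (deriv^[m] f)

def wSup1 (k : ℝ) (Γ Ω : Set ℝ) (d : ℕ) (g : ℝ → ℝ) : ℝ≥0∞ :=
  ⨆ x ∈ Ω, ENNReal.ofReal (infDist x Γ ^ (max ((d : ℝ) + k) 0) * |g x|)

def wSemi1 (m : ℕ) (α k : ℝ) (Γ Ω : Set ℝ) (g : ℝ → ℝ) : ℝ≥0∞ :=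
  ⨆ x ∈ Ω, ⨆ y ∈ Ω, ⨆ _ : x ≠ y,
    ENNReal.ofReal ((min (infDist x Γ) (infDist y Γ)) ^ (max ((m : ℝ) + α + k) 0) *
      (|g x - g y| / |x - y| ^ α))

/-- the one–dimensional weighted Hölder norm `‖f‖^{(k,Γ)}_{m,α,Ω}` -/
def wh1Norm (m : ℕ) (α k : ℝ) (Γ Ω : Set ℝ) (f : ℝ → ℝ) : ℝ≥0∞ :=
  ∑ i ∈ Finset.range (m+1), wSup1 k Γ Ω i (deriv^[i] f) + wSemi1 m α k Γ Ω (deriv^[m] f)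

/-! ### gas quantities and the background solution -/

/-- density as a function of entropy `S` and `ζ = K + Φ − |u|²/2` -/
def Hfun (γ 𝔭 cv S ζ : ℝ) : ℝ := ((γ - 1) * ζ / (γ * 𝔭 * exp (S / cv))) ^ (1 / (γ - 1))

/-- temperature -/
def Tfun (γ 𝔭 cv ρ S : ℝ) : ℝ := (cv * 𝔭 / (γ - 1)) * exp (S / cv) * ρ ^ (γ - 1)

/-- the background Bernoulli constant `B₀ = ū(0)²/2 + γ𝔭e^{S₀/c_v}ρ₀^{γ−1}/(γ−1)` -/
def Bern0 (γ 𝔭 cv S₀ J₀ ρ₀ : ℝ) : ℝ :=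
  (J₀ / ρ₀) ^ 2 / 2 + γ * 𝔭 * exp (S₀ / cv) * ρ₀ ^ (γ - 1) / (γ - 1)

/-- the Bernoulli function of a flow `(ρ, u, v, p)` -/
def BernFn (γ : ℝ) (ρ u v p : Pt → ℝ) : Pt → ℝ :=
  fun y => (u y ^ 2 + v y ^ 2) / 2 + γ * p y / ((γ - 1) * ρ y)

/-- the background electric potential `Φ₀` -/
def Phi0 (Eb : ℝ → ℝ) : Pt → ℝ := fun x => ∫ t in (0:ℝ)..x.1, Eb t

/-- the background velocity potential `φ₀` -/
def phi0 (J₀ : ℝ) (ρb : ℝ → ℝ) : Pt → ℝ := fun x => ∫ t in (0:ℝ)..x.1, J₀ / ρb t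

/-- `(ρb, Eb)` is the subsonic background solution of Proposition 2.1 associated with the
data `(b₀, S₀, J₀, ρ₀, E₀, L)`, with density bounds `ρlow, ρhigh` and subsonicity bound `ν₀`. -/
structure Background (γ 𝔭 cv b₀ J₀ S₀ E₀ ρ₀ L ν₀ ρlow ρhigh : ℝ) (ρb Eb : ℝ → ℝ) : Prop where
  hγ : 1 < γ
  h𝔭 : 0 < 𝔭
  hcv : 0 < cv
  hb₀ : 0 < b₀
  hJ₀ : 0 < J₀
  hS₀ : 0 < S₀
  hL : 0 < L
  hν₀ : 0 < ν₀
  hρlow : 0 < ρlow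
  smooth_rho : ContDiffOn ℝ (⊤ : ℕ∞) ρb (Icc 0 L)
  smooth_E : ContDiffOn ℝ (⊤ : ℕ∞) Eb (Icc 0 L)
  init_rho : ρb 0 = ρ₀
  init_E : Eb 0 = E₀
  ode_rho : ∀ x ∈ Icc 0 L, derivWithin ρb (Icc 0 L) x =
      ρb x * Eb x / (γ * 𝔭 * exp (S₀ / cv) * ρb x ^ (γ - 1) - J₀ ^ 2 / ρb x ^ 2)
  ode_E : ∀ x ∈ Icc 0 L, derivWithin Eb (Icc 0 L) x = ρb x - b₀
  bound_lo : ∀ x ∈ Icc 0 L, ρlow ≤ ρb x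
  bound_hi : ∀ x ∈ Icc 0 L, ρb x ≤ ρhigh
  subsonic : ∀ x ∈ Icc 0 L, ν₀ ≤ γ * 𝔭 * exp (S₀ / cv) * ρb x ^ (γ - 1) - J₀ ^ 2 / ρb x ^ 2

/-! ### sizes of the perturbations -/

/-- `ω₁(b) = ‖b − b₀‖_{α,N}` -/
def om1 (α b₀ L : ℝ) (b : Pt → ℝ) : ℝ≥0∞ := hNorm 0 α (Noz L) (fun x => b x - b₀)

/-- `ω₂(S_en, B_en) = ‖(S_en,B_en) − (S₀,B₀)‖_{1,α,Γ₀}` -/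
def om2 (α S₀ B₀ : ℝ) (Sen Ben : ℝ → ℝ) : ℝ≥0∞ :=
  h1Norm 1 α (Icc 0 1) (fun t => Sen t - S₀) + h1Norm 1 α (Icc 0 1) (fun t => Ben t - B₀)

/-- `ω₃(Φ_bd, p_ex)`, where `Φ_bd` is described by its two traces `Φbd0` on `Γ₀` and
`ΦbdL` on `Γ_L` (as functions of `x₂`), and the background potential vanishes on `Γ₀`. -/
def om3 (γ 𝔭 cv S₀ α L : ℝ) (ρb Eb : ℝ → ℝ) (Φbd0 ΦbdL pex : ℝ → ℝ) : ℝ≥0∞ :=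
  wh1Norm 2 α (-1-α) {0, 1} (Icc 0 1) Φbd0
  + wh1Norm 2 α (-1-α) {0, 1} (Icc 0 1) (fun t => ΦbdL t - ∫ s in (0:ℝ)..L, Eb s)
  + wh1Norm 1 α (-α) {0, 1} (Icc 0 1) (fun t => pex t - 𝔭 * exp (S₀ / cv) * ρb L ^ γ)

/-- the `W^{2,μ}` norm on `Γ₀ ≃ [0,1]` -/
def W2mu (μ : ℝ) (f : ℝ → ℝ) : ℝ :=
  (∫ t in (0:ℝ)..1, (|f t| ^ μ + |deriv f t| ^ μ + |deriv (deriv f) t| ^ μ)) ^ (1 / μ)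

/-- `ω₄(S_en, B_en, Φ_bd) = ‖(S_en, B_en − Φ_bd) − (S₀, B₀)‖_{W^{2,μ}(Γ₀)}` -/
def om4 (μ S₀ B₀ : ℝ) (Sen Ben Φbd0 : ℝ → ℝ) : ℝ :=
  W2mu μ (fun t => Sen t - S₀) + W2mu μ (fun t => Ben t - Φbd0 t - B₀)

/-- `U = (φ, ψ, Φ, S, K)` is a classical solution of the reformulated (Helmholtz/stream
function) Euler–Poisson system in `N` with its boundary conditions; here
`ρ = H(S, K + Φ − |∇φ + ∇^⊥ψ|²/2)` and the velocity is `∇φ + ∇^⊥ψ`. -/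
def RefSol (γ 𝔭 cv L : ℝ) (b : Pt → ℝ) (Sen Ben Φbd0 ΦbdL pex : ℝ → ℝ)
    (φ ψ Φ S K : Pt → ℝ) : Prop :=
  -- regularity: `(φ, ψ, Φ) ∈ C¹(N̄) ∩ C²(N)`, `(S, K) ∈ C¹(N̄)`
  UpTo 1 φ (closure (Noz L)) ∧ UpTo 1 ψ (closure (Noz L)) ∧ UpTo 1 Φ (closure (Noz L)) ∧
  ContDiffOn ℝ 2 φ (Noz L) ∧ ContDiffOn ℝ 2 ψ (Noz L) ∧ ContDiffOn ℝ 2 Φ (Noz L) ∧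
  UpTo 1 S (closure (Noz L)) ∧ UpTo 1 K (closure (Noz L)) ∧
  -- the equations (i)–(iv) in `N`
  (∀ x ∈ Noz L,
    (pd1 (fun y => Hfun γ 𝔭 cv (S y)
          (K y + Φ y - ((pd1 φ y + pd2 ψ y) ^ 2 + (pd2 φ y - pd1 ψ y) ^ 2) / 2) *
          (pd1 φ y + pd2 ψ y)) x
      + pd2 (fun y => Hfun γ 𝔭 cv (S y)
          (K y + Φ y - ((pd1 φ y + pd2 ψ y) ^ 2 + (pd2 φ y - pd1 ψ y) ^ 2) / 2) *
          (pd2 φ y - pd1 ψ y)) x = 0) ∧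
    lap Φ x = Hfun γ 𝔭 cv (S x)
        (K x + Φ x - ((pd1 φ x + pd2 ψ x) ^ 2 + (pd2 φ x - pd1 ψ x) ^ 2) / 2) - b x ∧
    lap ψ x = -(Tfun γ 𝔭 cv
          (Hfun γ 𝔭 cv (S x)
            (K x + Φ x - ((pd1 φ x + pd2 ψ x) ^ 2 + (pd2 φ x - pd1 ψ x) ^ 2) / 2))
          (S x) * pd2 S x - pd2 K x) / (pd1 φ x + pd2 ψ x) ∧
    Hfun γ 𝔭 cv (S x)
        (K x + Φ x - ((pd1 φ x + pd2 ψ x) ^ 2 + (pd2 φ x - pd1 ψ x) ^ 2) / 2) *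
      ((pd1 φ x + pd2 ψ x) * pd1 S x + (pd2 φ x - pd1 ψ x) * pd2 S x) = 0 ∧
    Hfun γ 𝔭 cv (S x)
        (K x + Φ x - ((pd1 φ x + pd2 ψ x) ^ 2 + (pd2 φ x - pd1 ψ x) ^ 2) / 2) *
      ((pd1 φ x + pd2 ψ x) * pd1 K x + (pd2 φ x - pd1 ψ x) * pd2 K x) = 0) ∧
  -- boundary conditions on the entrance and the exit
  (∀ t ∈ Icc (0:ℝ) 1,
    φ (0, t) = 0 ∧
    𝔭 * exp (S (L, t) / cv) *
        Hfun γ 𝔭 cv (S (L, t))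
          (K (L, t) + Φ (L, t) -
            ((pd1 φ (L, t) + pd2 ψ (L, t)) ^ 2 + (pd2 φ (L, t) - pd1 ψ (L, t)) ^ 2) / 2)
          ^ γ = pex t ∧
    Φ (0, t) = Φbd0 t ∧ Φ (L, t) = ΦbdL t ∧
    pd1 ψ (0, t) = 0 ∧ pd1 ψ (L, t) = 0 ∧
    S (0, t) = Sen t ∧ K (0, t) = Ben t - Φbd0 t) ∧
  -- boundary conditions on the walls
  (∀ x ∈ GamW L, pd2 φ x = 0 ∧ pd2 Φ x = 0 ∧ ψ x = 0)

/-- the weighted Hölder estimate for solutions of the reformulated problem -/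
def RefEst (γ 𝔭 cv J₀ S₀ ρ₀ L α C : ℝ) (ρb Eb : ℝ → ℝ) (φ ψ Φ S K : Pt → ℝ)
    (ω : ℝ≥0∞) : Prop :=
  whNorm 2 α (-1-α) (GamWbar L) (Noz L) (fun x => φ x - phi0 J₀ ρb x)
  + whNorm 2 α (-1-α) (GamWbar L) (Noz L) ψ
  + whNorm 2 α (-1-α) (GamWbar L) (Noz L) (fun x => Φ x - Phi0 Eb x)
  + hNorm 1 α (Noz L) (fun x => S x - S₀)
  + hNorm 1 α (Noz L) (fun x => K x - Bern0 γ 𝔭 cv S₀ J₀ ρ₀)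
  ≤ ENNReal.ofReal C * ω

/-! ### Calculus on the rectangle -/

/-- the closed rectangle `[0,L] × [0,1]` -/
def Rect (L : ℝ) : Set Pt := Icc 0 L ×ˢ Icc 0 1

lemma closure_Noz {L : ℝ} (hL : 0 < L) : closure (Noz L) = Rect L := by
  rw [Noz, closure_prod_eq, closure_Ioo hL.ne, closure_Ioo zero_ne_one, Rect]

lemma isOpen_Noz (L : ℝ) : IsOpen (Noz L) := isOpen_Ioo.prod isOpen_Ioo

lemma Noz_subset_Rect (L : ℝ) : Noz L ⊆ Rect L := prod_mono Ioo_subset_Icc_self Ioo_subset_Icc_self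

lemma isCompact_Rect (L : ℝ) : IsCompact (Rect L) := isCompact_Icc.prod isCompact_Icc

lemma Noz_ae_eq_Rect (L : ℝ) : Noz L =ᵐ[volume] Rect L := by
  rw [Measure.volume_eq_prod]
  exact Measure.set_prod_ae_eq Ioo_ae_eq_Icc Ioo_ae_eq_Icc

lemma mem_Rect_left {L t : ℝ} (hL : 0 < L) (ht : t ∈ Icc (0 : ℝ) 1) : ((0, t) : Pt) ∈ Rect L :=
  ⟨⟨le_rfl, hL.le⟩, ht⟩

lemma mem_Rect_right {L t : ℝ} (hL : 0 < L) (ht : t ∈ Icc (0 : ℝ) 1) : ((L, t) : Pt) ∈ Rect L :=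
  ⟨⟨hL.le, le_rfl⟩, ht⟩

lemma integrableOn_Noz {L : ℝ} {f : Pt → ℝ} (hf : ContinuousOn f (Rect L)) :
    IntegrableOn f (Noz L) :=
  (hf.integrableOn_compact (isCompact_Rect L)).mono_set (Noz_subset_Rect L)

lemma intervalIntegrable_slice {L a : ℝ} {f : Pt → ℝ} (hf : ContinuousOn f (Rect L))
    (ha : a ∈ Icc 0 L) : IntervalIntegrable (fun t => f (a, t)) volume 0 1 := by
  apply ContinuousOn.intervalIntegrable
  rw [uIcc_of_le zero_le_one]
  exact hf.comp (by fun_prop) fun t ht => ⟨ha, ht⟩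

/-- Divergence theorem on the nozzle for fields whose normal component vanishes on the walls. -/
lemma integral_div {L : ℝ} (hL : 0 < L) {f h D : Pt → ℝ} (hf : ContinuousOn f (Rect L))
    (hh : ContinuousOn h (Rect L)) (df : ∀ x ∈ Noz L, DifferentiableAt ℝ f x)
    (dh : ∀ x ∈ Noz L, DifferentiableAt ℝ h x) (hD : ∀ x ∈ Noz L, pd1 f x + pd2 h x = D x)
    (hi : IntegrableOn D (Noz L)) (h0 : ∀ t ∈ Icc 0 L, h (t, 0) = 0)
    (h1 : ∀ t ∈ Icc 0 L, h (t, 1) = 0) :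
    ∫ x in Noz L, D x = (∫ t in (0 : ℝ)..1, f (L, t)) - ∫ t in (0 : ℝ)..1, f (0, t) := by
  have hR : Rect L = Icc ((0, 0) : Pt) (L, 1) := by
    rw [Rect, Icc_prod_eq]
  have hi' : IntegrableOn (fun x => fderiv ℝ f x (1, 0) + fderiv ℝ h x (0, 1)) (Noz L) :=
    hi.congr_fun (fun x hx => (hD x hx).symm) (isOpen_Noz L).measurableSet
  have key := integral_divergence_prod_Icc_of_hasFDerivAt_off_countable_of_le f h
    (fderiv ℝ f) (fderiv ℝ h) (0, 0) (L, 1) ⟨hL.le, zero_le_one⟩ ∅ countable_empty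
    (hR ▸ hf) (hR ▸ hh) (fun x hx => (df x hx.1).hasFDerivAt)
    (fun x hx => (dh x hx.1).hasFDerivAt)
    (hR ▸ hi'.congr_set_ae (Noz_ae_eq_Rect L).symm)
  rw [← hR, ← setIntegral_congr_set (Noz_ae_eq_Rect L)] at key
  rw [← setIntegral_congr_fun (isOpen_Noz L).measurableSet hD]
  simp only [pd1, pd2]
  rw [key, intervalIntegral.integral_congr (g := fun _ => (0 : ℝ)),
    intervalIntegral.integral_congr (a := 0) (b := L) (f := fun x => h (x, 0))
      (g := fun _ => (0 : ℝ))]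
  · simp
  · intro t ht
    rw [uIcc_of_le hL.le] at ht
    exact h0 t ht
  · intro t ht
    simp only [uIcc_of_le hL.le] at ht
    exact h1 t ht

section pd
variable {f g : Pt → ℝ} {x : Pt}

lemma pd1_add (hf : DifferentiableAt ℝ f x) (hg : DifferentiableAt ℝ g x) :
    pd1 (fun y => f y + g y) x = pd1 f x + pd1 g x := by
  simp [pd1, fderiv_fun_add hf hg]

lemma pd2_add (hf : DifferentiableAt ℝ f x) (hg : DifferentiableAt ℝ g x) :
    pd2 (fun y => f y + g y) x = pd2 f x + pd2 g x := by
  simp [pd2, fderiv_fun_add hf hg]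

lemma pd1_sub (hf : DifferentiableAt ℝ f x) (hg : DifferentiableAt ℝ g x) :
    pd1 (fun y => f y - g y) x = pd1 f x - pd1 g x := by
  simp [pd1, fderiv_fun_sub hf hg]

lemma pd2_sub (hf : DifferentiableAt ℝ f x) (hg : DifferentiableAt ℝ g x) :
    pd2 (fun y => f y - g y) x = pd2 f x - pd2 g x := by
  simp [pd2, fderiv_fun_sub hf hg]

lemma pd1_mul (hf : DifferentiableAt ℝ f x) (hg : DifferentiableAt ℝ g x) :
    pd1 (fun y => f y * g y) x = pd1 f x * g x + f x * pd1 g x := by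
  simp [pd1, fderiv_fun_mul hf hg]; ring

lemma pd2_mul (hf : DifferentiableAt ℝ f x) (hg : DifferentiableAt ℝ g x) :
    pd2 (fun y => f y * g y) x = pd2 f x * g x + f x * pd2 g x := by
  simp [pd2, fderiv_fun_mul hf hg]; ring

lemma pd1_fst {φ : ℝ → ℝ} {x : Pt} (h : DifferentiableAt ℝ φ x.1) :
    pd1 (fun y => φ y.1) x = deriv φ x.1 := by
  have : HasFDerivAt (fun y : Pt => φ y.1) _ x := h.hasDerivAt.comp_hasFDerivAt x
    (hasFDerivAt_fst (𝕜 := ℝ) (E := ℝ) (F := ℝ) (p := x))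
  simp [pd1, this.fderiv]

lemma pd2_fst {φ : ℝ → ℝ} {x : Pt} (h : DifferentiableAt ℝ φ x.1) :
    pd2 (fun y => φ y.1) x = 0 := by
  have : HasFDerivAt (fun y : Pt => φ y.1) _ x := h.hasDerivAt.comp_hasFDerivAt x
    (hasFDerivAt_fst (𝕜 := ℝ) (E := ℝ) (F := ℝ) (p := x))
  simp [pd2, this.fderiv]

lemma pd2_snd {φ : ℝ → ℝ} {x : Pt} (h : DifferentiableAt ℝ φ x.2) :
    pd2 (fun y => φ y.2) x = deriv φ x.2 := by
  have : HasFDerivAt (fun y : Pt => φ y.2) _ x := h.hasDerivAt.comp_hasFDerivAt x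
    (hasFDerivAt_snd (𝕜 := ℝ) (E := ℝ) (F := ℝ) (p := x))
  simp [pd2, this.fderiv]

lemma abs_pd1_le : |pd1 f x| ≤ ‖fderiv ℝ f x‖ := by
  simpa [pd1] using (fderiv ℝ f x).le_opNorm ((1, 0) : Pt)

lemma abs_pd2_le : |pd2 f x| ≤ ‖fderiv ℝ f x‖ := by
  simpa [pd2] using (fderiv ℝ f x).le_opNorm ((0, 1) : Pt)

lemma norm_fderiv_le : ‖fderiv ℝ f x‖ ≤ |pd1 f x| + |pd2 f x| := by
  refine ContinuousLinearMap.opNorm_le_bound _ (by positivity) fun y => ?_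
  have hy : y = y.1 • ((1, 0) : Pt) + y.2 • ((0, 1) : Pt) := by ext <;> simp
  have : fderiv ℝ f x y = y.1 * pd1 f x + y.2 * pd2 f x := by
    conv_lhs => rw [hy]
    simp only [map_add, map_smul, smul_eq_mul, pd1, pd2]
  rw [this, norm_eq_abs]
  have h1 : |y.1| ≤ ‖y‖ := norm_fst_le y
  have h2 : |y.2| ≤ ‖y‖ := norm_snd_le y
  calc |y.1 * pd1 f x + y.2 * pd2 f x| ≤ |y.1| * |pd1 f x| + |y.2| * |pd2 f x| := by
        rw [← abs_mul, ← abs_mul]; exact abs_add_le _ _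
    _ ≤ ‖y‖ * |pd1 f x| + ‖y‖ * |pd2 f x| := by gcongr
    _ = _ := by ring

lemma pd1_congr {s : Set Pt} (hs : IsOpen s) (h : EqOn f g s) (hx : x ∈ s) : pd1 f x = pd1 g x := by
  rw [pd1, pd1, (h.eventuallyEq_of_mem (hs.mem_nhds hx)).fderiv_eq]

lemma pd2_congr {s : Set Pt} (hs : IsOpen s) (h : EqOn f g s) (hx : x ∈ s) : pd2 f x = pd2 g x := by
  rw [pd2, pd2, (h.eventuallyEq_of_mem (hs.mem_nhds hx)).fderiv_eq]

end pd

section C2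
variable {f : Pt → ℝ} {s : Set Pt}

lemma contDiffOn_pd1 {m n : WithTop ℕ∞} (hs : IsOpen s) (hf : ContDiffOn ℝ n f s)
    (h : m + 1 ≤ n) : ContDiffOn ℝ m (pd1 f) s :=
  (hf.fderiv_of_isOpen hs h).clm_apply contDiffOn_const

lemma contDiffOn_pd2 {m n : WithTop ℕ∞} (hs : IsOpen s) (hf : ContDiffOn ℝ n f s)
    (h : m + 1 ≤ n) : ContDiffOn ℝ m (pd2 f) s :=
  (hf.fderiv_of_isOpen hs h).clm_apply contDiffOn_const

lemma pd_comm (hs : IsOpen s) (hf : ContDiffOn ℝ 2 f s) {x : Pt} (hx : x ∈ s) :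
    pd2 (pd1 f) x = pd1 (pd2 f) x := by
  have h2 : ContDiffAt ℝ 2 f x := hf.contDiffAt (hs.mem_nhds hx)
  have hd : DifferentiableAt ℝ (fderiv ℝ f) x :=
    (h2.fderiv_right (m := 1) (by norm_num)).differentiableAt (by norm_num)
  have hsym := h2.isSymmSndFDerivAt (by simp)
  have e (v w : Pt) : fderiv ℝ (fun y => fderiv ℝ f y v) x w = fderiv ℝ (fderiv ℝ f) x w v := by
    have := (hd.hasFDerivAt.clm_apply (hasFDerivAt_const v x)).fderiv
    rw [this]; simp
  change fderiv ℝ (fun y => fderiv ℝ f y (1, 0)) x (0, 1) =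
    fderiv ℝ (fun y => fderiv ℝ f y (0, 1)) x (1, 0)
  rw [e, e]
  exact hsym _ _

end C2

section UpTo
variable {f g : Pt → ℝ} {K : Set Pt}

lemma UpTo.differentiableAt (h : UpTo 1 f K) {x : Pt} (hx : x ∈ K) : DifferentiableAt ℝ f x := by
  obtain ⟨U, hU, hKU, hf⟩ := h
  exact (hf.contDiffAt (hU.mem_nhds (hKU hx))).differentiableAt (by norm_num)

lemma UpTo.continuousOn (h : UpTo 1 f K) : ContinuousOn f K :=
  fun _ hx => (h.differentiableAt hx).continuousAt.continuousWithinAt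

lemma UpTo.continuousOn_pd1 (h : UpTo 1 f K) : ContinuousOn (pd1 f) K := by
  obtain ⟨U, hU, hKU, hf⟩ := h
  exact (contDiffOn_pd1 (m := 0) hU hf (by simp)).continuousOn.mono hKU

lemma UpTo.continuousOn_pd2 (h : UpTo 1 f K) : ContinuousOn (pd2 f) K := by
  obtain ⟨U, hU, hKU, hf⟩ := h
  exact (contDiffOn_pd2 (m := 0) hU hf (by simp)).continuousOn.mono hKU

lemma UpTo.contDiffOn (h : UpTo 1 f K) : ContDiffOn ℝ 1 f K := by
  obtain ⟨U, hU, hKU, hf⟩ := h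
  exact hf.mono hKU

lemma UpTo.sub (hf : UpTo 1 f K) (hg : UpTo 1 g K) : UpTo 1 (fun x => f x - g x) K := by
  obtain ⟨U, hU, hKU, hf⟩ := hf
  obtain ⟨V, hV, hKV, hg⟩ := hg
  exact ⟨U ∩ V, hU.inter hV, subset_inter hKU hKV,
    (hf.mono inter_subset_left).sub (hg.mono inter_subset_right)⟩

lemma UpTo.mul (hf : UpTo 1 f K) (hg : UpTo 1 g K) : UpTo 1 (fun x => f x * g x) K := by
  obtain ⟨U, hU, hKU, hf⟩ := hf
  obtain ⟨V, hV, hKV, hg⟩ := hg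
  exact ⟨U ∩ V, hU.inter hV, subset_inter hKU hKV,
    (hf.mono inter_subset_left).mul (hg.mono inter_subset_right)⟩

lemma ContDiff.upTo (hf : ContDiff ℝ 1 f) : UpTo 1 f K :=
  ⟨univ, isOpen_univ, subset_univ _, hf.contDiffOn⟩

end UpTo

/-! ### The singular weight near the walls -/

/-- weight bounding the second derivatives of the potentials near the walls -/
def wt (α t : ℝ) : ℝ := 1 + t ^ (α - 1) + (1 - t) ^ (α - 1)

lemma one_le_wt {α t : ℝ} (ht : t ∈ Ioo (0 : ℝ) 1) : 1 ≤ wt α t := by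
  have h1 : 0 ≤ t ^ (α - 1) := rpow_nonneg ht.1.le _
  have h2 : 0 ≤ (1 - t) ^ (α - 1) := rpow_nonneg (by linarith [ht.2]) _
  unfold wt; linarith

lemma continuousOn_wt (α : ℝ) : ContinuousOn (wt α) (Ioo 0 1) := by
  unfold wt
  refine ((continuousOn_const).add ?_).add ?_
  · exact continuousOn_id.rpow_const fun t ht => Or.inl ht.1.ne'
  · exact (continuousOn_const.sub continuousOn_id).rpow_const
      fun t ht => Or.inl (by simpa [sub_eq_zero] using ht.2.ne')

lemma integrableOn_wt_sq {α : ℝ} (hα : 1 / 2 < α) :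
    IntegrableOn (fun t => wt α t ^ 2) (Ioo 0 1) := by
  have hr : -1 < 2 * α - 2 := by linarith
  have i1 : IntervalIntegrable (fun t : ℝ => t ^ (2 * α - 2)) volume 0 1 :=
    intervalIntegral.intervalIntegrable_rpow' hr
  have i2 : IntervalIntegrable (fun t : ℝ => (1 - t) ^ (2 * α - 2)) volume 0 1 := by
    simpa using (i1.comp_sub_left 1).symm
  have i3 := ((intervalIntegrable_const (c := (1 : ℝ))).add (i1.add i2)).const_mul 3
  rw [intervalIntegrable_iff_integrableOn_Ioo_of_le zero_le_one] at i3
  refine Integrable.mono' i3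
    (((continuousOn_wt α).pow 2).aestronglyMeasurable measurableSet_Ioo) ?_
  filter_upwards [ae_restrict_mem measurableSet_Ioo] with t ht
  have e1 : t ^ (2 * α - 2) = (t ^ (α - 1)) ^ 2 := by
    rw [← rpow_natCast, ← rpow_mul ht.1.le]; congr 1; push_cast; ring
  have e2 : (1 - t) ^ (2 * α - 2) = ((1 - t) ^ (α - 1)) ^ 2 := by
    rw [← rpow_natCast, ← rpow_mul (by linarith [ht.2])]; congr 1; push_cast; ring
  rw [norm_of_nonneg (by positivity)]
  simp only [e1, e2, wt]
  nlinarith [sq_nonneg (1 - t ^ (α - 1)), sq_nonneg (1 - (1 - t) ^ (α - 1)),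
    sq_nonneg (t ^ (α - 1) - (1 - t) ^ (α - 1))]

lemma integrableOn_snd {L : ℝ} {f : ℝ → ℝ} (hf : IntegrableOn f (Ioo 0 1)) :
    IntegrableOn (fun x : Pt => f x.2) (Noz L) := by
  rw [IntegrableOn, Noz, Measure.volume_eq_prod, ← Measure.prod_restrict]
  exact Integrable.comp_snd hf _

lemma integrableOn_wt_sq_snd {α L : ℝ} (hα : 1 / 2 < α) :
    IntegrableOn (fun x : Pt => wt α x.2 ^ 2) (Noz L) :=
  integrableOn_snd (integrableOn_wt_sq hα)

lemma integrableOn_of_le_wt {α L c : ℝ} (hα : 1 / 2 < α) {D : Pt → ℝ}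
    (hD : ContinuousOn D (Noz L)) (hc : ∀ x ∈ Noz L, |D x| ≤ c * wt α x.2) :
    IntegrableOn D (Noz L) := by
  refine Integrable.mono' ((integrableOn_wt_sq_snd hα).const_mul |c|)
    (hD.aestronglyMeasurable (isOpen_Noz L).measurableSet) ?_
  filter_upwards [ae_restrict_mem (isOpen_Noz L).measurableSet] with x hx
  have h1 := one_le_wt (α := α) hx.2
  rw [norm_eq_abs]
  calc |D x| ≤ c * wt α x.2 := hc x hx
    _ ≤ |c| * wt α x.2 := by gcongr; exact le_abs_self c
    _ ≤ |c| * wt α x.2 ^ 2 := by gcongr; nlinarith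

lemma integrableOn_wt_sq_mul {α L : ℝ} (hα : 1 / 2 < α) {f : Pt → ℝ}
    (hf : ContinuousOn f (Rect L)) : IntegrableOn (fun x => wt α x.2 ^ 2 * f x) (Noz L) := by
  obtain ⟨c, hc⟩ := (isCompact_Rect L).exists_bound_of_continuousOn hf
  refine Integrable.mul_bdd (c := c) (integrableOn_wt_sq_snd hα)
    ((hf.mono (Noz_subset_Rect L)).aestronglyMeasurable (isOpen_Noz L).measurableSet) ?_
  filter_upwards [ae_restrict_mem (isOpen_Noz L).measurableSet] with x hx
  exact hc x (Noz_subset_Rect L hx)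

lemma setIntegral_Noz {L : ℝ} {f : Pt → ℝ} (hf : IntegrableOn f (Noz L)) :
    ∫ x in Noz L, f x = ∫ a in Ioo 0 L, ∫ t in (0 : ℝ)..1, f (a, t) := by
  rw [Noz, Measure.volume_eq_prod, setIntegral_prod]
  · simp_rw [intervalIntegral.integral_of_le zero_le_one, ← integral_Ioc_eq_integral_Ioo]
  · rwa [← Measure.volume_eq_prod]

/-- One-dimensional Sobolev inequality on vertical slices. -/
lemma sq_le_slice {L : ℝ} {f : Pt → ℝ} (hf : UpTo 1 f (Rect L)) {x : Pt} (hx : x ∈ Rect L) :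
    f x ^ 2 ≤ 2 * ∫ t in (0 : ℝ)..1, (f (x.1, t) ^ 2 + pd2 f (x.1, t) ^ 2) := by
  have cf := hf.continuousOn
  have cd := hf.continuousOn_pd2
  set I := ∫ t in (0 : ℝ)..1, (f (x.1, t) ^ 2 + pd2 f (x.1, t) ^ 2) with hI
  have ci := intervalIntegrable_slice (f := fun y => f y ^ 2 + pd2 f y ^ 2)
    ((cf.pow 2).add (cd.pow 2)) hx.1
  have cfi := intervalIntegrable_slice (f := fun y => f y ^ 2) (cf.pow 2) hx.1
  have hder : ∀ t ∈ Icc (0 : ℝ) 1,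
      HasDerivAt (fun t => f (x.1, t) ^ 2) (2 * f (x.1, t) * pd2 f (x.1, t)) t := by
    intro t ht
    have h1 := (hf.differentiableAt (x := (x.1, t)) ⟨hx.1, ht⟩).hasFDerivAt
    have h2 : HasDerivAt (fun t : ℝ => ((x.1, t) : Pt)) (0, 1) t :=
      (hasDerivAt_const t x.1).prodMk (hasDerivAt_id t)
    have h3 : HasDerivAt (fun t => f (x.1, t)) (pd2 f (x.1, t)) t := h1.comp_hasDerivAt t h2
    simpa using h3.fun_pow 2
  have hpt : ∀ t ∈ Icc (0 : ℝ) 1, f x ^ 2 ≤ f (x.1, t) ^ 2 + I := by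
    intro t ht
    have hsub : uIcc t x.2 ⊆ Icc 0 1 := uIcc_subset_Icc ht hx.2
    have hsub' : uIoc t x.2 ⊆ Ioc 0 1 := by
      intro r hr
      rw [uIoc, mem_Ioc] at hr
      exact ⟨lt_of_le_of_lt (le_min ht.1 hx.2.1) hr.1, hr.2.trans (max_le ht.2 hx.2.2)⟩
    have hftc := intervalIntegral.integral_eq_sub_of_hasDerivAt
      (fun r hr => hder r (hsub hr))
      (((((continuousOn_const (c := (2 : ℝ))).mul cf).mul cd).comp
        (f := fun r : ℝ => ((x.1, r) : Pt)) (by fun_prop)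
        fun r hr => ⟨hx.1, hsub hr⟩).intervalIntegrable)
    have hle : |∫ r in t..x.2, 2 * f (x.1, r) * pd2 f (x.1, r)| ≤ I := by
      rw [hI, intervalIntegral.integral_of_le zero_le_one]
      rw [← norm_eq_abs, intervalIntegral.norm_intervalIntegral_eq]
      refine (norm_integral_le_integral_norm _).trans ?_
      have hi1 : IntegrableOn (fun t => f (x.1, t) ^ 2 + pd2 f (x.1, t) ^ 2) (Ioc 0 1) :=
        (intervalIntegrable_iff_integrableOn_Ioc_of_le zero_le_one).1 ci
      refine le_trans (integral_mono_of_nonneg (Filter.Eventually.of_forall fun _ => norm_nonneg _)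
        (hi1.mono_set hsub') (Filter.Eventually.of_forall fun r => ?_)) ?_
      · simp only [norm_eq_abs]
        rw [abs_le]
        constructor <;> nlinarith [sq_nonneg (f (x.1, r) - pd2 f (x.1, r)),
          sq_nonneg (f (x.1, r) + pd2 f (x.1, r))]
      · exact setIntegral_mono_set hi1 (Filter.Eventually.of_forall fun r => by positivity)
          hsub'.eventuallyLE
    have := (abs_le.1 hle).2
    have hxx : f (x.1, x.2) = f x := rfl
    rw [hftc, hxx] at this
    linarith
  have h1 : ∫ t in (0 : ℝ)..1, f x ^ 2 ≤ ∫ t in (0 : ℝ)..1, (f (x.1, t) ^ 2 + I) :=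
    intervalIntegral.integral_mono_on zero_le_one intervalIntegrable_const
      (cfi.add intervalIntegrable_const) hpt
  rw [intervalIntegral.integral_add cfi intervalIntegrable_const] at h1
  simp only [intervalIntegral.integral_const, sub_zero, one_smul] at h1
  have h2 : ∫ t in (0 : ℝ)..1, f (x.1, t) ^ 2 ≤ I :=
    intervalIntegral.integral_mono_on zero_le_one cfi ci fun t _ => by
      nlinarith [sq_nonneg (pd2 f (x.1, t))]
  linarith

lemma weighted_sq_le {α L : ℝ} (hα : 1 / 2 < α) {f : Pt → ℝ}
    (hf : UpTo 1 f (Rect L)) :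
    ∫ x in Noz L, wt α x.2 ^ 2 * f x ^ 2 ≤
      2 * (∫ t in Ioo 0 1, wt α t ^ 2) * ∫ x in Noz L, (f x ^ 2 + pd2 f x ^ 2) := by
  have cf := hf.continuousOn
  have cd := hf.continuousOn_pd2
  have hi : IntegrableOn (fun x => f x ^ 2 + pd2 f x ^ 2) (Noz L) :=
    integrableOn_Noz ((cf.pow 2).add (cd.pow 2))
  set F : ℝ → ℝ := fun a => 2 * ∫ t in (0 : ℝ)..1, (f (a, t) ^ 2 + pd2 f (a, t) ^ 2) with hF
  have hFi : IntegrableOn F (Ioo 0 L) := by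
    have h := hi
    rw [IntegrableOn, Noz, Measure.volume_eq_prod, ← Measure.prod_restrict] at h
    have h' := h.integral_prod_left.const_mul 2
    refine h'.congr (Filter.Eventually.of_forall fun a => ?_)
    simp only [hF, intervalIntegral.integral_of_le zero_le_one, integral_Ioc_eq_integral_Ioo]
  have hprod : IntegrableOn (fun x : Pt => F x.1 * wt α x.2 ^ 2) (Noz L) := by
    rw [IntegrableOn, Noz, Measure.volume_eq_prod, ← Measure.prod_restrict]
    exact hFi.mul_prod (integrableOn_wt_sq hα)
  calc ∫ x in Noz L, wt α x.2 ^ 2 * f x ^ 2 ≤ ∫ x in Noz L, F x.1 * wt α x.2 ^ 2 := by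
        refine setIntegral_mono_on (integrableOn_wt_sq_mul hα (cf.pow 2)) hprod
          (isOpen_Noz L).measurableSet fun x hx => ?_
        rw [mul_comm]
        gcongr
        exact sq_le_slice hf (Noz_subset_Rect L hx)
    _ = (∫ a in Ioo 0 L, F a) * ∫ t in Ioo 0 1, wt α t ^ 2 := by
        rw [Noz, Measure.volume_eq_prod]
        exact setIntegral_prod_mul F (fun t => wt α t ^ 2) _ _
    _ = _ := by
        rw [setIntegral_Noz hi]
        simp only [hF, integral_const_mul]
        ring

/-- Poincaré inequality for functions vanishing on the entrance. -/
lemma poincare_left {L : ℝ} (hL : 0 < L) {f : Pt → ℝ} (hf : UpTo 1 f (Rect L))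
    (h0 : ∀ t ∈ Icc (0 : ℝ) 1, f (0, t) = 0) :
    ∫ x in Noz L, f x ^ 2 ≤ 4 * L ^ 2 * ∫ x in Noz L, pd1 f x ^ 2 := by
  have cf := hf.continuousOn
  have cd := hf.continuousOn_pd1
  have hw : UpTo 1 (fun x : Pt => L - x.1) (Rect L) := ContDiff.upTo (by fun_prop)
  have hff := hf.mul hf
  have hi1 : IntegrableOn (fun x => f x ^ 2) (Noz L) := integrableOn_Noz (cf.pow 2)
  have hi2 : IntegrableOn (fun x => pd1 f x ^ 2) (Noz L) := integrableOn_Noz (cd.pow 2)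
  have hi3 : IntegrableOn (fun x => (L - x.1) * (2 * f x * pd1 f x) - f x ^ 2) (Noz L) :=
    integrableOn_Noz (((hw.continuousOn).mul ((continuousOn_const.mul cf).mul cd)).sub (cf.pow 2))
  have key := integral_div hL (f := fun x => (L - x.1) * (f x * f x)) (h := fun _ => 0)
    (D := fun x => (L - x.1) * (2 * f x * pd1 f x) - f x ^ 2) (hw.mul hff).continuousOn
    continuousOn_const (fun x hx => (hw.mul hff).differentiableAt (Noz_subset_Rect L hx))
    (fun x _ => differentiableAt_const _) (fun x hx => by
      have hx' := Noz_subset_Rect L hx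
      have e : pd1 (fun y : Pt => L - y.1) x = -1 := by
        rw [pd1_fst (φ := fun t => L - t) (by fun_prop)]; simp
      rw [pd1_mul (hw.differentiableAt hx') (hff.differentiableAt hx'),
        pd1_mul (hf.differentiableAt hx') (hf.differentiableAt hx'), e]
      simp [pd2]
      ring) hi3 (fun _ _ => rfl) (fun _ _ => rfl)
  have hb0 : ∫ t in (0 : ℝ)..1, (L - ((0, t) : Pt).1) * (f (0, t) * f (0, t)) = 0 := by
    rw [intervalIntegral.integral_congr (g := fun _ => (0 : ℝ))]
    · simp
    · intro t ht
      rw [uIcc_of_le zero_le_one] at ht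
      simp [h0 t ht]
  simp only [sub_self, zero_mul, intervalIntegral.integral_zero, hb0] at key
  have hle : ∫ x in Noz L, ((L - x.1) * (2 * f x * pd1 f x) - f x ^ 2) ≤
      ∫ x in Noz L, (2 * L ^ 2 * pd1 f x ^ 2 - 1 / 2 * f x ^ 2) := by
    refine setIntegral_mono_on hi3 ((hi2.const_mul _).sub (hi1.const_mul _))
      (isOpen_Noz L).measurableSet fun x hx => ?_
    have h1 := hx.1.1
    have h2 := hx.1.2
    have h3 : (L - x.1) ^ 2 ≤ L ^ 2 := by nlinarith
    nlinarith [sq_nonneg (f x - 2 * (L - x.1) * pd1 f x),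
      mul_le_mul_of_nonneg_right h3 (sq_nonneg (pd1 f x))]
  rw [key, integral_sub (hi2.const_mul _) (hi1.const_mul _), integral_const_mul,
    integral_const_mul] at hle
  linarith

lemma trace_right {L : ℝ} (hL : 0 < L) {f : Pt → ℝ} (hf : UpTo 1 f (Rect L))
    (h0 : ∀ t ∈ Icc (0 : ℝ) 1, f (0, t) = 0) :
    ∫ t in (0 : ℝ)..1, f (L, t) ^ 2 ≤ (4 * L ^ 2 + 1) * ∫ x in Noz L, pd1 f x ^ 2 := by
  have cf := hf.continuousOn
  have cd := hf.continuousOn_pd1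
  have hff := hf.mul hf
  have hi1 : IntegrableOn (fun x => f x ^ 2) (Noz L) := integrableOn_Noz (cf.pow 2)
  have hi2 : IntegrableOn (fun x => pd1 f x ^ 2) (Noz L) := integrableOn_Noz (cd.pow 2)
  have hi3 : IntegrableOn (fun x => 2 * f x * pd1 f x) (Noz L) :=
    integrableOn_Noz ((continuousOn_const.mul cf).mul cd)
  have key := integral_div hL (f := fun x => f x * f x) (h := fun _ => 0)
    (D := fun x => 2 * f x * pd1 f x) hff.continuousOn
    continuousOn_const (fun x hx => hff.differentiableAt (Noz_subset_Rect L hx))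
    (fun x _ => differentiableAt_const _) (fun x hx => by
      have hx' := Noz_subset_Rect L hx
      rw [pd1_mul (hf.differentiableAt hx') (hf.differentiableAt hx')]
      simp [pd2]
      ring) hi3 (fun _ _ => rfl) (fun _ _ => rfl)
  have hb0 : ∫ t in (0 : ℝ)..1, f (0, t) * f (0, t) = 0 := by
    rw [intervalIntegral.integral_congr (g := fun _ => (0 : ℝ))]
    · simp
    · intro t ht
      rw [uIcc_of_le zero_le_one] at ht
      simp [h0 t ht]
  have hle : ∫ x in Noz L, 2 * f x * pd1 f x ≤ ∫ x in Noz L, (f x ^ 2 + pd1 f x ^ 2) :=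
    setIntegral_mono_on hi3 (hi1.add hi2) (isOpen_Noz L).measurableSet fun x _ => by
      nlinarith [sq_nonneg (f x - pd1 f x)]
  rw [integral_add hi1 hi2, key, hb0, sub_zero] at hle
  simp only [← pow_two] at hle
  have := poincare_left hL hf h0
  linarith

/-- Poincaré inequality for functions vanishing on the walls. -/
lemma poincare_wall {L : ℝ} (hL : 0 < L) {f : Pt → ℝ} (hf : UpTo 1 f (Rect L))
    (h0 : ∀ t ∈ Icc (0 : ℝ) L, f (t, 0) = 0) :
    ∫ x in Noz L, f x ^ 2 ≤ 4 * ∫ x in Noz L, pd2 f x ^ 2 := by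
  have cf := hf.continuousOn
  have cd := hf.continuousOn_pd2
  have hw : UpTo 1 (fun x : Pt => 1 - x.2) (Rect L) := ContDiff.upTo (by fun_prop)
  have hff := hf.mul hf
  have hi1 : IntegrableOn (fun x => f x ^ 2) (Noz L) := integrableOn_Noz (cf.pow 2)
  have hi2 : IntegrableOn (fun x => pd2 f x ^ 2) (Noz L) := integrableOn_Noz (cd.pow 2)
  have hi3 : IntegrableOn (fun x => (1 - x.2) * (2 * f x * pd2 f x) - f x ^ 2) (Noz L) :=
    integrableOn_Noz (((hw.continuousOn).mul ((continuousOn_const.mul cf).mul cd)).sub (cf.pow 2))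
  have key := integral_div hL (h := fun x => (1 - x.2) * (f x * f x)) (f := fun _ => 0)
    (D := fun x => (1 - x.2) * (2 * f x * pd2 f x) - f x ^ 2) continuousOn_const
    (hw.mul hff).continuousOn (fun x _ => differentiableAt_const _)
    (fun x hx => (hw.mul hff).differentiableAt (Noz_subset_Rect L hx)) (fun x hx => by
      have hx' := Noz_subset_Rect L hx
      have e : pd2 (fun y : Pt => 1 - y.2) x = -1 := by
        rw [pd2_snd (φ := fun t => 1 - t) (by fun_prop)]; simp
      rw [pd2_mul (hw.differentiableAt hx') (hff.differentiableAt hx'),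
        pd2_mul (hf.differentiableAt hx') (hf.differentiableAt hx'), e]
      simp [pd1]
      ring) hi3 (fun t ht => by simp [h0 t ht]) (fun _ _ => by simp)
  simp only [intervalIntegral.integral_zero, sub_zero] at key
  have hle : ∫ x in Noz L, ((1 - x.2) * (2 * f x * pd2 f x) - f x ^ 2) ≤
      ∫ x in Noz L, (2 * pd2 f x ^ 2 - 1 / 2 * f x ^ 2) := by
    refine setIntegral_mono_on hi3 ((hi2.const_mul _).sub (hi1.const_mul _))
      (isOpen_Noz L).measurableSet fun x hx => ?_
    have h1 := hx.2.1
    have h2 := hx.2.2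
    have h3 : (1 - x.2) ^ 2 ≤ 1 := by nlinarith
    nlinarith [sq_nonneg (f x - 2 * (1 - x.2) * pd2 f x),
      mul_le_mul_of_nonneg_right h3 (sq_nonneg (pd2 f x))]
  rw [key, integral_sub (hi2.const_mul _) (hi1.const_mul _), integral_const_mul,
    integral_const_mul] at hle
  linarith

/-! ### Functions with weighted gradient bounds -/

/-- `f` is continuous on the rectangle, `C¹` inside, bounded by `c`, with gradient bounded by
`d` times the weight. -/
structure Reg (α L c d : ℝ) (f : Pt → ℝ) : Prop where
  cont : ContinuousOn f (Rect L)
  smooth : ContDiffOn ℝ 1 f (Noz L)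
  bound : ∀ x ∈ Noz L, |f x| ≤ c
  grad : ∀ x ∈ Noz L, ‖fderiv ℝ f x‖ ≤ d * wt α x.2

section Reg
variable {α L c d c' d' : ℝ} {f h : Pt → ℝ}

lemma Reg.differentiableAt (hf : Reg α L c d f) {x : Pt} (hx : x ∈ Noz L) :
    DifferentiableAt ℝ f x :=
  (hf.smooth.contDiffAt ((isOpen_Noz L).mem_nhds hx)).differentiableAt (by norm_num)

lemma Reg.mono (hf : Reg α L c d f) (hc : c ≤ c') (hd : d ≤ d') : Reg α L c' d' f :=
  ⟨hf.cont, hf.smooth, fun x hx => (hf.bound x hx).trans hc, fun x hx => (hf.grad x hx).trans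
    (mul_le_mul_of_nonneg_right hd (zero_le_one.trans (one_le_wt hx.2)))⟩

lemma Reg.add (hf : Reg α L c d f) (hh : Reg α L c' d' h) :
    Reg α L (c + c') (d + d') (fun x => f x + h x) where
  cont := hf.cont.add hh.cont
  smooth := hf.smooth.add hh.smooth
  bound x hx := (abs_add_le _ _).trans (add_le_add (hf.bound x hx) (hh.bound x hx))
  grad x hx := by
    rw [fderiv_fun_add (hf.differentiableAt hx) (hh.differentiableAt hx), add_mul]
    exact (norm_add_le _ _).trans (add_le_add (hf.grad x hx) (hh.grad x hx))

lemma Reg.mul (hf : Reg α L c d f) (hh : Reg α L c' d' h) :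
    Reg α L (c * c') (c * d' + c' * d) (fun x => f x * h x) where
  cont := hf.cont.mul hh.cont
  smooth := hf.smooth.mul hh.smooth
  bound x hx := by
    rw [abs_mul]
    exact mul_le_mul (hf.bound x hx) (hh.bound x hx) (abs_nonneg _)
      ((abs_nonneg _).trans (hf.bound x hx))
  grad x hx := by
    rw [fderiv_fun_mul (hf.differentiableAt hx) (hh.differentiableAt hx), add_mul]
    refine (norm_add_le _ _).trans (add_le_add ?_ ?_)
    · rw [norm_smul, norm_eq_abs, mul_assoc]
      exact mul_le_mul (hf.bound x hx) (hh.grad x hx) (norm_nonneg _)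
        ((abs_nonneg _).trans (hf.bound x hx))
    · rw [norm_smul, norm_eq_abs, mul_assoc]
      exact mul_le_mul (hh.bound x hx) (hf.grad x hx) (norm_nonneg _)
        ((abs_nonneg _).trans (hh.bound x hx))

lemma Reg.inv {m : ℝ} (hm : 0 < m) (hf : Reg α L c d f) (hl : ∀ x ∈ Rect L, m ≤ f x) :
    Reg α L m⁻¹ (d / m ^ 2) (fun x => (f x)⁻¹) where
  cont := hf.cont.inv₀ fun x hx => (hm.trans_le (hl x hx)).ne'
  smooth := hf.smooth.inv fun x hx => (hm.trans_le (hl x (Noz_subset_Rect L hx))).ne'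
  bound x hx := by
    have := hl x (Noz_subset_Rect L hx)
    rw [abs_inv, abs_of_pos (hm.trans_le this)]
    exact inv_anti₀ hm this
  grad x hx := by
    have h1 := hl x (Noz_subset_Rect L hx)
    have h2 := hm.trans_le h1
    have := (hasDerivAt_inv h2.ne').comp_hasFDerivAt x (hf.differentiableAt hx).hasFDerivAt
    have e : fderiv ℝ (fun x => (f x)⁻¹) x = -(f x ^ 2)⁻¹ • fderiv ℝ f x := this.fderiv
    rw [e, norm_smul, norm_neg, norm_inv, norm_eq_abs, abs_of_pos (pow_pos h2 2)]
    calc (f x ^ 2)⁻¹ * ‖fderiv ℝ f x‖ ≤ (m ^ 2)⁻¹ * (d * wt α x.2) := by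
          gcongr
          exact hf.grad x hx
      _ = d / m ^ 2 * wt α x.2 := by ring

lemma Reg.abs_pd1_le (hf : Reg α L c d f) {x : Pt} (hx : x ∈ Noz L) : |pd1 f x| ≤ d * wt α x.2 :=
  _root_.abs_pd1_le.trans (hf.grad x hx)

lemma Reg.abs_pd2_le (hf : Reg α L c d f) {x : Pt} (hx : x ∈ Noz L) : |pd2 f x| ≤ d * wt α x.2 :=
  _root_.abs_pd2_le.trans (hf.grad x hx)

end Reg

/-! ### Pointwise estimates for the gas law -/

section Gas
variable {γ 𝔭 cv : ℝ}

lemma Hfun_eq_exp (hγ : 1 < γ) (h𝔭 : 0 < 𝔭) {S ζ : ℝ} (hζ : 0 < ζ) :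
    Hfun γ 𝔭 cv S ζ = exp ((log ((γ - 1) / (γ * 𝔭)) + log ζ - S / cv) / (γ - 1)) := by
  have h1 : 0 < γ - 1 := by linarith
  have h2 : 0 < (γ - 1) / (γ * 𝔭) := by positivity
  have e : (γ - 1) * ζ / (γ * 𝔭 * exp (S / cv)) = (γ - 1) / (γ * 𝔭) * ζ / exp (S / cv) := by
    field_simp
  rw [Hfun, e, rpow_def_of_pos (by positivity), log_div (by positivity) (exp_pos _).ne',
    log_mul h2.ne' hζ.ne', log_exp, mul_one_div]

lemma Hfun_pos (hγ : 1 < γ) (h𝔭 : 0 < 𝔭) {S ζ : ℝ} (hζ : 0 < ζ) : 0 < Hfun γ 𝔭 cv S ζ := by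
  rw [Hfun_eq_exp hγ h𝔭 hζ]; exact exp_pos _

lemma hasDerivAt_Hfun (hγ : 1 < γ) (h𝔭 : 0 < 𝔭) {S ζ : ℝ} (hζ : 0 < ζ) :
    HasDerivAt (Hfun γ 𝔭 cv S) (Hfun γ 𝔭 cv S ζ / ((γ - 1) * ζ)) ζ := by
  have h : HasDerivAt
      (fun ζ => exp ((log ((γ - 1) / (γ * 𝔭)) + log ζ - S / cv) / (γ - 1))) _ ζ :=
    (((((hasDerivAt_log hζ.ne').const_add (log ((γ - 1) / (γ * 𝔭)))).sub_const
      (S / cv)).div_const (γ - 1)).exp)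
  refine (h.congr_of_eventuallyEq ?_).congr_deriv ?_
  · filter_upwards [lt_mem_nhds hζ] with y hy using Hfun_eq_exp hγ h𝔭 hy
  · rw [Hfun_eq_exp hγ h𝔭 hζ]; field_simp

lemma Tfun_Hfun (hγ : 1 < γ) (h𝔭 : 0 < 𝔭) {S ζ : ℝ} (hζ : 0 < ζ) :
    Tfun γ 𝔭 cv (Hfun γ 𝔭 cv S ζ) S = cv / γ * ζ := by
  have h1 : 0 < γ - 1 := by linarith
  have e := exp_pos (S / cv)
  rw [Tfun, Hfun, ← rpow_mul (by positivity), one_div_mul_cancel h1.ne', rpow_one]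
  field_simp

lemma contDiffOn_Hfun (hγ : 1 < γ) (h𝔭 : 0 < 𝔭) {s : Set Pt} (hs : ∀ p ∈ s, 0 < p.2) :
    ContDiffOn ℝ 1 (fun p : Pt => Hfun γ 𝔭 cv p.1 p.2) s := by
  have : ContDiffOn ℝ 1
      (fun p : Pt => exp ((log ((γ - 1) / (γ * 𝔭)) + log p.2 - p.1 / cv) / (γ - 1))) s := by
    refine ContDiffOn.exp (ContDiffOn.div_const (ContDiffOn.sub (contDiffOn_const.add ?_) ?_) _)
    · exact contDiffOn_snd.log fun p hp => (hs p hp).ne'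
    · exact contDiffOn_fst.div_const _
  exact this.congr fun p hp => Hfun_eq_exp hγ h𝔭 (hs p hp)

lemma Hfun_box (hγ : 1 < γ) (h𝔭 : 0 < 𝔭) (S₀ : ℝ) {z₁ z₂ : ℝ} (hz : 0 < z₁) (hz' : z₁ ≤ z₂) :
    ∃ r > 0, ∃ Λ > 0, ∀ S ζ, |S - S₀| ≤ 1 → z₁ ≤ ζ → ζ ≤ z₂ →
      r ≤ Hfun γ 𝔭 cv S ζ ∧ Hfun γ 𝔭 cv S ζ ≤ Λ ∧ ∀ S' ζ', |S' - S₀| ≤ 1 → z₁ ≤ ζ' → ζ' ≤ z₂ →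
        |Hfun γ 𝔭 cv S ζ - Hfun γ 𝔭 cv S' ζ'| ≤ Λ * (|S - S'| + |ζ - ζ'|) := by
  set B : Set Pt := Icc (S₀ - 1) (S₀ + 1) ×ˢ Icc z₁ z₂ with hB
  have hBc : IsCompact B := isCompact_Icc.prod isCompact_Icc
  have hcv : Convex ℝ B := (convex_Icc _ _).prod (convex_Icc _ _)
  have hcd := contDiffOn_Hfun (cv := cv) hγ h𝔭 (s := B) fun p hp => hz.trans_le hp.2.1
  obtain ⟨k, hk⟩ := hcd.exists_lipschitzOnWith (by norm_num) hcv hBc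
  obtain ⟨C, hC⟩ := hBc.exists_bound_of_continuousOn hcd.continuousOn
  have hne : B.Nonempty := ⟨(S₀, z₁), ⟨by simp, by simpa⟩⟩
  obtain ⟨p, hp, hmin⟩ := hBc.exists_isMinOn hne hcd.continuousOn
  have hmem {S ζ : ℝ} (hS : |S - S₀| ≤ 1) (h1 : z₁ ≤ ζ) (h2 : ζ ≤ z₂) : ((S, ζ) : Pt) ∈ B := by
    rw [abs_le] at hS
    exact ⟨⟨by simp only; linarith, by simp only; linarith⟩, h1, h2⟩
  refine ⟨_, Hfun_pos (cv := cv) (S := p.1) hγ h𝔭 (hz.trans_le hp.2.1), max 1 (max C k),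
    by positivity, fun S ζ hS h1 h2 => ⟨hmin (hmem hS h1 h2), ?_, fun S' ζ' hS' h1' h2' => ?_⟩⟩
  · exact ((le_abs_self _).trans (hC _ (hmem hS h1 h2))).trans
      ((le_max_left _ _).trans (le_max_right _ _))
  · have := hk.dist_le_mul _ (hmem hS h1 h2) _ (hmem hS' h1' h2')
    rw [dist_eq, Prod.dist_eq, dist_eq, dist_eq] at this
    refine this.trans (mul_le_mul ((le_max_right _ _).trans (le_max_right _ _)) ?_ (by positivity)
      (by positivity))
    exact max_le (le_add_of_nonneg_right (abs_nonneg _)) (le_add_of_nonneg_left (abs_nonneg _))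

/-- Strong monotonicity of `(u, v, Φ) ↦ (ρu, ρv, ρ)` in the subsonic region. -/
lemma subsonic_monotone (hγ : 1 < γ) (h𝔭 : 0 < 𝔭) {S K Φ u v Φ' u' v' h ν Z : ℝ} (hν : 0 < ν)
    (hh : 0 < h)
    (hbox : ∀ ζ, ν / (γ - 1) ≤ ζ → ζ ≤ Z → h ≤ Hfun γ 𝔭 cv S ζ / ((γ - 1) * ζ))
    (hs : ν ≤ (γ - 1) * (K + Φ - (u ^ 2 + v ^ 2) / 2) - (u ^ 2 + v ^ 2))
    (hs' : ν ≤ (γ - 1) * (K + Φ' - (u' ^ 2 + v' ^ 2) / 2) - (u' ^ 2 + v' ^ 2))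
    (hZ : K + Φ ≤ Z) (hZ' : K + Φ' ≤ Z) :
    h * ((Φ - Φ') ^ 2 + ν * ((u - u') ^ 2 + (v - v') ^ 2)) ≤
      (Hfun γ 𝔭 cv S (K + Φ - (u ^ 2 + v ^ 2) / 2) * u -
        Hfun γ 𝔭 cv S (K + Φ' - (u' ^ 2 + v' ^ 2) / 2) * u') * (u - u') +
      (Hfun γ 𝔭 cv S (K + Φ - (u ^ 2 + v ^ 2) / 2) * v -
        Hfun γ 𝔭 cv S (K + Φ' - (u' ^ 2 + v' ^ 2) / 2) * v') * (v - v') +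
      (Hfun γ 𝔭 cv S (K + Φ - (u ^ 2 + v ^ 2) / 2) -
        Hfun γ 𝔭 cv S (K + Φ' - (u' ^ 2 + v' ^ 2) / 2)) * (Φ - Φ') := by
  have hg : 0 < γ - 1 := by linarith
  set a := u - u' with ha
  set b := v - v' with hb
  set χ := Φ - Φ' with hχ
  let U : ℝ → ℝ := fun θ => u' + θ * a
  let V : ℝ → ℝ := fun θ => v' + θ * b
  let z : ℝ → ℝ := fun θ => K + (Φ' + θ * χ) - (U θ ^ 2 + V θ ^ 2) / 2
  let f : ℝ → ℝ := fun θ => Hfun γ 𝔭 cv S (z θ) * (U θ * a + V θ * b + χ)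
  have dU (θ) : HasDerivAt U a θ :=
    ((hasDerivAt_mul_const a).const_add u')
  have dV (θ) : HasDerivAt V b θ :=
    ((hasDerivAt_mul_const b).const_add v')
  have dz (θ) : HasDerivAt z (χ - (U θ * a + V θ * b)) θ := by
    have : HasDerivAt z _ θ := ((((hasDerivAt_mul_const χ).const_add Φ').const_add K)).sub
      ((((dU θ).fun_pow 2).add ((dV θ).fun_pow 2)).div_const 2)
    refine this.congr_deriv ?_
    simp; ring
  have hsub : ∀ θ ∈ Icc (0 : ℝ) 1, ν ≤ (γ - 1) * z θ - (U θ ^ 2 + V θ ^ 2) := by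
    intro θ hθ
    have h0 : 0 ≤ θ * (1 - θ) := mul_nonneg hθ.1 (by linarith [hθ.2])
    have e : (γ - 1) * z θ - (U θ ^ 2 + V θ ^ 2) =
        θ * ((γ - 1) * (K + Φ - (u ^ 2 + v ^ 2) / 2) - (u ^ 2 + v ^ 2)) +
        (1 - θ) * ((γ - 1) * (K + Φ' - (u' ^ 2 + v' ^ 2) / 2) - (u' ^ 2 + v' ^ 2)) +
        (γ + 1) / 2 * (θ * (1 - θ)) * (a ^ 2 + b ^ 2) := by
      simp only [z, U, V, ha, hb, hχ]; ring
    have h1 : 0 ≤ (γ + 1) / 2 * (θ * (1 - θ)) * (a ^ 2 + b ^ 2) := by positivity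
    rw [e]
    nlinarith [mul_le_mul_of_nonneg_left hs hθ.1,
      mul_le_mul_of_nonneg_left hs' (sub_nonneg.2 hθ.2)]
  have hzl : ∀ θ ∈ Icc (0 : ℝ) 1, ν / (γ - 1) ≤ z θ := by
    intro θ hθ
    rw [div_le_iff₀ hg]
    nlinarith [hsub θ hθ, sq_nonneg (U θ), sq_nonneg (V θ)]
  have hzu : ∀ θ ∈ Icc (0 : ℝ) 1, z θ ≤ Z := by
    intro θ hθ
    have : K + (Φ' + θ * χ) ≤ Z := by
      simp only [hχ]
      nlinarith [mul_le_mul_of_nonneg_left hZ hθ.1,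
        mul_le_mul_of_nonneg_left hZ' (sub_nonneg.2 hθ.2)]
    have h2 := sq_nonneg (U θ)
    have h3 := sq_nonneg (V θ)
    simp only [z]; linarith
  have hz0 : ∀ θ ∈ Icc (0 : ℝ) 1, 0 < z θ := fun θ hθ => (div_pos hν hg).trans_le (hzl θ hθ)
  have df : ∀ θ ∈ Icc (0 : ℝ) 1, HasDerivAt f
      (Hfun γ 𝔭 cv S (z θ) / ((γ - 1) * z θ) * (χ - (U θ * a + V θ * b)) * (U θ * a + V θ * b + χ)
        + Hfun γ 𝔭 cv S (z θ) * (a * a + b * b)) θ := fun θ hθ =>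
    ((hasDerivAt_Hfun hγ h𝔭 (hz0 θ hθ)).comp θ (dz θ)).mul
      ((((dU θ).mul_const a).add ((dV θ).mul_const b)).add_const χ)
  obtain ⟨θ, hθ, hslope⟩ := exists_hasDerivAt_eq_slope f _ zero_lt_one
    (fun θ hθ => (df θ hθ).continuousAt.continuousWithinAt)
    (fun θ hθ => df θ (Ioo_subset_Icc_self hθ))
  have hθ' := Ioo_subset_Icc_self hθ
  have hb' := hbox (z θ) (hzl θ hθ') (hzu θ hθ')
  have hzp := hz0 θ hθ'
  have hsu := mul_le_mul_of_nonneg_right (hsub θ hθ') (by positivity : 0 ≤ a ^ 2 + b ^ 2)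
  have hf1 : f 1 - f 0 = (Hfun γ 𝔭 cv S (K + Φ - (u ^ 2 + v ^ 2) / 2) * u -
        Hfun γ 𝔭 cv S (K + Φ' - (u' ^ 2 + v' ^ 2) / 2) * u') * a +
      (Hfun γ 𝔭 cv S (K + Φ - (u ^ 2 + v ^ 2) / 2) * v -
        Hfun γ 𝔭 cv S (K + Φ' - (u' ^ 2 + v' ^ 2) / 2) * v') * b +
      (Hfun γ 𝔭 cv S (K + Φ - (u ^ 2 + v ^ 2) / 2) -
        Hfun γ 𝔭 cv S (K + Φ' - (u' ^ 2 + v' ^ 2) / 2)) * χ := by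
    have e1 : U 1 = u := by simp [U, ha]
    have e2 : V 1 = v := by simp [V, hb]
    have e3 : U 0 = u' := by simp [U]
    have e4 : V 0 = v' := by simp [V]
    have e5 : z 1 = K + Φ - (u ^ 2 + v ^ 2) / 2 := by simp [z, e1, e2, hχ]
    have e6 : z 0 = K + Φ' - (u' ^ 2 + v' ^ 2) / 2 := by simp [z, e3, e4]
    simp only [f, e1, e2, e3, e4, e5, e6]
    ring
  rw [← hf1]
  rw [sub_zero, div_one] at hslope
  rw [← hslope]
  clear hslope hf1 df hz0 hzl hzu hsub dz dU dV
  generalize U θ = U₁ at *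
  generalize V θ = V₁ at *
  generalize z θ = z₁ at *
  have hgz : 0 < (γ - 1) * z₁ := by positivity
  generalize hq : Hfun γ 𝔭 cv S z₁ / ((γ - 1) * z₁) = q at *
  have hHq : Hfun γ 𝔭 cv S z₁ = q * ((γ - 1) * z₁) := by rw [← hq, div_mul_cancel₀ _ hgz.ne']
  rw [hHq]
  have hcs : (U₁ * a + V₁ * b) ^ 2 ≤ (U₁ ^ 2 + V₁ ^ 2) * (a ^ 2 + b ^ 2) := by
    nlinarith [sq_nonneg (U₁ * b - V₁ * a)]
  have hin : χ ^ 2 + ν * (a ^ 2 + b ^ 2) ≤ χ ^ 2 - (U₁ * a + V₁ * b) ^ 2 +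
      (γ - 1) * z₁ * (a ^ 2 + b ^ 2) := by nlinarith
  calc h * (χ ^ 2 + ν * (a ^ 2 + b ^ 2)) ≤ q * (χ ^ 2 + ν * (a ^ 2 + b ^ 2)) := by gcongr
    _ ≤ q * (χ ^ 2 - (U₁ * a + V₁ * b) ^ 2 + (γ - 1) * z₁ * (a ^ 2 + b ^ 2)) :=
      mul_le_mul_of_nonneg_left hin (hh.le.trans hb')
    _ = _ := by ring

/-- Equal pressures at entropies `S, S'` force nearby enthalpies. -/
lemma abs_sub_le_of_pressure (hγ : 1 < γ) (h𝔭 : 0 < 𝔭) (hcv : 0 < cv) {S ζ S' ζ' Z : ℝ}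
    (hζ : 0 < ζ) (hζ' : 0 < ζ') (hZ : ζ ≤ Z) (hZ' : ζ' ≤ Z)
    (h : 𝔭 * exp (S / cv) * Hfun γ 𝔭 cv S ζ ^ γ = 𝔭 * exp (S' / cv) * Hfun γ 𝔭 cv S' ζ' ^ γ) :
    |ζ - ζ'| ≤ Z / (γ * cv) * |S - S'| := by
  have hg : 0 < γ - 1 := by linarith
  have hγ0 : 0 < γ := by linarith
  have hZ0 : 0 < Z := hζ.trans_le hZ
  have hl (S ζ : ℝ) (hζ : 0 < ζ) : log (𝔭 * exp (S / cv) * Hfun γ 𝔭 cv S ζ ^ γ) =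
      log 𝔭 + S / cv +
        γ * ((log ((γ - 1) / (γ * 𝔭)) + log ζ - S / cv) / (γ - 1)) := by
    rw [log_mul (by positivity) (rpow_pos_of_pos (Hfun_pos hγ h𝔭 hζ) _).ne',
      log_mul h𝔭.ne' (exp_pos _).ne', log_exp, log_rpow (Hfun_pos hγ h𝔭 hζ),
      Hfun_eq_exp hγ h𝔭 hζ, log_exp]
  have h2 := congrArg log h
  rw [hl S ζ hζ, hl S' ζ' hζ'] at h2
  have h3 : log ζ - log ζ' = (S - S') / (γ * cv) := by
    field_simp at h2 ⊢
    linarith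
  have hlog (a b : ℝ) (ha : 0 < a) (hb : 0 < b) (haZ : a ≤ Z) :
      a - b ≤ Z * |log a - log b| := by
    have h4 := log_le_sub_one_of_pos (div_pos hb ha)
    rw [log_div hb.ne' ha.ne'] at h4
    have h5 : a - b ≤ a * (log a - log b) := by
      have : a * (log b - log a) ≤ a * (b / a - 1) := by gcongr
      have e : a * (b / a - 1) = b - a := by field_simp
      linarith
    calc a - b ≤ a * (log a - log b) := h5
      _ ≤ a * |log a - log b| := by gcongr; exact le_abs_self _
      _ ≤ _ := by gcongr
  have h6 := hlog ζ ζ' hζ hζ' hZ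
  have h7 := hlog ζ' ζ hζ' hζ hZ'
  rw [abs_sub_comm (log ζ')] at h7
  have e : Z * |log ζ - log ζ'| = Z / (γ * cv) * |S - S'| := by
    rw [h3, abs_div, abs_of_pos (by positivity : 0 < γ * cv)]; ring
  rw [← e]
  exact abs_le.2 ⟨by linarith, h6⟩

end Gas

/-- Pointwise bounds for a uniformly subsonic state with enthalpy variable `z`. -/
structure SubsonicState (γ S₀ ν m M S K Φ u v z : ℝ) : Prop where
  z_eq : z = K + Φ - (u ^ 2 + v ^ 2) / 2
  entropy : |S - S₀| ≤ 1
  subsonic : ν ≤ (γ - 1) * z - (u ^ 2 + v ^ 2)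
  energy_le : K + Φ ≤ M
  le_u : m ≤ u
  u_le : u ≤ M
  abs_v_le : |v| ≤ 1

/-- Pointwise comparison of two states. -/
structure StateComparison (c C S K Φ u v z r S' K' Φ' u' v' z' r' : ℝ) : Prop where
  le_r : c ≤ r
  r_le : r ≤ C
  le_r' : c ≤ r'
  r'_le : r' ≤ C
  monotone : c * ((u - u') ^ 2 + (v - v') ^ 2 + (Φ - Φ') ^ 2) -
      C * ((S - S') ^ 2 + (K - K') ^ 2) ≤
    (r * u - r' * u') * (u - u') + (r * v - r' * v') * (v - v') + (r - r') * (Φ - Φ')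
  flux₁ : |r * u - r' * u'| ≤ C * (|S - S'| + |K - K'| + |Φ - Φ'| + |u - u'| + |v - v'|)
  flux₂ : |r * v - r' * v'| ≤ C * (|S - S'| + |K - K'| + |Φ - Φ'| + |u - u'| + |v - v'|)
  quot : |z / u - z' / u'| ≤ C * (|S - S'| + |K - K'| + |Φ - Φ'| + |u - u'| + |v - v'|)
  inv : |1 / u - 1 / u'| ≤ C * (|S - S'| + |K - K'| + |Φ - Φ'| + |u - u'| + |v - v'|)

lemma add_three_sq_le (a b c : ℝ) : (a + b + c) ^ 2 ≤ 3 * (a ^ 2 + b ^ 2 + c ^ 2) := by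
  nlinarith [sq_nonneg (a - b), sq_nonneg (a - c), sq_nonneg (b - c)]

lemma mul_le_weighted_sq {c : ℝ} (hc : 0 < c) (A T Y : ℝ) :
    A * T * Y ≤ c / 6 * Y ^ 2 + 3 / (2 * c) * A ^ 2 * T ^ 2 := by
  have : 0 ≤ c / 6 * (Y - 3 / c * A * T) ^ 2 := by positivity
  have e : c / 6 * (Y - 3 / c * A * T) ^ 2 = c / 6 * Y ^ 2 - A * T * Y +
      3 / (2 * c) * A ^ 2 * T ^ 2 := by field_simp; ring
  linarith

section Gas
variable {γ 𝔭 cv : ℝ}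

lemma SubsonicState.le_z {S₀ ν m M S K Φ u v z : ℝ} (hγ : 1 < γ)
    (h : SubsonicState γ S₀ ν m M S K Φ u v z) : ν / (γ - 1) ≤ z := by
  rw [div_le_iff₀ (by linarith)]
  nlinarith [h.subsonic, sq_nonneg u, sq_nonneg v]

lemma SubsonicState.z_le {S₀ ν m M S K Φ u v z : ℝ}
    (h : SubsonicState γ S₀ ν m M S K Φ u v z) : z ≤ M := by
  nlinarith [h.z_eq, h.energy_le, sq_nonneg u, sq_nonneg v]

lemma SubsonicState.abs_sub_z_le {S₀ ν m M S K Φ u v z S' K' Φ' u' v' z' : ℝ} (hm : 0 < m)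
    (hM : 1 ≤ M) (h : SubsonicState γ S₀ ν m M S K Φ u v z)
    (h' : SubsonicState γ S₀ ν m M S' K' Φ' u' v' z') :
    |z - z'| ≤ M * (|K - K'| + |Φ - Φ'| + |u - u'| + |v - v'|) := by
  have e : z - z' = (K - K') + (Φ - Φ') - (u + u') / 2 * (u - u') - (v + v') / 2 * (v - v') := by
    rw [h.z_eq, h'.z_eq]; ring
  have hu : |(u + u') / 2| ≤ M := abs_le.2 ⟨by linarith [h.le_u, h'.le_u], by
    linarith [h.u_le, h'.u_le]⟩
  have hv : |(v + v') / 2| ≤ M := by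
    have h1 := abs_le.1 h.abs_v_le
    have h2 := abs_le.1 h'.abs_v_le
    exact abs_le.2 ⟨by linarith, by linarith⟩
  calc |z - z'| ≤ |K - K'| + |Φ - Φ'| + |(u + u') / 2| * |u - u'| + |(v + v') / 2| * |v - v'| := by
        rw [e, ← abs_mul, ← abs_mul]
        exact (abs_sub _ _).trans (by gcongr; exact (abs_sub _ _).trans (by
          gcongr; exact abs_add_le _ _))
    _ ≤ M * |K - K'| + M * |Φ - Φ'| + M * |u - u'| + M * |v - v'| := by
        gcongr <;> exact le_mul_of_one_le_left (abs_nonneg _) hM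
    _ = _ := by ring

set_option maxHeartbeats 1000000 in
/-- Uniform comparison of nearby uniformly subsonic states. -/
lemma exists_stateComparison (hγ : 1 < γ) (h𝔭 : 0 < 𝔭) (S₀ : ℝ) {ν m M : ℝ} (hν : 0 < ν)
    (hm : 0 < m) (hM : 1 ≤ M) :
    ∃ c > 0, ∃ C > 0, ∀ S K Φ u v z S' K' Φ' u' v' z',
      SubsonicState γ S₀ ν m M S K Φ u v z → SubsonicState γ S₀ ν m M S' K' Φ' u' v' z' →
      (γ - 1) * |K - K'| ≤ ν / 2 →
      StateComparison c C S K Φ u v z (Hfun γ 𝔭 cv S z) S' K' Φ' u' v' z'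
        (Hfun γ 𝔭 cv S' z') := by
  have hg : 0 < γ - 1 := by linarith
  have hM0 : 0 < M := by linarith
  set z₁ := ν / 2 / (γ - 1) with hz₁
  have hz₁0 : 0 < z₁ := by positivity
  have hzz : ν / (γ - 1) = 2 * z₁ := by rw [hz₁]; ring
  obtain ⟨r₁, hr₁, Λ, hΛ, hbox⟩ := Hfun_box (cv := cv) hγ h𝔭 S₀ hz₁0
    (by linarith : z₁ ≤ M + z₁)
  set h := r₁ / ((γ - 1) * (M + z₁)) with hh
  have hh0 : 0 < h := by positivity
  set c₀ := h * min 1 (ν / 2) with hc₀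
  have hc₀0 : 0 < c₀ := by positivity
  set C₁ := Λ + M * (Λ * M) + (M * M + M) / m ^ 2 + 1 / m ^ 2 with hC₁
  have hC₁0 : 0 < C₁ := by positivity
  refine ⟨min (c₀ / 2) r₁, by positivity, C₁ + 3 / c₀ * (Λ * M) ^ 2 + 1, by positivity, ?_⟩
  intro S K Φ u v z S' K' Φ' u' v' z' P P' hk
  have hkz : |K - K'| ≤ z₁ := by rw [hz₁, le_div_iff₀ hg]; linarith
  have hk' := abs_le.1 hkz
  have hzl := P.le_z hγ
  have hzl' := P'.le_z hγ
  have hzu := P.z_le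
  have hzu' := P'.z_le
  rw [hzz] at hzl hzl'
  have hu := P.le_u
  have hu' := P'.le_u
  have huM := P.u_le
  have huM' := P'.u_le
  obtain ⟨hr1, hr2, hr3⟩ := hbox S z P.entropy (by linarith) (by linarith)
  obtain ⟨hr1', hr2', -⟩ := hbox S' z' P'.entropy (by linarith) (by linarith)
  have hdz := P.abs_sub_z_le hm hM P'
  have hdr := hr3 S' z' P'.entropy (by linarith) (by linarith)
  have hρ := hr3 S' (z - (K - K')) P'.entropy (by linarith) (by linarith)
  rw [sub_sub_cancel] at hρ
  have hsub : ν / 2 ≤ (γ - 1) * (K' + Φ - (u ^ 2 + v ^ 2) / 2) - (u ^ 2 + v ^ 2) := by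
    have h1 := mul_le_mul_of_nonneg_left (le_abs_self (K - K')) hg.le
    have h2 := P.subsonic
    rw [show K' + Φ - (u ^ 2 + v ^ 2) / 2 = z - (K - K') by rw [P.z_eq]; ring]
    linarith
  have hsub' : ν / 2 ≤ (γ - 1) * (K' + Φ' - (u' ^ 2 + v' ^ 2) / 2) - (u' ^ 2 + v' ^ 2) := by
    rw [← P'.z_eq]
    linarith [P'.subsonic]
  have hmono := subsonic_monotone (cv := cv) (S := S') (K := K') (Φ := Φ) (u := u) (v := v)
    (Φ' := Φ') (u' := u') (v' := v') (ν := ν / 2) (Z := M + z₁) (h := h) hγ h𝔭 (by positivity) hh0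
    (fun ζ h1 h2 => by
      have hζ0 : 0 < ζ := hz₁0.trans_le h1
      have h3 := (hbox S' ζ P'.entropy h1 h2).1
      exact div_le_div₀ (hr₁.le.trans h3) h3 (by positivity) (by gcongr))
    hsub hsub' (by linarith [P.energy_le]) (by linarith [P'.energy_le])
  rw [show K' + Φ - (u ^ 2 + v ^ 2) / 2 = z - (K - K') by rw [P.z_eq]; ring, ← P'.z_eq] at hmono
  have hav := P.abs_v_le
  have hav' := P'.abs_v_le
  generalize Hfun γ 𝔭 cv S z = r at *
  generalize Hfun γ 𝔭 cv S' z' = r' at *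
  generalize Hfun γ 𝔭 cv S' (z - (K - K')) = ρ at *
  set D := |S - S'| + |K - K'| + |Φ - Φ'| + |u - u'| + |v - v'| with hD
  have hD0 : 0 ≤ D := by positivity
  have a1 := abs_nonneg (S - S')
  have a2 := abs_nonneg (K - K')
  have a3 := abs_nonneg (Φ - Φ')
  have a4 := abs_nonneg (u - u')
  have a5 := abs_nonneg (v - v')
  have hdz2 : |z - z'| ≤ M * (D - |S - S'|) := by
    refine hdz.trans_eq ?_; rw [hD]; ring
  have hdr2 : |r - r'| ≤ Λ * M * D := by
    refine hdr.trans ?_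
    rw [mul_assoc]
    gcongr
    have h1 := le_mul_of_one_le_left a1 hM
    linarith
  have hr0 : 0 < r := by linarith
  have hr0' : 0 < r' := by linarith
  have hu0 : 0 < u := by linarith
  have hu0' : 0 < u' := by linarith
  have hz0' : 0 < z' := by linarith
  have hCC : C₁ * D ≤ (C₁ + 3 / c₀ * (Λ * M) ^ 2 + 1) * D := by
    gcongr
    have : 0 ≤ 3 / c₀ * (Λ * M) ^ 2 := by positivity
    linarith
  have hΛC : Λ ≤ C₁ := by
    rw [hC₁]
    have : 0 ≤ M * (Λ * M) + (M * M + M) / m ^ 2 + 1 / m ^ 2 := by positivity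
    linarith
  have h3c : 0 ≤ 3 / c₀ * (Λ * M) ^ 2 := by positivity
  refine ⟨(min_le_right _ _).trans hr1, by linarith, (min_le_right _ _).trans hr1', by linarith,
    ?_, ?_, ?_, ?_, ?_⟩
  · set P₁ := (u - u') ^ 2 + (v - v') ^ 2 + (Φ - Φ') ^ 2 with hP₁
    set T := |S - S'| + |K - K'| with hT
    set Y := |u - u'| + |v - v'| + |Φ - Φ'| with hY
    have hP₁0 : 0 ≤ P₁ := by positivity
    have i1 : c₀ * P₁ ≤ h * ((Φ - Φ') ^ 2 + ν / 2 * ((u - u') ^ 2 + (v - v') ^ 2)) := by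
      rw [hc₀, mul_assoc]
      gcongr
      have j1 : min 1 (ν / 2) * (Φ - Φ') ^ 2 ≤ 1 * (Φ - Φ') ^ 2 := by
        gcongr; exact min_le_left _ _
      have j2 : min 1 (ν / 2) * ((u - u') ^ 2 + (v - v') ^ 2) ≤
          ν / 2 * ((u - u') ^ 2 + (v - v') ^ 2) := by
        gcongr; exact min_le_right _ _
      rw [hP₁]; linarith
    have i2 : |(r - ρ) * (u * (u - u') + v * (v - v') + (Φ - Φ'))| ≤ Λ * T * (M * Y) := by
      rw [abs_mul]
      gcongr
      calc |u * (u - u') + v * (v - v') + (Φ - Φ')|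
          ≤ |u| * |u - u'| + |v| * |v - v'| + |Φ - Φ'| := by
            rw [← abs_mul, ← abs_mul]; exact abs_add_three _ _ _
        _ ≤ M * |u - u'| + M * |v - v'| + M * |Φ - Φ'| := by
            gcongr
            · rwa [abs_of_pos hu0]
            · linarith
            · exact le_mul_of_one_le_left a3 hM
        _ = M * Y := by rw [hY]; ring
    have i3 : T ^ 2 ≤ 2 * ((S - S') ^ 2 + (K - K') ^ 2) := by
      rw [hT, ← sq_abs (S - S'), ← sq_abs (K - K')]
      exact add_sq_le
    have i4 : Y ^ 2 ≤ 3 * P₁ := by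
      rw [hY, hP₁, ← sq_abs (u - u'), ← sq_abs (v - v'), ← sq_abs (Φ - Φ')]
      exact add_three_sq_le _ _ _
    have i5 := mul_le_weighted_sq hc₀0 (Λ * M) T Y
    rw [show Λ * M * T * Y = Λ * T * (M * Y) by ring] at i5
    have i6 : c₀ / 6 * Y ^ 2 ≤ c₀ / 6 * (3 * P₁) := by gcongr
    have i7 : 3 / (2 * c₀) * (Λ * M) ^ 2 * T ^ 2 ≤
        3 / (2 * c₀) * (Λ * M) ^ 2 * (2 * ((S - S') ^ 2 + (K - K') ^ 2)) := by gcongr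
    have e7 : 3 / (2 * c₀) * (Λ * M) ^ 2 * (2 * ((S - S') ^ 2 + (K - K') ^ 2)) =
        3 / c₀ * (Λ * M) ^ 2 * ((S - S') ^ 2 + (K - K') ^ 2) := by field_simp
    have i8 : min (c₀ / 2) r₁ * P₁ ≤ c₀ / 2 * P₁ := by gcongr; exact min_le_left _ _
    have i9 : 3 / c₀ * (Λ * M) ^ 2 * ((S - S') ^ 2 + (K - K') ^ 2) ≤
        (C₁ + 3 / c₀ * (Λ * M) ^ 2 + 1) * ((S - S') ^ 2 + (K - K') ^ 2) := by
      gcongr; linarith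
    have i10 := (abs_le.1 i2).1
    have e : (r * u - r' * u') * (u - u') + (r * v - r' * v') * (v - v') + (r - r') * (Φ - Φ') =
        ((ρ * u - r' * u') * (u - u') + (ρ * v - r' * v') * (v - v') + (ρ - r') * (Φ - Φ')) +
        (r - ρ) * (u * (u - u') + v * (v - v') + (Φ - Φ')) := by ring
    rw [e]
    linarith
  · refine le_trans ?_ hCC
    have e : r * u - r' * u' = r * (u - u') + (r - r') * u' := by ring
    rw [e]
    calc |r * (u - u') + (r - r') * u'| ≤ |r| * |u - u'| + |r - r'| * |u'| := by
          rw [← abs_mul, ← abs_mul]; exact abs_add_le _ _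
      _ ≤ Λ * D + Λ * M * D * M := by
          rw [abs_of_pos hr0, abs_of_pos hu0']
          gcongr
          linarith
      _ ≤ C₁ * D := by
          have : 0 ≤ ((M * M + M) / m ^ 2 + 1 / m ^ 2) * D := by positivity
          rw [hC₁]; linarith
  · refine le_trans ?_ hCC
    have e : r * v - r' * v' = r * (v - v') + (r - r') * v' := by ring
    rw [e]
    calc |r * (v - v') + (r - r') * v'| ≤ |r| * |v - v'| + |r - r'| * |v'| := by
          rw [← abs_mul, ← abs_mul]; exact abs_add_le _ _
      _ ≤ Λ * D + Λ * M * D * M := by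
          rw [abs_of_pos hr0]
          gcongr
          · linarith
          · linarith
      _ ≤ C₁ * D := by
          have : 0 ≤ ((M * M + M) / m ^ 2 + 1 / m ^ 2) * D := by positivity
          rw [hC₁]; linarith
  · refine le_trans ?_ hCC
    have e : z / u - z' / u' = ((z - z') * u' - z' * (u - u')) / (u * u') := by
      field_simp; ring
    rw [e, abs_div, abs_of_pos (mul_pos hu0 hu0')]
    calc |(z - z') * u' - z' * (u - u')| / (u * u')
        ≤ (M * D * M + M * D) / (m * m) := by
          gcongr
          refine (abs_sub _ _).trans ?_
          rw [abs_mul, abs_mul, abs_of_pos hu0', abs_of_pos hz0']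
          gcongr
          · exact hdz2.trans (by gcongr; linarith)
          · linarith
      _ ≤ C₁ * D := by
          have : 0 ≤ (Λ + M * (Λ * M) + 1 / m ^ 2) * D := by positivity
          have e2 : (M * D * M + M * D) / (m * m) = (M * M + M) / m ^ 2 * D := by ring
          rw [hC₁, e2]; linarith
  · refine le_trans ?_ hCC
    have e : 1 / u - 1 / u' = -(u - u') / (u * u') := by
      field_simp; ring
    rw [e, abs_div, abs_of_pos (mul_pos hu0 hu0'), abs_neg]
    calc |u - u'| / (u * u') ≤ D / (m * m) := by
          gcongr
          linarith
      _ ≤ C₁ * D := by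
          have : 0 ≤ (Λ + M * (Λ * M) + (M * M + M) / m ^ 2) * D := by positivity
          have e2 : D / (m * m) = 1 / m ^ 2 * D := by ring
          rw [hC₁, e2]; linarith

/-- At equal potential and equal pressure, the mass flux jump is a tangential velocity jump up to
terms controlled by the entropy and Bernoulli jumps. -/
lemma exists_exit_flux_bound (hγ : 1 < γ) (h𝔭 : 0 < 𝔭) (hcv : 0 < cv) (S₀ : ℝ) {ν m M : ℝ}
    (hν : 0 < ν) (hm : 0 < m) (hM : 1 ≤ M) :
    ∃ C > 0, ∀ S K Φ u v z S' K' Φ' u' v' z',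
      SubsonicState γ S₀ ν m M S K Φ u v z → SubsonicState γ S₀ ν m M S' K' Φ' u' v' z' →
      Φ = Φ' →
      𝔭 * exp (S / cv) * Hfun γ 𝔭 cv S z ^ γ = 𝔭 * exp (S' / cv) * Hfun γ 𝔭 cv S' z' ^ γ →
      |Hfun γ 𝔭 cv S z * u - Hfun γ 𝔭 cv S' z' * u' +
        Hfun γ 𝔭 cv S' z' * (v + v') * (u + u')⁻¹ * (v - v')| ≤ C * (|S - S'| + |K - K'|) := by
  have hg : 0 < γ - 1 := by linarith
  have hM0 : 0 < M := by linarith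
  have hz₁0 : 0 < ν / (γ - 1) := by positivity
  obtain ⟨r₁, hr₁, Λ, hΛ, hbox⟩ := Hfun_box (cv := cv) hγ h𝔭 S₀ hz₁0
    (by linarith : ν / (γ - 1) ≤ M + ν / (γ - 1))
  set q := M / (γ * cv) with hq
  have hq0 : 0 < q := by have : 0 < γ := by linarith
                         positivity
  refine ⟨Λ / m * (1 + q) + M * (Λ * (1 + q)), by positivity, ?_⟩
  intro S K Φ u v z S' K' Φ' u' v' z' P P' hΦ hp
  have hzl := P.le_z hγ
  have hzl' := P'.le_z hγ
  have hzu := P.z_le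
  have hzu' := P'.z_le
  have hu := P.le_u
  have hu' := P'.le_u
  have huM := P.u_le
  obtain ⟨hr1, hr2, hr3⟩ := hbox S z P.entropy (by linarith) (by linarith)
  obtain ⟨hr1', hr2', -⟩ := hbox S' z' P'.entropy (by linarith) (by linarith)
  have hdr := hr3 S' z' P'.entropy (by linarith) (by linarith)
  have hdz := abs_sub_le_of_pressure hγ h𝔭 hcv (hz₁0.trans_le hzl) (hz₁0.trans_le hzl') hzu hzu' hp
  rw [← hq] at hdz
  clear hp
  generalize Hfun γ 𝔭 cv S z = r at *
  generalize Hfun γ 𝔭 cv S' z' = r' at *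
  have hr0' : 0 < r' := by linarith
  have hu0 : 0 < u := by linarith
  have hu0' : 0 < u' := by linarith
  have hz : (u + u') * (u - u') = 2 * ((K - K') - (z - z')) - (v + v') * (v - v') := by
    rw [P.z_eq, P'.z_eq, hΦ]; ring
  have e : r * u - r' * u' + r' * (v + v') * (u + u')⁻¹ * (v - v') =
      r' * (2 / (u + u')) * ((K - K') - (z - z')) + (r - r') * u := by
    have h2 : u - u' = (2 * ((K - K') - (z - z')) - (v + v') * (v - v')) / (u + u') := by
      rw [← hz]; field_simp
    have h3 : r * u - r' * u' = r' * (u - u') + (r - r') * u := by ring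
    rw [h3, h2]; field_simp; ring
  have a1 := abs_nonneg (S - S')
  have a2 := abs_nonneg (K - K')
  set D := |S - S'| + |K - K'| with hD
  have h1 : |(K - K') - (z - z')| ≤ (1 + q) * D := (abs_sub _ _).trans (by nlinarith)
  have h2 : |r - r'| ≤ Λ * (1 + q) * D := hdr.trans (by
    rw [mul_assoc]; gcongr; nlinarith)
  have h3 : 2 / (u + u') ≤ 1 / m := by
    rw [div_le_div_iff₀ (by positivity) hm]; linarith
  rw [e]
  calc |r' * (2 / (u + u')) * ((K - K') - (z - z')) + (r - r') * u|
      ≤ r' * (2 / (u + u')) * |(K - K') - (z - z')| + |r - r'| * u := by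
        refine (abs_add_le _ _).trans ?_
        rw [abs_mul, abs_mul (r - r'), abs_of_pos hu0, abs_of_pos (by positivity :
          0 < r' * (2 / (u + u')))]
    _ ≤ Λ * (1 / m) * ((1 + q) * D) + Λ * (1 + q) * D * M := by gcongr
    _ = _ := by ring

end Gas

/-! ### Energy identities and estimates on the nozzle -/

lemma measurableSet_Noz (L : ℝ) : MeasurableSet (Noz L) := (isOpen_Noz L).measurableSet

lemma abs_setIntegral_Noz_le {L : ℝ} {F G : Pt → ℝ} (hG : IntegrableOn G (Noz L))
    (h : ∀ x ∈ Noz L, |F x| ≤ G x) : |∫ x in Noz L, F x| ≤ ∫ x in Noz L, G x :=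
  norm_integral_le_of_norm_le (f := F) hG <|
    (ae_restrict_iff' (measurableSet_Noz L)).2 (Filter.Eventually.of_forall h)

lemma intervalIntegral_eq_zero {f : ℝ → ℝ} (h : ∀ t ∈ Icc (0 : ℝ) 1, f t = 0) :
    ∫ t in (0 : ℝ)..1, f t = 0 := by
  rw [intervalIntegral.integral_congr (g := fun _ => 0), intervalIntegral.integral_zero]
  intro t ht
  rw [uIcc_of_le zero_le_one] at ht
  exact h t ht

lemma setIntegral_Noz_mono {L : ℝ} {F G : Pt → ℝ} (hF : IntegrableOn F (Noz L))
    (hG : IntegrableOn G (Noz L)) (h : ∀ x ∈ Noz L, F x ≤ G x) :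
    ∫ x in Noz L, F x ≤ ∫ x in Noz L, G x :=
  setIntegral_mono_on hF hG (measurableSet_Noz L) h

lemma setIntegral_Noz_nonneg {L : ℝ} {F : Pt → ℝ} (h : ∀ x ∈ Noz L, 0 ≤ F x) :
    0 ≤ ∫ x in Noz L, F x :=
  setIntegral_nonneg (measurableSet_Noz L) h

lemma abs_mul_le_weighted {η : ℝ} (hη : 0 < η) (a b : ℝ) : |a * b| ≤ η * a ^ 2 + η⁻¹ * b ^ 2 := by
  rw [abs_mul, ← sq_abs a, ← sq_abs b]
  have e : η * |a| ^ 2 + η⁻¹ * |b| ^ 2 - |a| * |b| =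
      η * (|a| - η⁻¹ * |b| / 2) ^ 2 + η⁻¹ * |b| ^ 2 * (3 / 4) := by
    field_simp; ring
  have : 0 ≤ η * (|a| - η⁻¹ * |b| / 2) ^ 2 + η⁻¹ * |b| ^ 2 * (3 / 4) := by positivity
  linarith

section Energy
variable {L : ℝ}

/-- Weak form of the continuity equation. -/
lemma integral_flux (hL : 0 < L) {m₁ m₂ η : Pt → ℝ} (c₁ : ContinuousOn m₁ (Rect L))
    (c₂ : ContinuousOn m₂ (Rect L)) (d₁ : ∀ x ∈ Noz L, DifferentiableAt ℝ m₁ x)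
    (d₂ : ∀ x ∈ Noz L, DifferentiableAt ℝ m₂ x) (hdiv : ∀ x ∈ Noz L, pd1 m₁ x + pd2 m₂ x = 0)
    (hη : UpTo 1 η (Rect L)) (h0 : ∀ t ∈ Icc 0 L, m₂ (t, 0) = 0)
    (h1 : ∀ t ∈ Icc 0 L, m₂ (t, 1) = 0) :
    ∫ x in Noz L, (m₁ x * pd1 η x + m₂ x * pd2 η x) =
      (∫ t in (0 : ℝ)..1, m₁ (L, t) * η (L, t)) - ∫ t in (0 : ℝ)..1, m₁ (0, t) * η (0, t) := by
  have dη (x) (hx : x ∈ Noz L) := hη.differentiableAt (Noz_subset_Rect L hx)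
  refine integral_div hL (f := fun x => m₁ x * η x) (h := fun x => m₂ x * η x)
    (c₁.mul hη.continuousOn) (c₂.mul hη.continuousOn) (fun x hx => (d₁ x hx).mul (dη x hx))
    (fun x hx => (d₂ x hx).mul (dη x hx)) (fun x hx => ?_) ?_ (fun t ht => by simp [h0 t ht])
    (fun t ht => by simp [h1 t ht])
  · rw [pd1_mul (d₁ x hx) (dη x hx), pd2_mul (d₂ x hx) (dη x hx)]
    linear_combination η x * hdiv x hx
  · exact integrableOn_Noz ((c₁.mul hη.continuousOn_pd1).add (c₂.mul hη.continuousOn_pd2))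

/-- Energy estimate for a quantity transported by a positive solenoidal flux. -/
lemma transport_energy (hL : 0 < L) {m₁ m₂ s g h : Pt → ℝ} {c : ℝ}
    (c₁ : ContinuousOn m₁ (Rect L))
    (c₂ : ContinuousOn m₂ (Rect L)) (d₁ : ∀ x ∈ Noz L, DifferentiableAt ℝ m₁ x)
    (d₂ : ∀ x ∈ Noz L, DifferentiableAt ℝ m₂ x) (hdiv : ∀ x ∈ Noz L, pd1 m₁ x + pd2 m₂ x = 0)
    (h0 : ∀ t ∈ Icc 0 L, m₂ (t, 0) = 0) (h1 : ∀ t ∈ Icc 0 L, m₂ (t, 1) = 0)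
    (hs : UpTo 1 s (Rect L)) (hs0 : ∀ t ∈ Icc (0 : ℝ) 1, s (0, t) = 0)
    (hlo : ∀ x ∈ Rect L, c ≤ m₁ x)
    (hg : ∀ x ∈ Noz L, m₁ x * pd1 s x + m₂ x * pd2 s x = g x)
    (hh : ContinuousOn h (Rect L)) (hgh : ∀ x ∈ Noz L, |s x * g x| ≤ h x) :
    c * ((∫ x in Noz L, s x ^ 2) + ∫ t in (0 : ℝ)..1, s (L, t) ^ 2) ≤
      2 * (L + 1) * ∫ x in Noz L, h x := by
  have hθ : UpTo 1 (fun x : Pt => L + 1 - x.1) (Rect L) :=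
    ContDiff.upTo (by fun_prop)
  have hss := hs.mul hs
  have key := integral_flux hL c₁ c₂ d₁ d₂ hdiv (hθ.mul hss) h0 h1
  have z0 : ∫ t in (0 : ℝ)..1, m₁ (0, t) * ((L + 1 - (0, t).1) * (s (0, t) * s (0, t))) = 0 :=
    intervalIntegral_eq_zero fun t ht => by simp [hs0 t ht]
  rw [z0, sub_zero] at key
  have ip : ∀ x ∈ Noz L, m₁ x * pd1 (fun y => (L + 1 - y.1) * (s y * s y)) x +
      m₂ x * pd2 (fun y => (L + 1 - y.1) * (s y * s y)) x ≤ 2 * (L + 1) * h x - c * s x ^ 2 := by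
    intro x hx
    have hx' := Noz_subset_Rect L hx
    have ds := hs.differentiableAt hx'
    have e1 : pd1 (fun y : Pt => L + 1 - y.1) x = -1 := by
      rw [pd1_fst (φ := fun t => L + 1 - t) (by fun_prop)]; simp
    have e2 : pd2 (fun y : Pt => L + 1 - y.1) x = 0 :=
      pd2_fst (φ := fun t => L + 1 - t) (by fun_prop)
    rw [pd1_mul (hθ.differentiableAt hx') (hss.differentiableAt hx'),
      pd2_mul (hθ.differentiableAt hx') (hss.differentiableAt hx'), e1, e2, pd1_mul ds ds,
      pd2_mul ds ds]
    have e : m₁ x * (-1 * (s x * s x) + (L + 1 - x.1) * (pd1 s x * s x + s x * pd1 s x)) +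
        m₂ x * (0 * (s x * s x) + (L + 1 - x.1) * (pd2 s x * s x + s x * pd2 s x)) =
        2 * (L + 1 - x.1) * (s x * g x) - m₁ x * s x ^ 2 := by
      rw [← hg x hx]; ring
    rw [e]
    have hx1 : 0 ≤ L + 1 - x.1 := by linarith [hx'.1.2]
    have hh0 : 0 ≤ h x := (abs_nonneg _).trans (hgh x hx)
    have i1 : (L + 1 - x.1) * (s x * g x) ≤ (L + 1) * h x :=
      calc _ ≤ (L + 1 - x.1) * h x := by gcongr; exact (le_abs_self _).trans (hgh x hx)
        _ ≤ _ := by gcongr; linarith [hx'.1.1]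
    have i2 : c * s x ^ 2 ≤ m₁ x * s x ^ 2 := by gcongr; exact hlo x hx'
    linarith
  have is2 : IntegrableOn (fun x => s x ^ 2) (Noz L) := integrableOn_Noz (hs.continuousOn.pow 2)
  have ih := integrableOn_Noz hh
  have hη := hθ.mul hss
  have idiff : IntegrableOn (fun x => 2 * (L + 1) * h x - c * s x ^ 2) (Noz L) :=
    Integrable.sub (ih.const_mul (2 * (L + 1))) (is2.const_mul c)
  have mono := setIntegral_Noz_mono (F := fun x =>
      m₁ x * pd1 (fun y => (L + 1 - y.1) * (s y * s y)) x +
      m₂ x * pd2 (fun y => (L + 1 - y.1) * (s y * s y)) x)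
    (G := fun x => 2 * (L + 1) * h x - c * s x ^ 2)
    (integrableOn_Noz ((c₁.mul hη.continuousOn_pd1).add (c₂.mul hη.continuousOn_pd2))) idiff ip
  rw [key, integral_sub (ih.const_mul _) (is2.const_mul _), integral_const_mul,
    integral_const_mul] at mono
  have bd : c * ∫ t in (0 : ℝ)..1, s (L, t) ^ 2 ≤
      ∫ t in (0 : ℝ)..1, m₁ (L, t) * ((L + 1 - (L, t).1) * (s (L, t) * s (L, t))) := by
    rw [← intervalIntegral.integral_const_mul]
    have hLm : L ∈ Icc 0 L := ⟨hL.le, le_rfl⟩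
    refine intervalIntegral.integral_mono_on zero_le_one
      ((intervalIntegrable_slice (hs.continuousOn.pow 2) hLm).const_mul c)
      (intervalIntegrable_slice (c₁.mul hη.continuousOn) hLm) fun t ht => ?_
    have := hlo (L, t) (mem_Rect_right hL ht)
    have h2 : c * s (L, t) ^ 2 ≤ m₁ (L, t) * s (L, t) ^ 2 := by gcongr
    simp only [add_sub_cancel_left, one_mul]
    linarith
  linarith

/-- Green's identity for functions with vanishing boundary contribution. -/
lemma integral_grad_sq (hL : 0 < L) {f F : Pt → ℝ} (hf : UpTo 1 f (Rect L))
    (hf2 : ContDiffOn ℝ 2 f (Noz L)) (hF : ContinuousOn F (Rect L))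
    (hlap : ∀ x ∈ Noz L, lap f x = F x) (h0 : ∀ t ∈ Icc 0 L, f (t, 0) * pd2 f (t, 0) = 0)
    (h1 : ∀ t ∈ Icc 0 L, f (t, 1) * pd2 f (t, 1) = 0)
    (hl : ∀ t ∈ Icc (0 : ℝ) 1, f (0, t) * pd1 f (0, t) = 0)
    (hr : ∀ t ∈ Icc (0 : ℝ) 1, f (L, t) * pd1 f (L, t) = 0) :
    ∫ x in Noz L, (pd1 f x ^ 2 + pd2 f x ^ 2) = -∫ x in Noz L, f x * F x := by
  have df (x) (hx : x ∈ Noz L) := hf.differentiableAt (Noz_subset_Rect L hx)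
  have d1 (x) (hx : x ∈ Noz L) : DifferentiableAt ℝ (pd1 f) x :=
    ((contDiffOn_pd1 (isOpen_Noz L) hf2 (m := 1) (by norm_num)).differentiableOn
      (by norm_num)).differentiableAt ((isOpen_Noz L).mem_nhds hx)
  have d2 (x) (hx : x ∈ Noz L) : DifferentiableAt ℝ (pd2 f) x :=
    ((contDiffOn_pd2 (isOpen_Noz L) hf2 (m := 1) (by norm_num)).differentiableOn
      (by norm_num)).differentiableAt ((isOpen_Noz L).mem_nhds hx)
  have ig : IntegrableOn (fun x => pd1 f x ^ 2 + pd2 f x ^ 2) (Noz L) :=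
    integrableOn_Noz ((hf.continuousOn_pd1.pow 2).add (hf.continuousOn_pd2.pow 2))
  have iF : IntegrableOn (fun x => f x * F x) (Noz L) := integrableOn_Noz (hf.continuousOn.mul hF)
  have key := integral_div hL (f := fun x => f x * pd1 f x) (h := fun x => f x * pd2 f x)
    (D := fun x => (pd1 f x ^ 2 + pd2 f x ^ 2) + f x * F x)
    (hf.continuousOn.mul hf.continuousOn_pd1) (hf.continuousOn.mul hf.continuousOn_pd2)
    (fun x hx => (df x hx).mul (d1 x hx)) (fun x hx => (df x hx).mul (d2 x hx))
    (fun x hx => by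
      rw [pd1_mul (df x hx) (d1 x hx), pd2_mul (df x hx) (d2 x hx), ← hlap x hx, lap]; ring)
    (ig.add iF) h0 h1
  rw [intervalIntegral_eq_zero hl, intervalIntegral_eq_zero hr, integral_add ig iF] at key
  linarith

variable {α c d : ℝ}

lemma Reg.contDiffOn_pd {a : Pt → ℝ} (ha : Reg α L c d a) :
    ContinuousOn (pd1 a) (Noz L) ∧ ContinuousOn (pd2 a) (Noz L) :=
  ⟨(contDiffOn_pd1 (m := 0) (isOpen_Noz L) ha.smooth (by norm_num)).continuousOn,
    (contDiffOn_pd2 (m := 0) (isOpen_Noz L) ha.smooth (by norm_num)).continuousOn⟩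

/-- Integration by parts in `x₂` moves the derivative off `s`. -/
lemma abs_integral_mul_pd2_le (hL : 0 < L) (hα : 1 / 2 < α) (hd : 0 ≤ d)
    {a q s : Pt → ℝ} (ha : Reg α L c d a)
    (hq : UpTo 1 q (Rect L)) (hs : UpTo 1 s (Rect L)) (h0 : ∀ t ∈ Icc 0 L, q (t, 0) = 0)
    (h1 : ∀ t ∈ Icc 0 L, q (t, 1) = 0) {η : ℝ} (hη : 0 < η) :
    |∫ x in Noz L, q x * (a x * pd2 s x)| ≤
      η * (1 + 10 * ∫ t in Ioo 0 1, wt α t ^ 2) * (∫ x in Noz L, pd2 q x ^ 2) +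
        η⁻¹ * (c ^ 2 + d ^ 2) * ∫ x in Noz L, s x ^ 2 := by
  have hqs := hq.mul hs
  have iA : IntegrableOn (fun x => q x * (a x * pd2 s x)) (Noz L) :=
    integrableOn_Noz (hq.continuousOn.mul (ha.cont.mul hs.continuousOn_pd2))
  have iB : IntegrableOn (fun x => pd2 q x * (a x * s x)) (Noz L) :=
    integrableOn_Noz (hq.continuousOn_pd2.mul (ha.cont.mul hs.continuousOn))
  have iBA : IntegrableOn (fun x => pd2 q x * (a x * s x) + q x * (a x * pd2 s x)) (Noz L) :=
    iB.add iA
  obtain ⟨N, hN⟩ := (isCompact_Rect L).exists_bound_of_continuousOn hqs.continuousOn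
  have iC : IntegrableOn (fun x => pd2 a x * (q x * s x)) (Noz L) := by
    refine integrableOn_of_le_wt (c := d * N) hα
      (ha.contDiffOn_pd.2.mul (hqs.continuousOn.mono (Noz_subset_Rect L))) fun x hx => ?_
    rw [abs_mul]
    calc |pd2 a x| * |q x * s x| ≤ (d * wt α x.2) * N := by
          gcongr
          · exact mul_nonneg hd (zero_le_one.trans (one_le_wt hx.2))
          · exact ha.abs_pd2_le hx
          · exact hN x (Noz_subset_Rect L hx)
      _ = _ := by ring
  have key := integral_div hL (f := fun _ => 0) (h := fun x => a x * (q x * s x))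
    (D := fun x => pd2 a x * (q x * s x) + (pd2 q x * (a x * s x) + q x * (a x * pd2 s x)))
    continuousOn_const (ha.cont.mul hqs.continuousOn) (fun x _ => differentiableAt_const _)
    (fun x hx => (ha.differentiableAt hx).mul (hqs.differentiableAt (Noz_subset_Rect L hx)))
    (fun x hx => by
      have hx' := Noz_subset_Rect L hx
      rw [pd2_mul (ha.differentiableAt hx) (hqs.differentiableAt hx'),
        pd2_mul (hq.differentiableAt hx') (hs.differentiableAt hx')]
      have : pd1 (fun _ : Pt => (0 : ℝ)) x = 0 := by simp [pd1]
      rw [this]; ring)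
    (iC.add iBA) (fun t ht => by simp [h0 t ht]) (fun t ht => by simp [h1 t ht])
  rw [integral_add iC iBA, integral_add iB iA] at key
  simp only [intervalIntegral.integral_zero, sub_zero] at key
  have is2 : IntegrableOn (fun x => s x ^ 2) (Noz L) := integrableOn_Noz (hs.continuousOn.pow 2)
  have iq2 : IntegrableOn (fun x => q x ^ 2) (Noz L) := integrableOn_Noz (hq.continuousOn.pow 2)
  have ip2 : IntegrableOn (fun x => pd2 q x ^ 2) (Noz L) :=
    integrableOn_Noz (hq.continuousOn_pd2.pow 2)
  have iw2 : IntegrableOn (fun x => wt α x.2 ^ 2 * q x ^ 2) (Noz L) :=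
    integrableOn_wt_sq_mul hα (hq.continuousOn.pow 2)
  have bB : |∫ x in Noz L, pd2 q x * (a x * s x)| ≤
      η * (∫ x in Noz L, pd2 q x ^ 2) + η⁻¹ * c ^ 2 * ∫ x in Noz L, s x ^ 2 := by
    rw [← integral_const_mul, ← integral_const_mul,
      ← integral_add (ip2.const_mul _) (is2.const_mul _)]
    refine abs_setIntegral_Noz_le ((ip2.const_mul _).add (is2.const_mul _)) fun x hx => ?_
    refine (abs_mul_le_weighted hη _ _).trans ?_
    have : a x ^ 2 ≤ c ^ 2 := sq_le_sq' (abs_le.1 (ha.bound x hx)).1 (abs_le.1 (ha.bound x hx)).2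
    rw [mul_pow, ← mul_assoc η⁻¹]
    gcongr
  have bC : |∫ x in Noz L, pd2 a x * (q x * s x)| ≤
      η * (∫ x in Noz L, wt α x.2 ^ 2 * q x ^ 2) + η⁻¹ * d ^ 2 * ∫ x in Noz L, s x ^ 2 := by
    rw [← integral_const_mul, ← integral_const_mul,
      ← integral_add (iw2.const_mul _) (is2.const_mul _)]
    refine abs_setIntegral_Noz_le ((iw2.const_mul _).add (is2.const_mul _)) fun x hx => ?_
    have hw : 0 ≤ wt α x.2 := zero_le_one.trans (one_le_wt hx.2)
    calc |pd2 a x * (q x * s x)| ≤ (d * wt α x.2) * |q x * s x| := by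
          rw [abs_mul]; gcongr; exact ha.abs_pd2_le hx
      _ = |(wt α x.2 * q x) * (d * s x)| := by
          rw [abs_mul, abs_mul, abs_mul (wt α x.2), abs_mul d, abs_of_nonneg hw, abs_of_nonneg hd]
          ring
      _ ≤ _ := (abs_mul_le_weighted hη _ _).trans_eq (by ring)
  have hw := weighted_sq_le hα hq
  have hp := poincare_wall hL hq h0
  rw [integral_add iq2 ip2] at hw
  have hW : 0 ≤ ∫ t in Ioo (0 : ℝ) 1, wt α t ^ 2 := integral_nonneg fun t => sq_nonneg _
  have hw' : ∫ x in Noz L, wt α x.2 ^ 2 * q x ^ 2 ≤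
      10 * (∫ t in Ioo 0 1, wt α t ^ 2) * ∫ x in Noz L, pd2 q x ^ 2 :=
    calc _ ≤ _ := hw
      _ ≤ 2 * (∫ t in Ioo 0 1, wt α t ^ 2) * (4 * (∫ x in Noz L, pd2 q x ^ 2) +
          ∫ x in Noz L, pd2 q x ^ 2) := by gcongr
      _ = _ := by ring
  have hw'' := mul_le_mul_of_nonneg_left hw' hη.le
  have e : ∫ x in Noz L, q x * (a x * pd2 s x) = -(∫ x in Noz L, pd2 a x * (q x * s x)) -
      ∫ x in Noz L, pd2 q x * (a x * s x) := by linarith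
  rw [e]
  refine (abs_sub _ _).trans ?_
  rw [abs_neg]
  linarith

/-- Null-Lagrangian estimate of the exit integral `∫ a w ∂₂w`. -/
lemma abs_exit_integral_le (hL : 0 < L) (hα : 1 / 2 < α) (hd : 0 ≤ d)
    {a w : Pt → ℝ} (ha : Reg α L c d a) (hw : UpTo 1 w (Rect L))
    (hw2 : ContDiffOn ℝ 2 w (Noz L)) (hw0 : ∀ t ∈ Icc (0 : ℝ) 1, w (0, t) = 0)
    (h0 : ∀ t ∈ Icc 0 L, a (t, 0) = 0) (h1 : ∀ t ∈ Icc 0 L, a (t, 1) = 0) :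
    |∫ t in (0 : ℝ)..1, a (L, t) * (w (L, t) * pd2 w (L, t))| ≤
      d * (1 + 2 * (∫ t in Ioo 0 1, wt α t ^ 2) * (4 * L ^ 2 + 1)) *
        ∫ x in Noz L, (pd1 w x ^ 2 + pd2 w x ^ 2) := by
  have dw (x) (hx : x ∈ Noz L) := hw.differentiableAt (Noz_subset_Rect L hx)
  have d1 (x) (hx : x ∈ Noz L) : DifferentiableAt ℝ (pd1 w) x :=
    ((contDiffOn_pd1 (isOpen_Noz L) hw2 (m := 1) (by norm_num)).differentiableOn
      (by norm_num)).differentiableAt ((isOpen_Noz L).mem_nhds hx)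
  have d2 (x) (hx : x ∈ Noz L) : DifferentiableAt ℝ (pd2 w) x :=
    ((contDiffOn_pd2 (isOpen_Noz L) hw2 (m := 1) (by norm_num)).differentiableOn
      (by norm_num)).differentiableAt ((isOpen_Noz L).mem_nhds hx)
  have c1 := hw.continuousOn.mul hw.continuousOn_pd1
  have c2 := hw.continuousOn.mul hw.continuousOn_pd2
  obtain ⟨N₁, hN₁⟩ := (isCompact_Rect L).exists_bound_of_continuousOn c1
  obtain ⟨N₂, hN₂⟩ := (isCompact_Rect L).exists_bound_of_continuousOn c2
  set D : Pt → ℝ := fun x => pd1 a x * (w x * pd2 w x) - pd2 a x * (w x * pd1 w x) with hD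
  have hDc : ContinuousOn D (Noz L) :=
    (ha.contDiffOn_pd.1.mul (c2.mono (Noz_subset_Rect L))).sub
      (ha.contDiffOn_pd.2.mul (c1.mono (Noz_subset_Rect L)))
  have hwt (x) (hx : x ∈ Noz L) : 0 ≤ wt α x.2 := zero_le_one.trans (one_le_wt hx.2)
  have hDle (x) (hx : x ∈ Noz L) : |D x| ≤
      d * wt α x.2 * |w x * pd2 w x| + d * wt α x.2 * |w x * pd1 w x| := by
    refine (abs_sub _ _).trans ?_
    rw [abs_mul, abs_mul (pd2 a x)]
    gcongr
    · exact ha.abs_pd1_le hx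
    · exact ha.abs_pd2_le hx
  have iD : IntegrableOn D (Noz L) := by
    refine integrableOn_of_le_wt (c := d * N₂ + d * N₁) hα hDc fun x hx => (hDle x hx).trans ?_
    have i1 := hN₁ x (Noz_subset_Rect L hx)
    have i2 := hN₂ x (Noz_subset_Rect L hx)
    have hdw : 0 ≤ d * wt α x.2 := mul_nonneg hd (hwt x hx)
    calc _ ≤ d * wt α x.2 * N₂ + d * wt α x.2 * N₁ := by gcongr <;> assumption
      _ = _ := by ring
  have key := integral_div hL (f := fun x => a x * (w x * pd2 w x))
    (h := fun x => -a x * (w x * pd1 w x)) (D := D) (ha.cont.mul c2) (ha.cont.neg.mul c1)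
    (fun x hx => (ha.differentiableAt hx).mul ((dw x hx).mul (d2 x hx)))
    (fun x hx => (ha.differentiableAt hx).neg.mul ((dw x hx).mul (d1 x hx)))
    (fun x hx => by
      have hn : pd2 (fun y => -a y) x = -pd2 a x := by
        simp [pd2, fderiv_fun_neg]
      rw [pd1_mul (ha.differentiableAt hx) ((dw x hx).fun_mul (d2 x hx)),
        pd2_mul (ha.differentiableAt hx).fun_neg ((dw x hx).fun_mul (d1 x hx)),
        pd1_mul (dw x hx) (d2 x hx), pd2_mul (dw x hx) (d1 x hx), hn,
        pd_comm (isOpen_Noz L) hw2 hx]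
      simp only [hD]; ring)
    iD (fun t ht => by simp [h0 t ht]) (fun t ht => by simp [h1 t ht])
  have zero : ∫ t in (0 : ℝ)..1, a (0, t) * (w (0, t) * pd2 w (0, t)) = 0 :=
    intervalIntegral_eq_zero fun t ht => by simp [hw0 t ht]
  rw [zero, sub_zero] at key
  rw [← key]
  have iw2 : IntegrableOn (fun x => wt α x.2 ^ 2 * w x ^ 2) (Noz L) :=
    integrableOn_wt_sq_mul hα (hw.continuousOn.pow 2)
  have i1 : IntegrableOn (fun x => pd1 w x ^ 2) (Noz L) :=
    integrableOn_Noz (hw.continuousOn_pd1.pow 2)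
  have i2 : IntegrableOn (fun x => pd2 w x ^ 2) (Noz L) :=
    integrableOn_Noz (hw.continuousOn_pd2.pow 2)
  have i12 : IntegrableOn (fun x => pd1 w x ^ 2 + pd2 w x ^ 2) (Noz L) := i1.add i2
  have i0 : IntegrableOn (fun x => w x ^ 2) (Noz L) := integrableOn_Noz (hw.continuousOn.pow 2)
  have b1 : |∫ x in Noz L, D x| ≤ d * ((∫ x in Noz L, wt α x.2 ^ 2 * w x ^ 2) +
      ∫ x in Noz L, (pd1 w x ^ 2 + pd2 w x ^ 2)) := by
    rw [← integral_add iw2 i12, ← integral_const_mul]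
    refine abs_setIntegral_Noz_le ((iw2.add i12).const_mul d) fun x hx =>
      (hDle x hx).trans ?_
    rw [mul_assoc, mul_assoc d, ← mul_add]
    refine mul_le_mul_of_nonneg_left ?_ hd
    have e (y : ℝ) : wt α x.2 * |w x * y| ≤ (wt α x.2 ^ 2 * w x ^ 2 + y ^ 2) / 2 := by
      rw [← abs_of_nonneg (hwt x hx), ← abs_mul, abs_of_nonneg (hwt x hx), ← mul_assoc, abs_mul,
        ← mul_pow, ← sq_abs (wt α x.2 * w x), ← sq_abs y]
      linarith [two_mul_le_add_sq |wt α x.2 * w x| |y|]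
    have := e (pd1 w x)
    have := e (pd2 w x)
    have : 0 ≤ pd1 w x ^ 2 + pd2 w x ^ 2 := by positivity
    linarith
  have hW : 0 ≤ ∫ t in Ioo (0 : ℝ) 1, wt α t ^ 2 := integral_nonneg fun t => sq_nonneg _
  have hwq := weighted_sq_le hα hw
  have hp := poincare_left hL hw hw0
  rw [integral_add i0 i2] at hwq
  have p1 : 0 ≤ ∫ x in Noz L, pd1 w x ^ 2 := setIntegral_Noz_nonneg fun x _ => sq_nonneg _
  have p2 : 0 ≤ ∫ x in Noz L, pd2 w x ^ 2 := setIntegral_Noz_nonneg fun x _ => sq_nonneg _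
  refine b1.trans ?_
  rw [mul_assoc]
  gcongr
  rw [integral_add i1 i2]
  have : ∫ x in Noz L, wt α x.2 ^ 2 * w x ^ 2 ≤ 2 * (∫ t in Ioo 0 1, wt α t ^ 2) *
      ((4 * L ^ 2 + 1) * ((∫ x in Noz L, pd1 w x ^ 2) + ∫ x in Noz L, pd2 w x ^ 2)) := by
    refine hwq.trans ?_
    gcongr
    nlinarith [mul_nonneg (sq_nonneg L) p2]
  linarith

end Energy

/-! ### Flow fields -/

/-- The unknowns `(φ, ψ, Φ, S, K)` of the reformulated problem. -/
structure Fld where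
  φ : Pt → ℝ
  ψ : Pt → ℝ
  Φ : Pt → ℝ
  S : Pt → ℝ
  K : Pt → ℝ

/-- Constants of the gas, the geometry and the a priori bounds. -/
structure FlowConst where
  (γ 𝔭 cv α L S₀ ν m M c C : ℝ)
  hγ : 1 < γ
  h𝔭 : 0 < 𝔭
  hcv : 0 < cv
  hα : 1 / 2 < α
  hL : 0 < L
  hν : 0 < ν
  hm : 0 < m
  hM : 1 ≤ M
  hc : 0 < c
  hC : 0 < C

namespace Fld

/-- horizontal velocity -/
def u (U : Fld) (x : Pt) : ℝ := pd1 U.φ x + pd2 U.ψ x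

/-- vertical velocity -/
def v (U : Fld) (x : Pt) : ℝ := pd2 U.φ x - pd1 U.ψ x

/-- enthalpy variable -/
def z (U : Fld) (x : Pt) : ℝ := U.K x + U.Φ x - (U.u x ^ 2 + U.v x ^ 2) / 2

/-- density -/
def r (κ : FlowConst) (U : Fld) (x : Pt) : ℝ := Hfun κ.γ κ.𝔭 κ.cv (U.S x) (U.z x)

end Fld

/-- A classical solution of the equations and the homogeneous boundary conditions, with uniform
subsonic bounds, and with `ε`-small vertical velocity and entropy and Bernoulli gradients. -/
structure SubsonicFlow (κ : FlowConst) (ε : ℝ) (U : Fld) : Prop where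
  φ_up : UpTo 1 U.φ (Rect κ.L)
  ψ_up : UpTo 1 U.ψ (Rect κ.L)
  Φ_up : UpTo 1 U.Φ (Rect κ.L)
  S_up : UpTo 1 U.S (Rect κ.L)
  K_up : UpTo 1 U.K (Rect κ.L)
  φ_smooth : ContDiffOn ℝ 2 U.φ (Noz κ.L)
  ψ_smooth : ContDiffOn ℝ 2 U.ψ (Noz κ.L)
  Φ_smooth : ContDiffOn ℝ 2 U.Φ (Noz κ.L)
  mass : ∀ x ∈ Noz κ.L, pd1 (fun y => U.r κ y * U.u y) x + pd2 (fun y => U.r κ y * U.v y) x = 0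
  S_transport : ∀ x ∈ Noz κ.L, U.r κ x * (U.u x * pd1 U.S x + U.v x * pd2 U.S x) = 0
  K_transport : ∀ x ∈ Noz κ.L, U.r κ x * (U.u x * pd1 U.K x + U.v x * pd2 U.K x) = 0
  vorticity : ∀ x ∈ Noz κ.L, lap U.ψ x =
    -(κ.cv / κ.γ * (U.z x / U.u x * pd2 U.S x)) + 1 / U.u x * pd2 U.K x
  state : ∀ x ∈ Rect κ.L,
    SubsonicState κ.γ κ.S₀ κ.ν κ.m κ.M (U.S x) (U.K x) (U.Φ x) (U.u x) (U.v x) (U.z x)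
  S_grad : ∀ x ∈ Rect κ.L, |pd1 U.S x| ≤ ε ∧ |pd2 U.S x| ≤ ε
  K_grad : ∀ x ∈ Rect κ.L, |pd1 U.K x| ≤ ε ∧ |pd2 U.K x| ≤ ε
  u_reg : Reg κ.α κ.L κ.M κ.M U.u
  v_reg : Reg κ.α κ.L ε ε U.v
  Φ_reg : Reg κ.α κ.L κ.M κ.M U.Φ
  S_reg : Reg κ.α κ.L κ.M κ.M U.S
  K_reg : Reg κ.α κ.L κ.M κ.M U.K
  v_bot : ∀ t ∈ Icc 0 κ.L, U.v (t, 0) = 0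
  v_top : ∀ t ∈ Icc 0 κ.L, U.v (t, 1) = 0
  ψ_bot : ∀ t ∈ Icc 0 κ.L, U.ψ (t, 0) = 0
  ψ_top : ∀ t ∈ Icc 0 κ.L, U.ψ (t, 1) = 0
  Φ_bot : ∀ t ∈ Icc 0 κ.L, pd2 U.Φ (t, 0) = 0
  Φ_top : ∀ t ∈ Icc 0 κ.L, pd2 U.Φ (t, 1) = 0
  φ_in : ∀ t ∈ Icc (0 : ℝ) 1, U.φ (0, t) = 0
  ψ_in : ∀ t ∈ Icc (0 : ℝ) 1, pd1 U.ψ (0, t) = 0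
  ψ_out : ∀ t ∈ Icc (0 : ℝ) 1, pd1 U.ψ (κ.L, t) = 0

/-- Two flows with the same boundary data and doping profile. -/
structure FlowPair (κ : FlowConst) (ε : ℝ) (A B : Fld) : Prop where
  nonneg : 0 ≤ ε
  le_one : ε ≤ 1
  fst : SubsonicFlow κ ε A
  snd : SubsonicFlow κ ε B
  poisson : ∀ x ∈ Noz κ.L, lap A.Φ x - lap B.Φ x = A.r κ x - B.r κ x
  Φ_in : ∀ t ∈ Icc (0 : ℝ) 1, A.Φ (0, t) = B.Φ (0, t)
  Φ_out : ∀ t ∈ Icc (0 : ℝ) 1, A.Φ (κ.L, t) = B.Φ (κ.L, t)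
  S_in : ∀ t ∈ Icc (0 : ℝ) 1, A.S (0, t) = B.S (0, t)
  K_in : ∀ t ∈ Icc (0 : ℝ) 1, A.K (0, t) = B.K (0, t)
  comparison : ∀ x ∈ Rect κ.L, StateComparison κ.c κ.C (A.S x) (A.K x) (A.Φ x) (A.u x) (A.v x)
    (A.z x) (A.r κ x) (B.S x) (B.K x) (B.Φ x) (B.u x) (B.v x) (B.z x) (B.r κ x)
  exit_flux : ∀ t ∈ Icc (0 : ℝ) 1, |A.r κ (κ.L, t) * A.u (κ.L, t) - B.r κ (κ.L, t) * B.u (κ.L, t) +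
    B.r κ (κ.L, t) * (A.v (κ.L, t) + B.v (κ.L, t)) * (A.u (κ.L, t) + B.u (κ.L, t))⁻¹ *
      (A.v (κ.L, t) - B.v (κ.L, t))| ≤
    κ.C * (|A.S (κ.L, t) - B.S (κ.L, t)| + |A.K (κ.L, t) - B.K (κ.L, t)|)

lemma reg_const (α L k : ℝ) : Reg α L |k| 0 (fun _ => k) where
  cont := continuousOn_const
  smooth := contDiffOn_const
  bound _ _ := le_rfl
  grad x hx := by simp

lemma reg_fst_div {α L : ℝ} (hL : 0 < L) : Reg α L 1 L⁻¹ (fun x => x.1 / L) where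
  cont := by fun_prop
  smooth := by fun_prop
  bound x hx := by
    rw [abs_of_nonneg (div_nonneg hx.1.1.le hL.le), div_le_one hL]
    exact hx.1.2.le
  grad x hx := by
    have e1 : pd1 (fun y : Pt => y.1 / L) x = L⁻¹ := by
      rw [pd1_fst (φ := fun t => t / L) (by fun_prop)]; simp
    have e2 : pd2 (fun y : Pt => y.1 / L) x = 0 :=
      pd2_fst (φ := fun t => t / L) (by fun_prop)
    refine norm_fderiv_le.trans ?_
    rw [e1, e2, abs_zero, add_zero, abs_of_pos (inv_pos.2 hL)]
    exact le_mul_of_one_le_right (inv_pos.2 hL).le (one_le_wt hx.2)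

namespace SubsonicFlow
variable {κ : FlowConst} {ε : ℝ} {U : Fld}

lemma pos_z (h : SubsonicFlow κ ε U) {x : Pt} (hx : x ∈ Rect κ.L) : 0 < U.z x :=
  (div_pos κ.hν (by linarith [κ.hγ])).trans_le ((h.state x hx).le_z κ.hγ)

lemma pos_u (h : SubsonicFlow κ ε U) {x : Pt} (hx : x ∈ Rect κ.L) : 0 < U.u x :=
  κ.hm.trans_le (h.state x hx).le_u

lemma reg_z (h : SubsonicFlow κ ε U) (hε : ε ≤ 1) :
    Reg κ.α κ.L (2 * κ.M + κ.M ^ 2) (2 * κ.M + 2 * κ.M ^ 2) U.z := by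
  have hM := κ.hM
  have hv : Reg κ.α κ.L κ.M κ.M U.v := h.v_reg.mono (hε.trans hM) (hε.trans hM)
  have := (h.K_reg.add h.Φ_reg).add ((reg_const κ.α κ.L (-(1 / 2))).mul
    ((h.u_reg.mul h.u_reg).add (hv.mul hv)))
  have e : U.z = fun x => U.K x + U.Φ x + -(1 / 2) * (U.u x * U.u x + U.v x * U.v x) := by
    funext x; simp only [Fld.z]; ring
  rw [e]
  refine this.mono (le_of_eq ?_) (le_of_eq ?_) <;> (norm_num; ring)

lemma cont_r (h : SubsonicFlow κ ε U) (hε : ε ≤ 1) : ContinuousOn (U.r κ) (Rect κ.L) := by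
  have hH := (contDiffOn_Hfun (cv := κ.cv) κ.hγ κ.h𝔭 (s := {p : Pt | 0 < p.2})
    fun p hp => hp).continuousOn
  exact hH.comp (h.S_reg.cont.prodMk (h.reg_z hε).cont) fun x hx => h.pos_z hx

lemma reg_r (h : SubsonicFlow κ ε U) (hε : ε ≤ 1) (hr : ∀ x ∈ Rect κ.L, |U.r κ x| ≤ κ.C) :
    Reg κ.α κ.L κ.C (κ.C * ((2 * κ.M + 2 * κ.M ^ 2) / (κ.ν / (κ.γ - 1)) + κ.M / κ.cv) / (κ.γ - 1))
      (U.r κ) := by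
  have hg : 0 < κ.γ - 1 := by linarith [κ.hγ]
  have hz := h.reg_z hε
  have hH := contDiffOn_Hfun (cv := κ.cv) κ.hγ κ.h𝔭 (s := {p : Pt | 0 < p.2}) fun p hp => hp
  refine ⟨h.cont_r hε, hH.comp (h.S_reg.smooth.prodMk hz.smooth) fun x hx =>
    h.pos_z (Noz_subset_Rect _ hx), fun x hx => hr x (Noz_subset_Rect _ hx), fun x hx => ?_⟩
  have hx' := Noz_subset_Rect _ hx
  have zpos := h.pos_z hx'
  have dz := (hz.differentiableAt hx).hasFDerivAt
  have dS := (h.S_reg.differentiableAt hx).hasFDerivAt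
  have key : HasFDerivAt (U.r κ) (U.r κ x • ((κ.γ - 1)⁻¹ • ((U.z x)⁻¹ • fderiv ℝ U.z x -
      κ.cv⁻¹ • fderiv ℝ U.S x))) x := by
    have h1 : HasFDerivAt (fun y => (κ.γ - 1)⁻¹ * (log ((κ.γ - 1) / (κ.γ * κ.𝔭)) + log (U.z y) -
        κ.cv⁻¹ * U.S y)) ((κ.γ - 1)⁻¹ • ((U.z x)⁻¹ • fderiv ℝ U.z x -
        κ.cv⁻¹ • fderiv ℝ U.S x)) x :=
      (((dz.log zpos.ne').const_add _).sub (dS.const_mul _)).const_mul _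
    have h2 := h1.exp
    have e : ∀ y ∈ Noz κ.L, U.r κ y = exp ((κ.γ - 1)⁻¹ *
        (log ((κ.γ - 1) / (κ.γ * κ.𝔭)) + log (U.z y) - κ.cv⁻¹ * U.S y)) := by
      intro y hy
      rw [Fld.r, Hfun_eq_exp κ.hγ κ.h𝔭 (h.pos_z (Noz_subset_Rect _ hy))]
      congr 1; ring
    rw [← e x hx] at h2
    exact h2.congr_of_eventuallyEq
      (Filter.eventually_of_mem ((isOpen_Noz _).mem_nhds hx) e)
  rw [key.fderiv, norm_smul, norm_smul, Real.norm_eq_abs, Real.norm_eq_abs,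
    abs_of_pos (inv_pos.2 hg)]
  have hw : 0 ≤ wt κ.α x.2 := zero_le_one.trans (one_le_wt hx.2)
  have hC := κ.hC
  have hM : 0 < κ.M := by linarith [κ.hM]
  have hν := κ.hν
  have hcv := κ.hcv
  have i1 : ‖(U.z x)⁻¹ • fderiv ℝ U.z x‖ ≤
      (κ.ν / (κ.γ - 1))⁻¹ * ((2 * κ.M + 2 * κ.M ^ 2) * wt κ.α x.2) := by
    rw [norm_smul, Real.norm_eq_abs, abs_of_pos (inv_pos.2 zpos)]
    have := (h.state x hx').le_z κ.hγ
    gcongr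
    exact hz.grad x hx
  have i2 : ‖κ.cv⁻¹ • fderiv ℝ U.S x‖ ≤ κ.cv⁻¹ * (κ.M * wt κ.α x.2) := by
    rw [norm_smul, Real.norm_eq_abs, abs_of_pos (inv_pos.2 hcv)]
    gcongr
    exact h.S_reg.grad x hx
  calc |U.r κ x| * ((κ.γ - 1)⁻¹ * ‖(U.z x)⁻¹ • fderiv ℝ U.z x - κ.cv⁻¹ • fderiv ℝ U.S x‖)
      ≤ κ.C * ((κ.γ - 1)⁻¹ * ((κ.ν / (κ.γ - 1))⁻¹ * ((2 * κ.M + 2 * κ.M ^ 2) * wt κ.α x.2) +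
        κ.cv⁻¹ * (κ.M * wt κ.α x.2))) := by
        gcongr
        · exact hr x hx'
        · exact (norm_sub_le _ _).trans (add_le_add i1 i2)
    _ = _ := by ring

end SubsonicFlow

namespace FlowPair
variable {κ : FlowConst} {ε : ℝ} {A B : Fld}

/-- sum of the squared jumps -/
def jump (A B : Fld) (x : Pt) : ℝ :=
  ((A.u x - B.u x) ^ 2 + (A.v x - B.v x) ^ 2 + (A.Φ x - B.Φ x) ^ 2) +
    ((A.S x - B.S x) ^ 2 + (A.K x - B.K x) ^ 2)

/-- sum of the absolute jumps -/
def absJump (A B : Fld) (x : Pt) : ℝ :=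
  |A.S x - B.S x| + |A.K x - B.K x| + |A.Φ x - B.Φ x| + |A.u x - B.u x| + |A.v x - B.v x|

lemma absJump_nonneg (A B : Fld) (x : Pt) : 0 ≤ absJump A B x := by unfold absJump; positivity

lemma absJump_sq_le (A B : Fld) (x : Pt) : absJump A B x ^ 2 ≤ 5 * jump A B x := by
  have h (a b c d e : ℝ) : (a + b + c + d + e) ^ 2 ≤
      5 * ((d ^ 2 + e ^ 2 + c ^ 2) + (a ^ 2 + b ^ 2)) := by
    nlinarith [sq_nonneg (a - b), sq_nonneg (a - c), sq_nonneg (a - d), sq_nonneg (a - e),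
      sq_nonneg (b - c), sq_nonneg (b - d), sq_nonneg (b - e), sq_nonneg (c - d),
      sq_nonneg (c - e), sq_nonneg (d - e)]
  have := h |A.S x - B.S x| |A.K x - B.K x| |A.Φ x - B.Φ x| |A.u x - B.u x| |A.v x - B.v x|
  simp only [sq_abs] at this
  exact this

lemma cont_jump (h : FlowPair κ ε A B) : ContinuousOn (jump A B) (Rect κ.L) :=
  ((((h.fst.u_reg.cont.sub h.snd.u_reg.cont).pow 2).add
    ((h.fst.v_reg.cont.sub h.snd.v_reg.cont).pow 2)).add
    ((h.fst.Φ_reg.cont.sub h.snd.Φ_reg.cont).pow 2)).add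
    (((h.fst.S_reg.cont.sub h.snd.S_reg.cont).pow 2).add
    ((h.fst.K_reg.cont.sub h.snd.K_reg.cont).pow 2))

/-- kinetic and potential part of the energy of the difference -/
def eX (κ : FlowConst) (A B : Fld) : ℝ :=
  ∫ x in Noz κ.L, ((A.u x - B.u x) ^ 2 + (A.v x - B.v x) ^ 2 + (A.Φ x - B.Φ x) ^ 2)

/-- transported part of the energy of the difference -/
def eY (κ : FlowConst) (A B : Fld) : ℝ :=
  ∫ x in Noz κ.L, ((A.S x - B.S x) ^ 2 + (A.K x - B.K x) ^ 2)

/-- exit trace of the transported part -/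
def eT (κ : FlowConst) (A B : Fld) : ℝ :=
  ∫ t in (0 : ℝ)..1, ((A.S (κ.L, t) - B.S (κ.L, t)) ^ 2 + (A.K (κ.L, t) - B.K (κ.L, t)) ^ 2)

/-- Dirichlet energy of the difference of the stream functions -/
def eQ (κ : FlowConst) (A B : Fld) : ℝ :=
  ∫ x in Noz κ.L, (pd1 (fun y => A.ψ y - B.ψ y) x ^ 2 + pd2 (fun y => A.ψ y - B.ψ y) x ^ 2)

/-- Dirichlet energy of the difference of the potentials -/
def eW (κ : FlowConst) (A B : Fld) : ℝ :=
  ∫ x in Noz κ.L, (pd1 (fun y => A.φ y - B.φ y) x ^ 2 + pd2 (fun y => A.φ y - B.φ y) x ^ 2)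

/-- exit contribution to the energy identity -/
def eB (κ : FlowConst) (A B : Fld) : ℝ :=
  ∫ t in (0 : ℝ)..1, (A.r κ (κ.L, t) * A.u (κ.L, t) - B.r κ (κ.L, t) * B.u (κ.L, t)) *
    (A.φ (κ.L, t) - B.φ (κ.L, t))

lemma eX_nonneg (κ : FlowConst) (A B : Fld) : 0 ≤ eX κ A B :=
  setIntegral_Noz_nonneg fun x _ => by positivity

lemma eY_nonneg (κ : FlowConst) (A B : Fld) : 0 ≤ eY κ A B :=
  setIntegral_Noz_nonneg fun x _ => by positivity

lemma eT_nonneg (κ : FlowConst) (A B : Fld) : 0 ≤ eT κ A B :=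
  intervalIntegral.integral_nonneg zero_le_one fun t _ => by positivity

lemma eQ_nonneg (κ : FlowConst) (A B : Fld) : 0 ≤ eQ κ A B :=
  setIntegral_Noz_nonneg fun x _ => by positivity

lemma eW_nonneg (κ : FlowConst) (A B : Fld) : 0 ≤ eW κ A B :=
  setIntegral_Noz_nonneg fun x _ => by positivity

lemma integrable_X (h : FlowPair κ ε A B) : IntegrableOn (fun x => (A.u x - B.u x) ^ 2 +
    (A.v x - B.v x) ^ 2 + (A.Φ x - B.Φ x) ^ 2) (Noz κ.L) :=
  integrableOn_Noz ((((h.fst.u_reg.cont.sub h.snd.u_reg.cont).pow 2).add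
    ((h.fst.v_reg.cont.sub h.snd.v_reg.cont).pow 2)).add
    ((h.fst.Φ_reg.cont.sub h.snd.Φ_reg.cont).pow 2))

lemma integrable_Y (h : FlowPair κ ε A B) : IntegrableOn (fun x => (A.S x - B.S x) ^ 2 +
    (A.K x - B.K x) ^ 2) (Noz κ.L) :=
  integrableOn_Noz (((h.fst.S_reg.cont.sub h.snd.S_reg.cont).pow 2).add
    ((h.fst.K_reg.cont.sub h.snd.K_reg.cont).pow 2))

lemma integral_jump (h : FlowPair κ ε A B) :
    ∫ x in Noz κ.L, jump A B x = eX κ A B + eY κ A B :=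
  integral_add h.integrable_X h.integrable_Y

lemma w_up (h : FlowPair κ ε A B) : UpTo 1 (fun x => A.φ x - B.φ x) (Rect κ.L) :=
  h.fst.φ_up.sub h.snd.φ_up

lemma q_up (h : FlowPair κ ε A B) : UpTo 1 (fun x => A.ψ x - B.ψ x) (Rect κ.L) :=
  h.fst.ψ_up.sub h.snd.ψ_up

lemma u_sub (h : FlowPair κ ε A B) {x : Pt} (hx : x ∈ Rect κ.L) : A.u x - B.u x =
    pd1 (fun y => A.φ y - B.φ y) x + pd2 (fun y => A.ψ y - B.ψ y) x := by
  rw [pd1_sub (h.fst.φ_up.differentiableAt hx) (h.snd.φ_up.differentiableAt hx),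
    pd2_sub (h.fst.ψ_up.differentiableAt hx) (h.snd.ψ_up.differentiableAt hx)]
  simp only [Fld.u]; ring

lemma v_sub (h : FlowPair κ ε A B) {x : Pt} (hx : x ∈ Rect κ.L) : A.v x - B.v x =
    pd2 (fun y => A.φ y - B.φ y) x - pd1 (fun y => A.ψ y - B.ψ y) x := by
  rw [pd2_sub (h.fst.φ_up.differentiableAt hx) (h.snd.φ_up.differentiableAt hx),
    pd1_sub (h.fst.ψ_up.differentiableAt hx) (h.snd.ψ_up.differentiableAt hx)]
  simp only [Fld.v]; ring

lemma reg_r_fst (h : FlowPair κ ε A B) : Reg κ.α κ.L κ.C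
    (κ.C * ((2 * κ.M + 2 * κ.M ^ 2) / (κ.ν / (κ.γ - 1)) + κ.M / κ.cv) / (κ.γ - 1)) (A.r κ) :=
  h.fst.reg_r h.le_one fun x hx => by
    rw [abs_of_pos (κ.hc.trans_le (h.comparison x hx).le_r)]; exact (h.comparison x hx).r_le

lemma reg_r_snd (h : FlowPair κ ε A B) : Reg κ.α κ.L κ.C
    (κ.C * ((2 * κ.M + 2 * κ.M ^ 2) / (κ.ν / (κ.γ - 1)) + κ.M / κ.cv) / (κ.γ - 1)) (B.r κ) :=
  h.snd.reg_r h.le_one fun x hx => by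
    rw [abs_of_pos (κ.hc.trans_le (h.comparison x hx).le_r')]; exact (h.comparison x hx).r'_le

lemma eW_le (h : FlowPair κ ε A B) : eW κ A B ≤ 2 * (eX κ A B + eQ κ A B) := by
  have iw : IntegrableOn (fun x => pd1 (fun y => A.φ y - B.φ y) x ^ 2 +
      pd2 (fun y => A.φ y - B.φ y) x ^ 2) (Noz κ.L) :=
    integrableOn_Noz ((h.w_up.continuousOn_pd1.pow 2).add (h.w_up.continuousOn_pd2.pow 2))
  have iq : IntegrableOn (fun x => pd1 (fun y => A.ψ y - B.ψ y) x ^ 2 +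
      pd2 (fun y => A.ψ y - B.ψ y) x ^ 2) (Noz κ.L) :=
    integrableOn_Noz ((h.q_up.continuousOn_pd1.pow 2).add (h.q_up.continuousOn_pd2.pow 2))
  rw [eW, eX, eQ, ← integral_add h.integrable_X iq, ← integral_const_mul]
  refine setIntegral_Noz_mono iw ((h.integrable_X.add iq).const_mul 2) fun x hx => ?_
  have hx' := Noz_subset_Rect _ hx
  have e1 := h.u_sub hx'
  have e2 := h.v_sub hx'
  rw [e1, e2]
  generalize pd1 (fun y => A.φ y - B.φ y) x = a
  generalize pd2 (fun y => A.φ y - B.φ y) x = b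
  generalize pd1 (fun y => A.ψ y - B.ψ y) x = c
  generalize pd2 (fun y => A.ψ y - B.ψ y) x = d
  nlinarith [sq_nonneg (A.Φ x - B.Φ x), sq_nonneg (a + 2 * d), sq_nonneg (b - 2 * c)]

end FlowPair

namespace SubsonicFlow
variable {κ : FlowConst} {ε : ℝ} {U : Fld}

lemma cont_flux (h : SubsonicFlow κ ε U) (hε : ε ≤ 1) :
    ContinuousOn (fun x => U.r κ x * U.u x) (Rect κ.L) ∧
      ContinuousOn (fun x => U.r κ x * U.v x) (Rect κ.L) :=
  ⟨(h.cont_r hε).mul h.u_reg.cont, (h.cont_r hε).mul h.v_reg.cont⟩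

lemma cont_quot (h : SubsonicFlow κ ε U) (hε : ε ≤ 1) :
    ContinuousOn (fun x => U.z x / U.u x) (Rect κ.L) ∧
      ContinuousOn (fun x => 1 / U.u x) (Rect κ.L) :=
  ⟨(h.reg_z hε).cont.div h.u_reg.cont fun _ hx => (h.pos_u hx).ne',
    continuousOn_const.div h.u_reg.cont fun _ hx => (h.pos_u hx).ne'⟩

end SubsonicFlow

namespace FlowPair
variable {κ : FlowConst} {ε : ℝ} {A B : Fld}

lemma diff_flux_fst (h : FlowPair κ ε A B) {x : Pt} (hx : x ∈ Noz κ.L) :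
    DifferentiableAt ℝ (fun x => A.r κ x * A.u x) x ∧
      DifferentiableAt ℝ (fun x => A.r κ x * A.v x) x :=
  ⟨(h.reg_r_fst.differentiableAt hx).fun_mul (h.fst.u_reg.differentiableAt hx),
    (h.reg_r_fst.differentiableAt hx).fun_mul (h.fst.v_reg.differentiableAt hx)⟩

lemma diff_flux_snd (h : FlowPair κ ε A B) {x : Pt} (hx : x ∈ Noz κ.L) :
    DifferentiableAt ℝ (fun x => B.r κ x * B.u x) x ∧
      DifferentiableAt ℝ (fun x => B.r κ x * B.v x) x :=
  ⟨(h.reg_r_snd.differentiableAt hx).fun_mul (h.snd.u_reg.differentiableAt hx),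
    (h.reg_r_snd.differentiableAt hx).fun_mul (h.snd.v_reg.differentiableAt hx)⟩

/-- Difference of two quantities transported by the two flows. -/
lemma transport_le (h : FlowPair κ ε A B) {f f' : Pt → ℝ} (hf : UpTo 1 f (Rect κ.L))
    (hf' : UpTo 1 f' (Rect κ.L)) (h0 : ∀ t ∈ Icc (0 : ℝ) 1, f (0, t) = f' (0, t))
    (ht : ∀ x ∈ Noz κ.L, A.r κ x * (A.u x * pd1 f x + A.v x * pd2 f x) = 0)
    (ht' : ∀ x ∈ Noz κ.L, B.r κ x * (B.u x * pd1 f' x + B.v x * pd2 f' x) = 0)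
    (hε : ∀ x ∈ Rect κ.L, |pd1 f' x| ≤ ε ∧ |pd2 f' x| ≤ ε)
    (hj : ∀ x, |f x - f' x| ≤ absJump A B x) :
    κ.c * κ.m * ((∫ x in Noz κ.L, (f x - f' x) ^ 2) +
        ∫ t in (0 : ℝ)..1, (f (κ.L, t) - f' (κ.L, t)) ^ 2) ≤
      2 * (κ.L + 1) * (10 * κ.C * ε * (eX κ A B + eY κ A B)) := by
  rw [← h.integral_jump, ← integral_const_mul]
  refine transport_energy κ.hL (m₁ := fun x => A.r κ x * A.u x) (m₂ := fun x => A.r κ x * A.v x)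
    (s := fun x => f x - f' x)
    (g := fun x => -((A.r κ x * A.u x - B.r κ x * B.u x) * pd1 f' x +
      (A.r κ x * A.v x - B.r κ x * B.v x) * pd2 f' x))
    (h.fst.cont_flux h.le_one).1 (h.fst.cont_flux h.le_one).2
    (fun x hx => (h.diff_flux_fst hx).1) (fun x hx => (h.diff_flux_fst hx).2) h.fst.mass
    (fun t ht => by simp [h.fst.v_bot t ht]) (fun t ht => by simp [h.fst.v_top t ht])
    (hf.sub hf') (fun t ht => by simp [h0 t ht]) (fun x hx => ?_) (fun x hx => ?_)
    (continuousOn_const.mul h.cont_jump) (fun x hx => ?_)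
  · exact mul_le_mul (h.comparison x hx).le_r (h.fst.state x hx).le_u κ.hm.le
      (κ.hc.le.trans (h.comparison x hx).le_r)
  · have hx' := Noz_subset_Rect _ hx
    rw [pd1_sub (hf.differentiableAt hx') (hf'.differentiableAt hx'),
      pd2_sub (hf.differentiableAt hx') (hf'.differentiableAt hx')]
    linear_combination ht x hx - ht' x hx
  · have hx' := Noz_subset_Rect _ hx
    have c := h.comparison x hx'
    have a0 := absJump_nonneg A B x
    have f1 : |A.r κ x * A.u x - B.r κ x * B.u x| ≤ κ.C * absJump A B x := c.flux₁
    have f2 : |A.r κ x * A.v x - B.r κ x * B.v x| ≤ κ.C * absJump A B x := c.flux₂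
    have hC := κ.hC
    have hn := h.nonneg
    rw [abs_mul, abs_neg]
    calc |f x - f' x| * |(A.r κ x * A.u x - B.r κ x * B.u x) * pd1 f' x +
          (A.r κ x * A.v x - B.r κ x * B.v x) * pd2 f' x|
        ≤ absJump A B x * (κ.C * absJump A B x * ε + κ.C * absJump A B x * ε) := by
          refine mul_le_mul (hj x) ((abs_add_le _ _).trans ?_) (abs_nonneg _) a0
          rw [abs_mul, abs_mul]
          have := hε x hx'
          exact add_le_add (mul_le_mul f1 this.1 (abs_nonneg _) (by positivity))
            (mul_le_mul f2 this.2 (abs_nonneg _) (by positivity))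
      _ = 2 * κ.C * ε * absJump A B x ^ 2 := by ring
      _ ≤ 2 * κ.C * ε * (5 * jump A B x) := by gcongr; exact absJump_sq_le A B x
      _ = _ := by ring

lemma transported_le (h : FlowPair κ ε A B) :
    κ.c * κ.m * (eY κ A B + eT κ A B) ≤
      40 * (κ.L + 1) * κ.C * (ε * (eX κ A B + eY κ A B)) := by
  have hS := h.transport_le h.fst.S_up h.snd.S_up h.S_in h.fst.S_transport h.snd.S_transport
    h.snd.S_grad fun x => by
      unfold absJump
      linarith [abs_nonneg (A.K x - B.K x), abs_nonneg (A.Φ x - B.Φ x),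
        abs_nonneg (A.u x - B.u x), abs_nonneg (A.v x - B.v x)]
  have hK := h.transport_le h.fst.K_up h.snd.K_up h.K_in h.fst.K_transport h.snd.K_transport
    h.snd.K_grad fun x => by
      unfold absJump
      linarith [abs_nonneg (A.S x - B.S x), abs_nonneg (A.Φ x - B.Φ x),
        abs_nonneg (A.u x - B.u x), abs_nonneg (A.v x - B.v x)]
  have cS := (h.fst.S_reg.cont.sub h.snd.S_reg.cont).pow 2
  have cK := (h.fst.K_reg.cont.sub h.snd.K_reg.cont).pow 2
  have hLm : κ.L ∈ Icc 0 κ.L := ⟨κ.hL.le, le_rfl⟩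
  have eY' : eY κ A B = (∫ x in Noz κ.L, (A.S x - B.S x) ^ 2) +
      ∫ x in Noz κ.L, (A.K x - B.K x) ^ 2 :=
    integral_add (integrableOn_Noz cS) (integrableOn_Noz cK)
  have eT' : eT κ A B = (∫ t in (0 : ℝ)..1, (A.S (κ.L, t) - B.S (κ.L, t)) ^ 2) +
      ∫ t in (0 : ℝ)..1, (A.K (κ.L, t) - B.K (κ.L, t)) ^ 2 :=
    intervalIntegral.integral_add (intervalIntegrable_slice cS hLm)
      (intervalIntegrable_slice cK hLm)
  calc κ.c * κ.m * (eY κ A B + eT κ A B)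
      = κ.c * κ.m * ((∫ x in Noz κ.L, (A.S x - B.S x) ^ 2) +
          ∫ t in (0 : ℝ)..1, (A.S (κ.L, t) - B.S (κ.L, t)) ^ 2) +
        κ.c * κ.m * ((∫ x in Noz κ.L, (A.K x - B.K x) ^ 2) +
          ∫ t in (0 : ℝ)..1, (A.K (κ.L, t) - B.K (κ.L, t)) ^ 2) := by rw [eY', eT']; ring
    _ ≤ _ := add_le_add hS hK
    _ = _ := by ring

lemma integrable_Q (h : FlowPair κ ε A B) : IntegrableOn (fun x =>
    pd1 (fun y => A.ψ y - B.ψ y) x ^ 2 + pd2 (fun y => A.ψ y - B.ψ y) x ^ 2) (Noz κ.L) :=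
  integrableOn_Noz ((h.q_up.continuousOn_pd1.pow 2).add (h.q_up.continuousOn_pd2.pow 2))

lemma integrable_W (h : FlowPair κ ε A B) : IntegrableOn (fun x =>
    pd1 (fun y => A.φ y - B.φ y) x ^ 2 + pd2 (fun y => A.φ y - B.φ y) x ^ 2) (Noz κ.L) :=
  integrableOn_Noz ((h.w_up.continuousOn_pd1.pow 2).add (h.w_up.continuousOn_pd2.pow 2))

lemma integral_pd2_q_le (h : FlowPair κ ε A B) :
    ∫ x in Noz κ.L, pd2 (fun y => A.ψ y - B.ψ y) x ^ 2 ≤ eQ κ A B :=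
  setIntegral_Noz_mono (integrableOn_Noz (h.q_up.continuousOn_pd2.pow 2)) h.integrable_Q
    fun x _ => by nlinarith [sq_nonneg (pd1 (fun y => A.ψ y - B.ψ y) x)]

lemma integral_pd1_w_le (h : FlowPair κ ε A B) :
    ∫ x in Noz κ.L, pd1 (fun y => A.φ y - B.φ y) x ^ 2 ≤ eW κ A B :=
  setIntegral_Noz_mono (integrableOn_Noz (h.w_up.continuousOn_pd1.pow 2)) h.integrable_W
    fun x _ => by nlinarith [sq_nonneg (pd2 (fun y => A.φ y - B.φ y) x)]

lemma lap_sub {f g : Pt → ℝ} {s : Set Pt} (hs : IsOpen s) (hf : ContDiffOn ℝ 2 f s)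
    (hg : ContDiffOn ℝ 2 g s) {x : Pt} (hx : x ∈ s) :
    lap (fun y => f y - g y) x = lap f x - lap g x := by
  have d0 : ∀ {f : Pt → ℝ}, ContDiffOn ℝ 2 f s → ∀ y ∈ s, DifferentiableAt ℝ f y :=
    fun hf y hy => (hf.differentiableOn (by norm_num)).differentiableAt (hs.mem_nhds hy)
  have d1 : ∀ {f : Pt → ℝ}, ContDiffOn ℝ 2 f s → DifferentiableAt ℝ (pd1 f) x := fun hf =>
    ((contDiffOn_pd1 (m := 1) hs hf (by norm_num)).differentiableOn
      (by norm_num)).differentiableAt (hs.mem_nhds hx)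
  have d2 : ∀ {f : Pt → ℝ}, ContDiffOn ℝ 2 f s → DifferentiableAt ℝ (pd2 f) x := fun hf =>
    ((contDiffOn_pd2 (m := 1) hs hf (by norm_num)).differentiableOn
      (by norm_num)).differentiableAt (hs.mem_nhds hx)
  have e1 : EqOn (pd1 fun y => f y - g y) (fun y => pd1 f y - pd1 g y) s := fun y hy =>
    pd1_sub (d0 hf y hy) (d0 hg y hy)
  have e2 : EqOn (pd2 fun y => f y - g y) (fun y => pd2 f y - pd2 g y) s := fun y hy =>
    pd2_sub (d0 hf y hy) (d0 hg y hy)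
  simp only [lap]
  rw [pd1_congr hs e1 hx, pd2_congr hs e2 hx, pd1_sub (d1 hf) (d1 hg), pd2_sub (d2 hf) (d2 hg)]
  ring

end FlowPair

namespace FlowPair
variable {κ : FlowConst} {ε : ℝ} {A B : Fld}

set_option maxHeartbeats 1000000 in
/-- Energy estimate for the difference of the stream functions. -/
lemma exists_eQ_le (κ : FlowConst) : ∃ N > 0, ∀ ε A B, FlowPair κ ε A B →
    eQ κ A B ≤ N * (eY κ A B + ε * (eX κ A B + eY κ A B + eQ κ A B)) := by
  set W : ℝ := 1 + 10 * ∫ t in Ioo 0 1, wt κ.α t ^ 2 with hW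
  have hW1 : 0 < W := by
    have : 0 ≤ ∫ t in Ioo (0 : ℝ) 1, wt κ.α t ^ 2 := integral_nonneg fun t => sq_nonneg _
    positivity
  have hM : 0 < κ.M := zero_lt_one.trans_le κ.hM
  have hm := κ.hm
  have hC := κ.hC
  set k : ℝ := κ.cv / κ.γ with hk
  have hk0 : 0 < k := div_pos κ.hcv (by linarith [κ.hγ])
  -- coefficients of the two transported gradients
  set ca : ℝ := (2 * κ.M + κ.M ^ 2) * κ.m⁻¹ with hca
  set da : ℝ := (2 * κ.M + κ.M ^ 2) * (κ.M / κ.m ^ 2) + κ.m⁻¹ * (2 * κ.M + 2 * κ.M ^ 2) with hda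
  set ci : ℝ := κ.m⁻¹ with hci
  set di : ℝ := κ.M / κ.m ^ 2 with hdi
  have hda0 : 0 ≤ da := by positivity
  have hdi0 : 0 ≤ di := by positivity
  set η : ℝ := (2 * (k + 1) * W)⁻¹ with hη
  have hη0 : 0 < η := by positivity
  set N₁ : ℝ := η⁻¹ * (k * (ca ^ 2 + da ^ 2) + (ci ^ 2 + di ^ 2)) with hN1
  have hN10 : 0 ≤ N₁ := by positivity
  refine ⟨2 * (N₁ + 5 * (k + 1) * κ.C), by positivity, fun ε A B h => ?_⟩
  have hε := h.nonneg
  set q : Pt → ℝ := fun y => A.ψ y - B.ψ y with hq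
  have hq0 : ∀ t ∈ Icc 0 κ.L, q (t, 0) = 0 := fun t ht => by
    simp [hq, h.fst.ψ_bot t ht, h.snd.ψ_bot t ht]
  have hq1 : ∀ t ∈ Icc 0 κ.L, q (t, 1) = 0 := fun t ht => by
    simp [hq, h.fst.ψ_top t ht, h.snd.ψ_top t ht]
  have rinv : Reg κ.α κ.L ci di (fun x => (A.u x)⁻¹) :=
    h.fst.u_reg.inv hm fun x hx => (h.fst.state x hx).le_u
  have ra : Reg κ.α κ.L ca da (fun x => A.z x * (A.u x)⁻¹) := (h.fst.reg_z h.le_one).mul rinv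
  have cA := h.fst.cont_quot h.le_one
  have cB := h.snd.cont_quot h.le_one
  have SA := h.fst.S_up.continuousOn_pd2
  have SB := h.snd.S_up.continuousOn_pd2
  have KA := h.fst.K_up.continuousOn_pd2
  have KB := h.snd.K_up.continuousOn_pd2
  set F : Pt → ℝ := fun x => (-(k * (A.z x / A.u x * pd2 A.S x)) + 1 / A.u x * pd2 A.K x) -
    (-(k * (B.z x / B.u x * pd2 B.S x)) + 1 / B.u x * pd2 B.K x) with hF
  have cF : ContinuousOn F (Rect κ.L) :=
    ((continuousOn_const.mul (cA.1.mul SA)).neg.add (cA.2.mul KA)).sub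
      ((continuousOn_const.mul (cB.1.mul SB)).neg.add (cB.2.mul KB))
  have main : eQ κ A B = -∫ x in Noz κ.L, q x * F x := by
    refine integral_grad_sq κ.hL h.q_up (h.fst.ψ_smooth.sub h.snd.ψ_smooth) cF (fun x hx => ?_)
      (fun t ht => mul_eq_zero_of_left (hq0 t ht) _) (fun t ht => mul_eq_zero_of_left (hq1 t ht) _)
      (fun t ht => ?_) (fun t ht => ?_)
    · rw [lap_sub (isOpen_Noz _) h.fst.ψ_smooth h.snd.ψ_smooth hx, h.fst.vorticity x hx,
        h.snd.vorticity x hx]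
    · rw [pd1_sub (h.fst.ψ_up.differentiableAt (mem_Rect_left κ.hL ht))
        (h.snd.ψ_up.differentiableAt (mem_Rect_left κ.hL ht)), h.fst.ψ_in t ht, h.snd.ψ_in t ht]
      simp
    · rw [pd1_sub (h.fst.ψ_up.differentiableAt (mem_Rect_right κ.hL ht))
        (h.snd.ψ_up.differentiableAt (mem_Rect_right κ.hL ht)), h.fst.ψ_out t ht,
        h.snd.ψ_out t ht]
      simp
  set s : Pt → ℝ := fun y => A.S y - B.S y with hs
  set l : Pt → ℝ := fun y => A.K y - B.K y with hl
  have s_up : UpTo 1 s (Rect κ.L) := h.fst.S_up.sub h.snd.S_up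
  have l_up : UpTo 1 l (Rect κ.L) := h.fst.K_up.sub h.snd.K_up
  set R : Pt → ℝ := fun x => q x * (k * ((A.z x / A.u x - B.z x / B.u x) * pd2 B.S x) -
    (1 / A.u x - 1 / B.u x) * pd2 B.K x) with hR
  have cq := h.q_up.continuousOn
  have i1 : IntegrableOn (fun x => q x * (A.z x * (A.u x)⁻¹ * pd2 s x)) (Noz κ.L) :=
    integrableOn_Noz (cq.mul (ra.cont.mul s_up.continuousOn_pd2))
  have i2 : IntegrableOn (fun x => q x * ((A.u x)⁻¹ * pd2 l x)) (Noz κ.L) :=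
    integrableOn_Noz (cq.mul (rinv.cont.mul l_up.continuousOn_pd2))
  have i3 : IntegrableOn R (Noz κ.L) :=
    integrableOn_Noz (cq.mul ((continuousOn_const.mul ((cA.1.sub cB.1).mul SB)).sub
      ((cA.2.sub cB.2).mul KB)))
  have split : eQ κ A B = k * (∫ x in Noz κ.L, q x * (A.z x * (A.u x)⁻¹ * pd2 s x)) -
      (∫ x in Noz κ.L, q x * ((A.u x)⁻¹ * pd2 l x)) + ∫ x in Noz κ.L, R x := by
    have j1 : IntegrableOn (fun x => k * (q x * (A.z x * (A.u x)⁻¹ * pd2 s x))) (Noz κ.L) :=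
      i1.const_mul k
    have j2 : IntegrableOn (fun x => k * (q x * (A.z x * (A.u x)⁻¹ * pd2 s x)) -
      q x * ((A.u x)⁻¹ * pd2 l x)) (Noz κ.L) := j1.sub i2
    rw [main, ← integral_neg, ← integral_const_mul, ← integral_sub j1 i2, ← integral_add j2 i3]
    refine setIntegral_congr_fun (measurableSet_Noz _) fun x hx => ?_
    have hx' := Noz_subset_Rect _ hx
    have e1 : pd2 s x = pd2 A.S x - pd2 B.S x :=
      pd2_sub (h.fst.S_up.differentiableAt hx') (h.snd.S_up.differentiableAt hx')
    have e2 : pd2 l x = pd2 A.K x - pd2 B.K x :=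
      pd2_sub (h.fst.K_up.differentiableAt hx') (h.snd.K_up.differentiableAt hx')
    simp only [hF, hR, e1, e2, div_eq_mul_inv]
    ring
  have b1 := abs_integral_mul_pd2_le κ.hL κ.hα hda0 ra h.q_up s_up hq0 hq1 hη0
  have b2 := abs_integral_mul_pd2_le κ.hL κ.hα hdi0 rinv h.q_up l_up hq0 hq1 hη0
  rw [← hW] at b1 b2
  have iq2 : IntegrableOn (fun x => q x ^ 2) (Noz κ.L) := integrableOn_Noz (cq.pow 2)
  have ij : IntegrableOn (fun x => 5 * jump A B x) (Noz κ.L) :=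
    (integrableOn_Noz h.cont_jump).const_mul 5
  have b3 : |∫ x in Noz κ.L, R x| ≤
      ∫ x in Noz κ.L, (k + 1) * κ.C * ε * (q x ^ 2 + 5 * jump A B x) := by
    refine abs_setIntegral_Noz_le ((iq2.add ij).const_mul _) fun x hx => ?_
    have hx' := Noz_subset_Rect _ hx
    have a0 := absJump_nonneg A B x
    have c := h.comparison x hx'
    have f1 : |A.z x / A.u x - B.z x / B.u x| ≤ κ.C * absJump A B x := c.quot
    have f2 : |1 / A.u x - 1 / B.u x| ≤ κ.C * absJump A B x := c.inv
    have g1 := (h.snd.S_grad x hx').2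
    have g2 := (h.snd.K_grad x hx').2
    have t1 : |(A.z x / A.u x - B.z x / B.u x) * pd2 B.S x| ≤ κ.C * absJump A B x * ε := by
      rw [abs_mul]; exact mul_le_mul f1 g1 (abs_nonneg _) (by positivity)
    have t2 : |(1 / A.u x - 1 / B.u x) * pd2 B.K x| ≤ κ.C * absJump A B x * ε := by
      rw [abs_mul]; exact mul_le_mul f2 g2 (abs_nonneg _) (by positivity)
    have t3 : |k * ((A.z x / A.u x - B.z x / B.u x) * pd2 B.S x) -
        (1 / A.u x - 1 / B.u x) * pd2 B.K x| ≤ (k + 1) * κ.C * ε * absJump A B x := by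
      refine (abs_sub _ _).trans ?_
      rw [abs_mul, abs_of_pos hk0]
      linarith [mul_le_mul_of_nonneg_left t1 hk0.le]
    have t4 : |q x| * absJump A B x ≤ q x ^ 2 + 5 * jump A B x := by
      have := absJump_sq_le A B x
      nlinarith [sq_nonneg (|q x| - absJump A B x), sq_abs (q x), sq_nonneg (q x)]
    simp only [hR]
    rw [abs_mul]
    calc |q x| * _ ≤ |q x| * ((k + 1) * κ.C * ε * absJump A B x) := by gcongr
      _ = (k + 1) * κ.C * ε * (|q x| * absJump A B x) := by ring
      _ ≤ _ := by gcongr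
  have e3 : ∫ x in Noz κ.L, (k + 1) * κ.C * ε * (q x ^ 2 + 5 * jump A B x) =
      (k + 1) * κ.C * ε * ((∫ x in Noz κ.L, q x ^ 2) + 5 * (eX κ A B + eY κ A B)) := by
    rw [integral_const_mul, integral_add iq2 ij, integral_const_mul, h.integral_jump]
  have b4 := poincare_wall κ.hL h.q_up hq0
  have b5 := h.integral_pd2_q_le
  have X0 := eX_nonneg κ A B
  have Y0 := eY_nonneg κ A B
  have Q0 := eQ_nonneg κ A B
  have s0 : ∫ x in Noz κ.L, s x ^ 2 ≤ eY κ A B :=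
    setIntegral_Noz_mono (integrableOn_Noz (s_up.continuousOn.pow 2)) h.integrable_Y
      fun x _ => by nlinarith [sq_nonneg (A.K x - B.K x)]
  have l0 : ∫ x in Noz κ.L, l x ^ 2 ≤ eY κ A B :=
    setIntegral_Noz_mono (integrableOn_Noz (l_up.continuousOn.pow 2)) h.integrable_Y
      fun x _ => by nlinarith [sq_nonneg (A.S x - B.S x)]
  have hηW : η * W * (k + 1) = 1 / 2 := by rw [hη]; field_simp
  have c1 : |∫ x in Noz κ.L, q x * (A.z x * (A.u x)⁻¹ * pd2 s x)| ≤
      η * W * eQ κ A B + η⁻¹ * (ca ^ 2 + da ^ 2) * eY κ A B := b1.trans (by gcongr)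
  have c2 : |∫ x in Noz κ.L, q x * ((A.u x)⁻¹ * pd2 l x)| ≤
      η * W * eQ κ A B + η⁻¹ * (ci ^ 2 + di ^ 2) * eY κ A B := b2.trans (by gcongr)
  have c3 : |∫ x in Noz κ.L, R x| ≤
      (k + 1) * κ.C * ε * (4 * eQ κ A B + 5 * (eX κ A B + eY κ A B)) := by
    rw [e3] at b3
    refine b3.trans ?_
    have : ∫ x in Noz κ.L, q x ^ 2 ≤ 4 * eQ κ A B := b4.trans (by linarith)
    gcongr
  have c4 : eQ κ A B ≤ k * (η * W * eQ κ A B + η⁻¹ * (ca ^ 2 + da ^ 2) * eY κ A B) +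
      (η * W * eQ κ A B + η⁻¹ * (ci ^ 2 + di ^ 2) * eY κ A B) +
      (k + 1) * κ.C * ε * (4 * eQ κ A B + 5 * (eX κ A B + eY κ A B)) := by
    have d1 := mul_le_mul_of_nonneg_left ((le_abs_self _).trans c1) hk0.le
    have d2 := (neg_le_abs _).trans c2
    have d3 := (le_abs_self _).trans c3
    linarith
  have c5 : eQ κ A B ≤ 1 / 2 * eQ κ A B + N₁ * eY κ A B +
      (k + 1) * κ.C * ε * (4 * eQ κ A B + 5 * (eX κ A B + eY κ A B)) := by
    rw [← hηW, hN1]; linarith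
  have p1 : 0 ≤ (k + 1) * κ.C * ε * eQ κ A B := by positivity
  have p2 : 0 ≤ (k + 1) * κ.C * eY κ A B := by positivity
  have p3 : 0 ≤ N₁ * (ε * (eX κ A B + eY κ A B + eQ κ A B)) := by positivity
  linarith

end FlowPair

namespace FlowPair
variable {κ : FlowConst} {ε : ℝ} {A B : Fld}

lemma w_in (h : FlowPair κ ε A B) : ∀ t ∈ Icc (0 : ℝ) 1, A.φ (0, t) - B.φ (0, t) = 0 :=
  fun t ht => by simp [h.fst.φ_in t ht, h.snd.φ_in t ht]

/-- Weak form of the difference of the continuity equations. -/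
lemma integral_flux_sub (h : FlowPair κ ε A B) :
    ∫ x in Noz κ.L, ((A.r κ x * A.u x - B.r κ x * B.u x) * pd1 (fun y => A.φ y - B.φ y) x +
      (A.r κ x * A.v x - B.r κ x * B.v x) * pd2 (fun y => A.φ y - B.φ y) x) = eB κ A B := by
  have cA := h.fst.cont_flux h.le_one
  have cB := h.snd.cont_flux h.le_one
  have z : ∫ t in (0 : ℝ)..1, (A.r κ (0, t) * A.u (0, t) - B.r κ (0, t) * B.u (0, t)) *
      (A.φ (0, t) - B.φ (0, t)) = 0 :=
    intervalIntegral_eq_zero fun t ht => by rw [h.w_in t ht, mul_zero]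
  rw [integral_flux κ.hL (m₁ := fun x => A.r κ x * A.u x - B.r κ x * B.u x)
    (m₂ := fun x => A.r κ x * A.v x - B.r κ x * B.v x) (cA.1.sub cB.1) (cA.2.sub cB.2)
    (fun x hx => (h.diff_flux_fst hx).1.fun_sub (h.diff_flux_snd hx).1)
    (fun x hx => (h.diff_flux_fst hx).2.fun_sub (h.diff_flux_snd hx).2)
    (fun x hx => ?_) h.w_up
    (fun t ht => by simp [h.fst.v_bot t ht, h.snd.v_bot t ht])
    (fun t ht => by simp [h.fst.v_top t ht, h.snd.v_top t ht]),
    z, sub_zero, eB]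
  rw [pd1_sub (h.diff_flux_fst hx).1 (h.diff_flux_snd hx).1,
    pd2_sub (h.diff_flux_fst hx).2 (h.diff_flux_snd hx).2]
  linarith [h.fst.mass x hx, h.snd.mass x hx]

/-- The density jump does negative work against the jump of the electric potential. -/
lemma integral_density_nonpos (h : FlowPair κ ε A B) :
    ∫ x in Noz κ.L, (A.Φ x - B.Φ x) * (A.r κ x - B.r κ x) ≤ 0 := by
  have dA : ∀ {x}, x ∈ Rect κ.L → DifferentiableAt ℝ A.Φ x := fun hx =>
    h.fst.Φ_up.differentiableAt hx
  have dB : ∀ {x}, x ∈ Rect κ.L → DifferentiableAt ℝ B.Φ x := fun hx =>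
    h.snd.Φ_up.differentiableAt hx
  have wall : ∀ t ∈ Icc 0 κ.L, ((t, 0) : Pt) ∈ Rect κ.L ∧ ((t, 1) : Pt) ∈ Rect κ.L :=
    fun t ht => ⟨⟨ht, by simp⟩, ⟨ht, by simp⟩⟩
  have := integral_grad_sq κ.hL (h.fst.Φ_up.sub h.snd.Φ_up)
    (h.fst.Φ_smooth.sub h.snd.Φ_smooth) (F := fun x => A.r κ x - B.r κ x)
    ((h.fst.cont_r h.le_one).sub (h.snd.cont_r h.le_one))
    (fun x hx => by
      rw [lap_sub (isOpen_Noz _) h.fst.Φ_smooth h.snd.Φ_smooth hx, h.poisson x hx])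
    (fun t ht => by
      rw [pd2_sub (dA (wall t ht).1) (dB (wall t ht).1), h.fst.Φ_bot t ht, h.snd.Φ_bot t ht]
      simp)
    (fun t ht => by
      rw [pd2_sub (dA (wall t ht).2) (dB (wall t ht).2), h.fst.Φ_top t ht, h.snd.Φ_top t ht]
      simp)
    (fun t ht => by simp [h.Φ_in t ht]) (fun t ht => by simp [h.Φ_out t ht])
  have nn : 0 ≤ ∫ x in Noz κ.L, (pd1 (fun y => A.Φ y - B.Φ y) x ^ 2 +
      pd2 (fun y => A.Φ y - B.Φ y) x ^ 2) := setIntegral_Noz_nonneg fun x _ => by positivity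
  linarith

/-- Energy estimate for the velocity and the electric potential. -/
lemma exists_eX_le (κ : FlowConst) : ∃ N > 0, ∀ ε A B, FlowPair κ ε A B →
    eX κ A B ≤ N * (eY κ A B + eQ κ A B + |eB κ A B|) := by
  have hc := κ.hc
  have hC := κ.hC
  refine ⟨2 / κ.c * (κ.C + κ.c / 2 + 20 * κ.C ^ 2 / κ.c + 1), by positivity, fun ε A B h => ?_⟩
  have X0 := eX_nonneg κ A B
  have Y0 := eY_nonneg κ A B
  have Q0 := eQ_nonneg κ A B
  have B0 := abs_nonneg (eB κ A B)
  have cA := h.fst.cont_flux h.le_one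
  have cB := h.snd.cont_flux h.le_one
  have i1 : IntegrableOn (fun x =>
      (A.r κ x * A.u x - B.r κ x * B.u x) * pd1 (fun y => A.φ y - B.φ y) x +
      (A.r κ x * A.v x - B.r κ x * B.v x) * pd2 (fun y => A.φ y - B.φ y) x) (Noz κ.L) :=
    integrableOn_Noz (((cA.1.sub cB.1).mul h.w_up.continuousOn_pd1).add
      ((cA.2.sub cB.2).mul h.w_up.continuousOn_pd2))
  have i2 : IntegrableOn (fun x =>
      (A.r κ x * A.u x - B.r κ x * B.u x) * pd2 (fun y => A.ψ y - B.ψ y) x -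
      (A.r κ x * A.v x - B.r κ x * B.v x) * pd1 (fun y => A.ψ y - B.ψ y) x) (Noz κ.L) :=
    integrableOn_Noz (((cA.1.sub cB.1).mul h.q_up.continuousOn_pd2).sub
      ((cA.2.sub cB.2).mul h.q_up.continuousOn_pd1))
  have i3 : IntegrableOn (fun x => (A.Φ x - B.Φ x) * (A.r κ x - B.r κ x)) (Noz κ.L) :=
    integrableOn_Noz ((h.fst.Φ_reg.cont.sub h.snd.Φ_reg.cont).mul
      ((h.fst.cont_r h.le_one).sub (h.snd.cont_r h.le_one)))
  have i12 : IntegrableOn (fun x =>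
      ((A.r κ x * A.u x - B.r κ x * B.u x) * pd1 (fun y => A.φ y - B.φ y) x +
      (A.r κ x * A.v x - B.r κ x * B.v x) * pd2 (fun y => A.φ y - B.φ y) x) +
      ((A.r κ x * A.u x - B.r κ x * B.u x) * pd2 (fun y => A.ψ y - B.ψ y) x -
      (A.r κ x * A.v x - B.r κ x * B.v x) * pd1 (fun y => A.ψ y - B.ψ y) x)) (Noz κ.L) :=
    i1.add i2
  have mono : κ.c * eX κ A B - κ.C * eY κ A B ≤ eB κ A B + (∫ x in Noz κ.L,
      ((A.r κ x * A.u x - B.r κ x * B.u x) * pd2 (fun y => A.ψ y - B.ψ y) x -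
      (A.r κ x * A.v x - B.r κ x * B.v x) * pd1 (fun y => A.ψ y - B.ψ y) x)) +
      ∫ x in Noz κ.L, (A.Φ x - B.Φ x) * (A.r κ x - B.r κ x) := by
    have jX : IntegrableOn (fun x => κ.c * ((A.u x - B.u x) ^ 2 +
      (A.v x - B.v x) ^ 2 + (A.Φ x - B.Φ x) ^ 2)) (Noz κ.L) := h.integrable_X.const_mul _
    have jY : IntegrableOn (fun x => κ.C * ((A.S x - B.S x) ^ 2 +
      (A.K x - B.K x) ^ 2)) (Noz κ.L) := h.integrable_Y.const_mul _
    rw [eX, eY, ← integral_const_mul, ← integral_const_mul, ← integral_sub jX jY,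
      ← h.integral_flux_sub, ← integral_add i1 i2, ← integral_add i12 i3]
    refine setIntegral_Noz_mono (jX.sub jY) (i12.add i3) fun x hx => ?_
    have hx' := Noz_subset_Rect _ hx
    have := (h.comparison x hx').monotone
    refine this.trans (le_of_eq ?_)
    rw [h.u_sub hx', h.v_sub hx']
    ring
  have mid : |∫ x in Noz κ.L,
      ((A.r κ x * A.u x - B.r κ x * B.u x) * pd2 (fun y => A.ψ y - B.ψ y) x -
      (A.r κ x * A.v x - B.r κ x * B.v x) * pd1 (fun y => A.ψ y - B.ψ y) x)| ≤
      κ.c / 2 * (eX κ A B + eY κ A B) + 20 * κ.C ^ 2 / κ.c * eQ κ A B := by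
    have jj : IntegrableOn (fun x => κ.c / 2 * jump A B x) (Noz κ.L) :=
      (integrableOn_Noz h.cont_jump).const_mul _
    have jq : IntegrableOn (fun x => 20 * κ.C ^ 2 / κ.c * (pd1 (fun y => A.ψ y - B.ψ y) x ^ 2 +
        pd2 (fun y => A.ψ y - B.ψ y) x ^ 2)) (Noz κ.L) := h.integrable_Q.const_mul _
    rw [← h.integral_jump, eQ, ← integral_const_mul, ← integral_const_mul, ← integral_add jj jq]
    refine abs_setIntegral_Noz_le (jj.add jq) fun x hx => ?_
    have hx' := Noz_subset_Rect _ hx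
    have c := h.comparison x hx'
    have a0 := absJump_nonneg A B x
    have f1 : |A.r κ x * A.u x - B.r κ x * B.u x| ≤ κ.C * absJump A B x := c.flux₁
    have f2 : |A.r κ x * A.v x - B.r κ x * B.v x| ≤ κ.C * absJump A B x := c.flux₂
    have sq := absJump_sq_le A B x
    generalize pd1 (fun y => A.ψ y - B.ψ y) x = a at *
    generalize pd2 (fun y => A.ψ y - B.ψ y) x = b at *
    generalize absJump A B x = J at *
    have young := abs_mul_le_weighted (show 0 < κ.c / 10 by positivity) J (κ.C * (|a| + |b|))
    have hab : (κ.C * (|a| + |b|)) ^ 2 ≤ 2 * κ.C ^ 2 * (a ^ 2 + b ^ 2) := by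
      have : (|a| + |b|) ^ 2 ≤ 2 * (a ^ 2 + b ^ 2) := by
        nlinarith [sq_nonneg (|a| - |b|), sq_abs a, sq_abs b]
      rw [mul_pow, mul_comm 2, mul_assoc]
      gcongr
    calc |(A.r κ x * A.u x - B.r κ x * B.u x) * b - (A.r κ x * A.v x - B.r κ x * B.v x) * a|
        ≤ κ.C * J * |b| + κ.C * J * |a| := by
          refine (abs_sub _ _).trans ?_
          rw [abs_mul, abs_mul]
          gcongr
      _ = J * (κ.C * (|a| + |b|)) := by ring
      _ ≤ κ.c / 10 * J ^ 2 + (κ.c / 10)⁻¹ * (κ.C * (|a| + |b|)) ^ 2 := (le_abs_self _).trans young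
      _ ≤ κ.c / 10 * (5 * jump A B x) + (κ.c / 10)⁻¹ * (2 * κ.C ^ 2 * (a ^ 2 + b ^ 2)) := by
          gcongr
      _ = κ.c / 2 * jump A B x + 20 * κ.C ^ 2 / κ.c * (a ^ 2 + b ^ 2) := by
          field_simp; ring
  have neg := h.integral_density_nonpos
  have key : κ.c / 2 * eX κ A B ≤
      (κ.C + κ.c / 2 + 20 * κ.C ^ 2 / κ.c + 1) * (eY κ A B + eQ κ A B + |eB κ A B|) := by
    have p : 0 ≤ 20 * κ.C ^ 2 / κ.c := by positivity
    have m1 := (le_abs_self _).trans mid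
    have m2 := le_abs_self (eB κ A B)
    nlinarith [mul_nonneg p Y0, mul_nonneg p B0, mul_nonneg hC.le Q0, mul_nonneg hC.le B0,
      mul_nonneg hc.le Q0, mul_nonneg hc.le B0]
  calc eX κ A B = 2 / κ.c * (κ.c / 2 * eX κ A B) := by field_simp
    _ ≤ 2 / κ.c * ((κ.C + κ.c / 2 + 20 * κ.C ^ 2 / κ.c + 1) *
        (eY κ A B + eQ κ A B + |eB κ A B|)) := by gcongr
    _ = _ := by ring

set_option maxHeartbeats 1000000 in
/-- Estimate of the exit contribution, where only the pressure is prescribed. -/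
lemma exists_eB_le (κ : FlowConst) : ∃ N > 0, ∀ ε A B, FlowPair κ ε A B → ∀ η > 0,
    |eB κ A B| ≤ N * (η * eW κ A B + η⁻¹ * eT κ A B + ε * eW κ A B) := by
  have hC := κ.hC
  have hL := κ.hL
  have hm := κ.hm
  have hM : 0 < κ.M := zero_lt_one.trans_le κ.hM
  set D : ℝ := κ.C * ((2 * κ.M + 2 * κ.M ^ 2) / (κ.ν / (κ.γ - 1)) + κ.M / κ.cv) / (κ.γ - 1)
    with hD
  have hD0 : 0 ≤ D := by
    have := κ.hν
    have := κ.hcv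
    have : 0 < κ.γ - 1 := by linarith [κ.hγ]
    positivity
  have hI : 0 ≤ ∫ t in Ioo (0 : ℝ) 1, wt κ.α t ^ 2 := integral_nonneg fun t => sq_nonneg _
  set Z : ℝ := 1 + 2 * (∫ t in Ioo (0 : ℝ) 1, wt κ.α t ^ 2) * (4 * κ.L ^ 2 + 1) with hZ
  set d : ℝ := κ.C * 2 * ((2 * κ.M) / (2 * κ.m) ^ 2) + (2 * κ.m)⁻¹ * (κ.C * 2 + 2 * D) +
    κ.C * 2 * (2 * κ.m)⁻¹ * κ.L⁻¹ with hd
  refine ⟨(4 * κ.L ^ 2 + 1) + 2 * κ.C ^ 2 + d * Z, by positivity, fun ε A B h η hη => ?_⟩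
  have hε := h.nonneg
  have hLm : κ.L ∈ Icc 0 κ.L := ⟨hL.le, le_rfl⟩
  set a : Pt → ℝ := fun x => x.1 / κ.L * (B.r κ x * (A.v x + B.v x) * (A.u x + B.u x)⁻¹) with ha
  have hu : Reg κ.α κ.L (κ.M + κ.M) (κ.M + κ.M) (fun x => A.u x + B.u x) :=
    h.fst.u_reg.add h.snd.u_reg
  have rinv := hu.inv (m := 2 * κ.m) (by positivity) fun x hx => by
    linarith [(h.fst.state x hx).le_u, (h.snd.state x hx).le_u]
  have ra₀ := (reg_fst_div hL).mul ((h.reg_r_snd.mul (h.fst.v_reg.add h.snd.v_reg)).mul rinv)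
  have ra : Reg κ.α κ.L _ (d * ε) a := ra₀.mono le_rfl (le_of_eq (by rw [hd]; ring))
  have wL : ∀ t ∈ Icc (0 : ℝ) 1, A.v (κ.L, t) - B.v (κ.L, t) =
      pd2 (fun y => A.φ y - B.φ y) (κ.L, t) := fun t ht => by
    have hx := mem_Rect_right hL ht
    rw [h.v_sub hx, pd1_sub (h.fst.ψ_up.differentiableAt hx) (h.snd.ψ_up.differentiableAt hx),
      h.fst.ψ_out t ht, h.snd.ψ_out t ht]
    simp
  have b1 := abs_exit_integral_le hL κ.hα (by positivity) ra h.w_up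
    (h.fst.φ_smooth.sub h.snd.φ_smooth) h.w_in
    (fun t ht => by simp [ha, h.fst.v_bot t ht, h.snd.v_bot t ht])
    (fun t ht => by simp [ha, h.fst.v_top t ht, h.snd.v_top t ht])
  have b2 := (trace_right hL h.w_up h.w_in).trans
    (mul_le_mul_of_nonneg_left h.integral_pd1_w_le (by positivity))
  have cA := (h.fst.cont_flux h.le_one).1
  have cB := (h.snd.cont_flux h.le_one).1
  have cw := h.w_up.continuousOn
  set g : Pt → ℝ := fun x => (A.r κ x * A.u x - B.r κ x * B.u x +
    a x * (A.v x - B.v x)) * (A.φ x - B.φ x) with hg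
  have cg : ContinuousOn g (Rect κ.L) := ((cA.sub cB).add
    (ra.cont.mul (h.fst.v_reg.cont.sub h.snd.v_reg.cont))).mul cw
  have ca : ContinuousOn (fun x => a x * ((A.φ x - B.φ x) * pd2 (fun y => A.φ y - B.φ y) x))
    (Rect κ.L) := ra.cont.mul (cw.mul h.w_up.continuousOn_pd2)
  have split : eB κ A B = (∫ t in (0 : ℝ)..1, g (κ.L, t)) - ∫ t in (0 : ℝ)..1,
      a (κ.L, t) * ((A.φ (κ.L, t) - B.φ (κ.L, t)) * pd2 (fun y => A.φ y - B.φ y) (κ.L, t)) := by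
    rw [← intervalIntegral.integral_sub (intervalIntegrable_slice cg hLm)
      (intervalIntegrable_slice ca hLm), eB]
    refine intervalIntegral.integral_congr fun t ht => ?_
    rw [uIcc_of_le zero_le_one] at ht
    simp only [hg]
    rw [wL t ht]
    ring
  have cw2 : ContinuousOn (fun x => (A.φ x - B.φ x) ^ 2) (Rect κ.L) := cw.pow 2
  have cT : ContinuousOn (fun x => (A.S x - B.S x) ^ 2 + (A.K x - B.K x) ^ 2) (Rect κ.L) :=
    ((h.fst.S_reg.cont.sub h.snd.S_reg.cont).pow 2).add
      ((h.fst.K_reg.cont.sub h.snd.K_reg.cont).pow 2)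
  have iw := (intervalIntegrable_slice cw2 hLm).const_mul η
  have iT := (intervalIntegrable_slice cT hLm).const_mul (η⁻¹ * (2 * κ.C ^ 2))
  have b3 : |∫ t in (0 : ℝ)..1, g (κ.L, t)| ≤
      η * (∫ t in (0 : ℝ)..1, (A.φ (κ.L, t) - B.φ (κ.L, t)) ^ 2) +
        η⁻¹ * (2 * κ.C ^ 2) * eT κ A B := by
    rw [eT, ← intervalIntegral.integral_const_mul, ← intervalIntegral.integral_const_mul,
      ← intervalIntegral.integral_add iw iT]
    refine (intervalIntegral.abs_integral_le_integral_abs zero_le_one).trans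
      (intervalIntegral.integral_mono_on zero_le_one (intervalIntegrable_slice cg hLm).abs
        (iw.add iT) fun t ht => ?_)
    have ex := h.exit_flux t ht
    have e : a (κ.L, t) = B.r κ (κ.L, t) * (A.v (κ.L, t) + B.v (κ.L, t)) *
        (A.u (κ.L, t) + B.u (κ.L, t))⁻¹ := by simp [ha, div_self hL.ne']
    rw [← e] at ex
    have y := abs_mul_le_weighted hη (A.φ (κ.L, t) - B.φ (κ.L, t))
      (A.r κ (κ.L, t) * A.u (κ.L, t) - B.r κ (κ.L, t) * B.u (κ.L, t) +
        a (κ.L, t) * (A.v (κ.L, t) - B.v (κ.L, t)))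
    simp only [hg]
    rw [mul_comm, mul_assoc η⁻¹]
    refine y.trans (add_le_add le_rfl (mul_le_mul_of_nonneg_left ?_ (by positivity)))
    rw [← sq_abs]
    refine (pow_le_pow_left₀ (abs_nonneg _) ex 2).trans ?_
    rw [mul_pow, mul_comm 2, mul_assoc]
    refine mul_le_mul_of_nonneg_left ?_ (by positivity)
    have (p q : ℝ) : (|p| + |q|) ^ 2 ≤ 2 * (p ^ 2 + q ^ 2) := by
      nlinarith [sq_nonneg (|p| - |q|), sq_abs p, sq_abs q]
    exact this _ _
  have W0 := eW_nonneg κ A B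
  have T0 := eT_nonneg κ A B
  have b4 : |eB κ A B| ≤ η * ((4 * κ.L ^ 2 + 1) * eW κ A B) + η⁻¹ * (2 * κ.C ^ 2) * eT κ A B +
      d * ε * Z * eW κ A B := by
    rw [split]
    refine (abs_sub _ _).trans (add_le_add (b3.trans ?_) b1)
    gcongr
  have hdZ : 0 ≤ d * Z := by positivity
  have hi : 0 ≤ η⁻¹ * eT κ A B := by positivity
  have hw : 0 ≤ η * eW κ A B := by positivity
  have he : 0 ≤ ε * eW κ A B := by positivity
  have p1 : 0 ≤ 4 * κ.L ^ 2 + 1 := by positivity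
  have p2 : 0 ≤ 2 * κ.C ^ 2 := by positivity
  linarith [mul_nonneg p1 hi, mul_nonneg p1 he, mul_nonneg p2 hw, mul_nonneg p2 he,
    mul_nonneg hdZ hw, mul_nonneg hdZ hi]

end FlowPair

/-- Absorption argument for a closed system of energy inequalities. -/
lemma exists_absorb {N₁ N₂ N₃ N₄ : ℝ} (h₁ : 0 < N₁) (h₂ : 0 < N₂) (h₃ : 0 < N₃) (h₄ : 0 < N₄) :
    ∃ ε₀ > 0, ∀ ε X Y Q T W b : ℝ, 0 ≤ ε → ε ≤ ε₀ → 0 ≤ X → 0 ≤ Y → 0 ≤ Q → 0 ≤ T → 0 ≤ W →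
      X ≤ N₁ * (Y + Q + b) → Q ≤ N₂ * (Y + ε * (X + Y + Q)) → Y + T ≤ N₃ * (ε * (X + Y)) →
      (∀ η > 0, b ≤ N₄ * (η * W + η⁻¹ * T + ε * W)) → W ≤ 2 * (X + Q) →
      X = 0 ∧ Y = 0 ∧ Q = 0 := by
  set η : ℝ := (8 * N₁ * N₄)⁻¹ with hη
  have hη0 : 0 < η := by positivity
  set Z : ℝ := N₁ * (2 * N₃ + N₂ * (2 * N₃ + 2) + 2 * N₄ * η⁻¹ * N₃ + 2 * N₄) +
    N₂ * (2 * N₃ + 2) with hZ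
  have hZ0 : 0 < Z := by positivity
  refine ⟨min (2 * N₃)⁻¹ (4 * Z)⁻¹, by positivity, ?_⟩
  intro ε X Y Q T W b hε hle hX hY hQ hT hW eX eQ eY eB eW
  have l1 : ε * N₃ ≤ 1 / 2 := by
    have := hle.trans (min_le_left _ _)
    calc ε * N₃ ≤ (2 * N₃)⁻¹ * N₃ := by gcongr
      _ = 1 / 2 := by field_simp
  have l2 : ε * Z ≤ 1 / 4 := by
    have := hle.trans (min_le_right _ _)
    calc ε * Z ≤ (4 * Z)⁻¹ * Z := by gcongr
      _ = 1 / 4 := by field_simp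
  have bη := eB η hη0
  set P := X + Q with hP
  have hP0 : 0 ≤ P := by positivity
  have hY1 : Y ≤ 2 * N₃ * ε * P := by
    nlinarith [mul_nonneg (mul_nonneg hε h₃.le) hQ, mul_le_mul_of_nonneg_right l1 hY]
  have hYP : Y ≤ P := by nlinarith [mul_le_mul_of_nonneg_right l1 hP0]
  have hT1 : T ≤ 2 * N₃ * ε * P := by
    have : N₃ * (ε * (X + Y)) ≤ N₃ * (ε * (P + P)) := by gcongr; linarith
    linarith
  have hQ1 : Q ≤ ε * (N₂ * (2 * N₃ + 2)) * P := by
    have : N₂ * (Y + ε * (X + Y + Q)) ≤ N₂ * (2 * N₃ * ε * P + ε * (P + P)) := by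
      have : X + Y + Q ≤ P + P := by linarith
      gcongr
    linarith
  have hb1 : b ≤ N₄ * (η * (2 * P) + η⁻¹ * (2 * N₃ * ε * P) + ε * (2 * P)) :=
    bη.trans (by gcongr)
  have hX1 : X ≤ N₁ * (2 * N₃ * ε * P + ε * (N₂ * (2 * N₃ + 2)) * P +
      N₄ * (η * (2 * P) + η⁻¹ * (2 * N₃ * ε * P) + ε * (2 * P))) := eX.trans (by gcongr)
  have hηN : N₁ * (N₄ * η) = 1 / 8 := by rw [hη]; field_simp
  have fin : P ≤ 2 * (N₁ * (N₄ * η)) * P + ε * Z * P := by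
    rw [hZ]; linarith
  have hPle : P ≤ 0 := by
    rw [hηN] at fin
    nlinarith [mul_le_mul_of_nonneg_right l2 hP0]
  have hPz : P = 0 := le_antisymm hPle hP0
  rw [hPz] at hYP
  exact ⟨by linarith, by linarith, by linarith⟩

lemma eqOn_zero_of_integral_nonpos {L : ℝ} (hL : 0 < L) {f : Pt → ℝ} (hf : ContinuousOn f (Rect L))
    (h0 : ∀ x, 0 ≤ f x) (hi : ∫ x in Noz L, f x ≤ 0) : EqOn f 0 (Rect L) := by
  have hz : ∫ x in Noz L, f x = 0 := le_antisymm hi (setIntegral_Noz_nonneg fun x _ => h0 x)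
  have ae := (setIntegral_eq_zero_iff_of_nonneg_ae (Filter.Eventually.of_forall h0)
    (integrableOn_Noz hf)).1 hz
  have hN : EqOn f 0 (Noz L) := Measure.eqOn_open_of_ae_eq ae (isOpen_Noz L)
    (hf.mono (Noz_subset_Rect L)) continuousOn_const
  exact hN.of_subset_closure hf continuousOn_const (Noz_subset_Rect L) (closure_Noz hL).ge

/-- Two sufficiently small flows with the same data coincide. -/
theorem FlowPair.exists_eqOn (κ : FlowConst) : ∃ ε₀ > 0, ∀ ε A B, ε ≤ ε₀ → FlowPair κ ε A B →
    EqOn A.φ B.φ (Rect κ.L) ∧ EqOn A.ψ B.ψ (Rect κ.L) ∧ EqOn A.Φ B.Φ (Rect κ.L) ∧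
      EqOn A.S B.S (Rect κ.L) ∧ EqOn A.K B.K (Rect κ.L) := by
  obtain ⟨N₁, p₁, hX⟩ := exists_eX_le κ
  obtain ⟨N₂, p₂, hQ⟩ := exists_eQ_le κ
  obtain ⟨N₄, p₄, hB⟩ := exists_eB_le κ
  have hc := κ.hc
  have hm := κ.hm
  have hC := κ.hC
  have hL := κ.hL
  obtain ⟨ε₀, hε₀, absorb⟩ := exists_absorb p₁ p₂
    (show 0 < (κ.c * κ.m)⁻¹ * (40 * (κ.L + 1) * κ.C) by positivity) p₄
  refine ⟨ε₀, hε₀, fun ε A B hε h => ?_⟩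
  obtain ⟨zX, zY, zQ⟩ := absorb ε (eX κ A B) (eY κ A B) (eQ κ A B) (eT κ A B) (eW κ A B)
    |eB κ A B| h.nonneg hε (eX_nonneg κ A B) (eY_nonneg κ A B) (eQ_nonneg κ A B) (eT_nonneg κ A B)
    (eW_nonneg κ A B) (hX ε A B h) (hQ ε A B h)
    (by
      rw [mul_assoc, ← mul_assoc, mul_assoc, le_inv_mul_iff₀ (by positivity)]
      simpa only [mul_assoc] using h.transported_le) (hB ε A B h) h.eW_le
  have cX : ContinuousOn (fun x => (A.u x - B.u x) ^ 2 +
      (A.v x - B.v x) ^ 2 + (A.Φ x - B.Φ x) ^ 2) (Rect κ.L) :=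
    (((h.fst.u_reg.cont.sub h.snd.u_reg.cont).pow 2).add
    ((h.fst.v_reg.cont.sub h.snd.v_reg.cont).pow 2)).add
    ((h.fst.Φ_reg.cont.sub h.snd.Φ_reg.cont).pow 2)
  have cY : ContinuousOn (fun x => (A.S x - B.S x) ^ 2 + (A.K x - B.K x) ^ 2) (Rect κ.L) :=
    ((h.fst.S_reg.cont.sub h.snd.S_reg.cont).pow 2).add
      ((h.fst.K_reg.cont.sub h.snd.K_reg.cont).pow 2)
  have X := eqOn_zero_of_integral_nonpos hL cX (fun x => by positivity) zX.le
  have Y := eqOn_zero_of_integral_nonpos hL cY (fun x => by positivity) zY.le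
  have hw := h.eW_le
  rw [zX, zQ] at hw
  have w2 := poincare_left hL h.w_up h.w_in
  have q2 := poincare_wall hL h.q_up fun t ht => by
    simp [h.fst.ψ_bot t ht, h.snd.ψ_bot t ht]
  have w1 := h.integral_pd1_w_le
  have q1 := h.integral_pd2_q_le
  have W := eqOn_zero_of_integral_nonpos hL (h.w_up.continuousOn.pow 2)
    (fun x => by simp only [Pi.pow_apply]; positivity)
    (w2.trans (mul_nonpos_of_nonneg_of_nonpos (by positivity) (by linarith)))
  have Q := eqOn_zero_of_integral_nonpos hL (h.q_up.continuousOn.pow 2)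
    (fun x => by simp only [Pi.pow_apply]; positivity)
    (q2.trans (mul_nonpos_of_nonneg_of_nonpos (by positivity) (by linarith)))
  refine ⟨fun x hx => ?_, fun x hx => ?_, fun x hx => ?_, fun x hx => ?_, fun x hx => ?_⟩
  · have : (A.φ x - B.φ x) ^ 2 = 0 := W hx
    exact sub_eq_zero.1 (pow_eq_zero_iff two_ne_zero |>.1 this)
  · have : (A.ψ x - B.ψ x) ^ 2 = 0 := Q hx
    exact sub_eq_zero.1 (pow_eq_zero_iff two_ne_zero |>.1 this)
  · have : (A.u x - B.u x) ^ 2 + (A.v x - B.v x) ^ 2 + (A.Φ x - B.Φ x) ^ 2 = 0 := X hx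
    have : (A.Φ x - B.Φ x) ^ 2 = 0 := by
      nlinarith [sq_nonneg (A.u x - B.u x), sq_nonneg (A.v x - B.v x), sq_nonneg (A.Φ x - B.Φ x)]
    exact sub_eq_zero.1 (pow_eq_zero_iff two_ne_zero |>.1 this)
  · have : (A.S x - B.S x) ^ 2 + (A.K x - B.K x) ^ 2 = 0 := Y hx
    have : (A.S x - B.S x) ^ 2 = 0 := by
      nlinarith [sq_nonneg (A.S x - B.S x), sq_nonneg (A.K x - B.K x)]
    exact sub_eq_zero.1 (pow_eq_zero_iff two_ne_zero |>.1 this)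
  · have : (A.S x - B.S x) ^ 2 + (A.K x - B.K x) ^ 2 = 0 := Y hx
    have : (A.K x - B.K x) ^ 2 = 0 := by
      nlinarith [sq_nonneg (A.S x - B.S x), sq_nonneg (A.K x - B.K x)]
    exact sub_eq_zero.1 (pow_eq_zero_iff two_ne_zero |>.1 this)

/-! ### Pointwise bounds from the norms -/

lemma wSup_bound {k e : ℝ} {Γ Ω : Set Pt} {d : ℕ} {g : Pt → ℝ} (he : 0 ≤ e)
    (h : wSup k Γ Ω d g ≤ ENNReal.ofReal e) {x : Pt} (hx : x ∈ Ω) :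
    infDist x Γ ^ (max ((d : ℝ) + k) 0) * |g x| ≤ e :=
  (ENNReal.ofReal_le_ofReal_iff he).1 ((le_iSup₂ (f := fun x (_ : x ∈ Ω) =>
    ENNReal.ofReal (infDist x Γ ^ (max ((d : ℝ) + k) 0) * |g x|)) x hx).trans h)

lemma supAbs_bound {e : ℝ} {Ω : Set Pt} {g : Pt → ℝ} (he : 0 ≤ e)
    (h : supAbs Ω g ≤ ENNReal.ofReal e) {x : Pt} (hx : x ∈ Ω) : |g x| ≤ e :=
  (ENNReal.ofReal_le_ofReal_iff he).1 ((le_iSup₂ (f := fun x (_ : x ∈ Ω) =>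
    ENNReal.ofReal |g x|) x hx).trans h)

lemma wSup_le_whNorm {m : ℕ} {α k : ℝ} {Γ Ω : Set Pt} {f : Pt → ℝ} {i j : ℕ}
    (hij : (i, j) ∈ idxLe m) : wSup k Γ Ω (i + j) (Dmix i j f) ≤ whNorm m α k Γ Ω f :=
  (Finset.single_le_sum (f := fun p : ℕ × ℕ => wSup k Γ Ω (p.1 + p.2) (Dmix p.1 p.2 f))
    (fun _ _ => zero_le) hij).trans le_self_add

lemma supAbs_le_hNorm {m : ℕ} {α : ℝ} {Ω : Set Pt} {f : Pt → ℝ} {i j : ℕ}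
    (hij : (i, j) ∈ idxLe m) : supAbs Ω (Dmix i j f) ≤ hNorm m α Ω f :=
  (Finset.single_le_sum (f := fun p : ℕ × ℕ => supAbs Ω (Dmix p.1 p.2 f))
    (fun _ _ => zero_le) hij).trans le_self_add

lemma infDist_wall_rpow_le {α L : ℝ} (hα : α < 1) {x : Pt} (hx : x ∈ Noz L) :
    0 < infDist x (GamWbar L) ∧ infDist x (GamWbar L) ^ (α - 1) ≤ wt α x.2 := by
  have hL : 0 < L := hx.1.1.trans hx.1.2
  have hne : (GamWbar L).Nonempty := ⟨(0, 0), ⟨le_rfl, hL.le⟩, by simp⟩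
  have p1 : 0 < x.2 := hx.2.1
  have p2 : 0 < 1 - x.2 := sub_pos.2 hx.2.2
  have lo : min x.2 (1 - x.2) ≤ infDist x (GamWbar L) := by
    refine (le_infDist hne).2 fun y hy => ?_
    have : |x.2 - y.2| ≤ dist x y := by
      rw [← Real.dist_eq]; exact le_max_right _ _
    rcases hy.2 with h | h
    · rw [h] at this
      exact (min_le_left _ _).trans ((le_abs_self _).trans (by simpa using this))
    · rw [h, abs_sub_comm] at this
      exact (min_le_right _ _).trans ((le_abs_self _).trans this)
  have mpos : 0 < min x.2 (1 - x.2) := lt_min p1 p2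
  refine ⟨mpos.trans_le lo, (rpow_le_rpow_of_nonpos mpos lo (by linarith)).trans ?_⟩
  have q1 : 0 ≤ x.2 ^ (α - 1) := rpow_nonneg p1.le _
  have q2 : 0 ≤ (1 - x.2) ^ (α - 1) := rpow_nonneg p2.le _
  unfold wt
  rcases min_choice x.2 (1 - x.2) with h | h <;> rw [h] <;> linarith

/-- Pointwise bounds on a function and its first and second derivatives in the nozzle. -/
structure PointwiseSmall (α L e : ℝ) (f : Pt → ℝ) : Prop where
  val : ∀ x ∈ Noz L, |f x| ≤ e
  one : ∀ x ∈ Noz L, |pd1 f x| ≤ e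
  two : ∀ x ∈ Noz L, |pd2 f x| ≤ e
  one_one : ∀ x ∈ Noz L, |pd1 (pd1 f) x| ≤ e * wt α x.2
  one_two : ∀ x ∈ Noz L, |pd1 (pd2 f) x| ≤ e * wt α x.2
  two_two : ∀ x ∈ Noz L, |pd2 (pd2 f) x| ≤ e * wt α x.2

lemma pointwiseSmall_of_whNorm {α L e : ℝ} {f : Pt → ℝ} (hα0 : 0 < α) (hα : α < 1) (he : 0 ≤ e)
    (h : whNorm 2 α (-1 - α) (GamWbar L) (Noz L) f ≤ ENNReal.ofReal e) :
    PointwiseSmall α L e f := by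
  have low : ∀ i j : ℕ, (i, j) ∈ idxLe 2 → i + j ≤ 1 → ∀ x ∈ Noz L, |Dmix i j f x| ≤ e := by
    intro i j hij hle x hx
    have := wSup_bound he ((wSup_le_whNorm hij).trans h) hx
    have hle' : ((i + j : ℕ) : ℝ) ≤ 1 := by exact_mod_cast hle
    rw [max_eq_right (by linarith), rpow_zero, one_mul] at this
    exact this
  have high : ∀ i j : ℕ, (i, j) ∈ idxLe 2 → i + j = 2 → ∀ x ∈ Noz L,
      |Dmix i j f x| ≤ e * wt α x.2 := by
    intro i j hij hle x hx
    have := wSup_bound he ((wSup_le_whNorm hij).trans h) hx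
    obtain ⟨hpos, hwt⟩ := infDist_wall_rpow_le hα hx
    rw [hle, Nat.cast_ofNat, show (2 : ℝ) + (-1 - α) = 1 - α by ring,
      max_eq_left (by linarith)] at this
    have hp : infDist x (GamWbar L) ^ (α - 1) * infDist x (GamWbar L) ^ (1 - α) = 1 := by
      rw [← rpow_add hpos]; simp
    calc |Dmix i j f x| = infDist x (GamWbar L) ^ (α - 1) *
          (infDist x (GamWbar L) ^ (1 - α) * |Dmix i j f x|) := by rw [← mul_assoc, hp, one_mul]
      _ ≤ wt α x.2 * e := mul_le_mul hwt this (by positivity)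
          (zero_le_one.trans (one_le_wt hx.2))
      _ = _ := mul_comm _ _
  exact ⟨low 0 0 (by decide) (by norm_num), low 1 0 (by decide) (by norm_num),
    low 0 1 (by decide) (by norm_num), high 2 0 (by decide) (by norm_num),
    high 1 1 (by decide) (by norm_num), high 0 2 (by decide) (by norm_num)⟩

lemma bound_of_hNorm {α L e : ℝ} {f : Pt → ℝ} (he : 0 ≤ e)
    (h : hNorm 1 α (Noz L) f ≤ ENNReal.ofReal e) :
    ∀ x ∈ Noz L, |f x| ≤ e ∧ |pd1 f x| ≤ e ∧ |pd2 f x| ≤ e := fun _ hx =>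
  ⟨supAbs_bound he ((supAbs_le_hNorm (i := 0) (j := 0) (by decide)).trans h) hx,
    supAbs_bound he ((supAbs_le_hNorm (i := 1) (j := 0) (by decide)).trans h) hx,
    supAbs_bound he ((supAbs_le_hNorm (i := 0) (j := 1) (by decide)).trans h) hx⟩

lemma abs_le_on_Rect {L e : ℝ} (hL : 0 < L) {f : Pt → ℝ} (hf : ContinuousOn f (Rect L))
    (h : ∀ x ∈ Noz L, |f x| ≤ e) : ∀ x ∈ Rect L, |f x| ≤ e := by
  rw [← closure_Noz hL] at hf ⊢
  exact fun x hx => le_on_closure h hf.abs continuousOn_const hx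

lemma eq_zero_on_walls {L : ℝ} (hL : 0 < L) {f : Pt → ℝ} (hf : ContinuousOn f (Rect L))
    {c : ℝ} (hc : c ∈ ({0, 1} : Set ℝ)) (h : ∀ x ∈ GamW L, f x = 0) :
    ∀ t ∈ Icc 0 L, f (t, c) = 0 := by
  have hc' : c ∈ Icc (0 : ℝ) 1 := by
    rcases hc with rfl | rfl <;> simp
  have cont : ContinuousOn (fun t => f (t, c)) (Icc 0 L) :=
    hf.comp (by fun_prop) fun t ht => ⟨ht, hc'⟩
  have e : EqOn (fun t => f (t, c)) (fun _ => 0) (Ioo 0 L) := fun t ht => h (t, c) ⟨ht, hc⟩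
  exact e.of_subset_closure cont continuousOn_const Ioo_subset_Icc_self (closure_Ioo hL.ne).ge

lemma pd1_wall {L : ℝ} {f : Pt → ℝ} (hd : ∀ x ∈ GamW L, DifferentiableAt ℝ f x)
    (h : ∀ x ∈ GamW L, f x = 0) : ∀ x ∈ GamW L, pd1 f x = 0 := by
  rintro ⟨t, c⟩ hx
  have h1 : HasDerivAt (fun s : ℝ => ((s, c) : Pt)) (1, 0) t :=
    (hasDerivAt_id t).prodMk (hasDerivAt_const t c)
  have h2 := (hd _ hx).hasFDerivAt.comp_hasDerivAt t h1
  have h3 : HasDerivAt (f ∘ fun s : ℝ => ((s, c) : Pt)) 0 t := by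
    refine (hasDerivAt_const t (0 : ℝ)).congr_of_eventuallyEq ?_
    filter_upwards [Ioo_mem_nhds hx.1.1 hx.1.2] with s hs
    exact h (s, c) ⟨hs, hx.2⟩
  exact h2.unique h3

/-! ### The background solution -/

namespace Background
variable {γ 𝔭 cv b₀ J₀ S₀ E₀ ρ₀ L ν₀ ρlow ρhigh : ℝ} {ρb Eb : ℝ → ℝ}

lemma pos_rho (h : Background γ 𝔭 cv b₀ J₀ S₀ E₀ ρ₀ L ν₀ ρlow ρhigh ρb Eb) {t : ℝ}
    (ht : t ∈ Icc 0 L) : 0 < ρb t := h.hρlow.trans_le (h.bound_lo t ht)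

lemma contDiffOn_velocity (h : Background γ 𝔭 cv b₀ J₀ S₀ E₀ ρ₀ L ν₀ ρlow ρhigh ρb Eb) :
    ContDiffOn ℝ 1 (fun t => J₀ / ρb t) (Icc 0 L) :=
  contDiffOn_const.div (h.smooth_rho.of_le (by exact_mod_cast le_top)) fun _ ht => (h.pos_rho ht).ne'

lemma hasDerivAt_primitive {g : ℝ → ℝ} (hg : ContinuousOn g (Icc 0 L)) {t : ℝ}
    (ht : t ∈ Ioo 0 L) : HasDerivAt (fun s => ∫ r in (0 : ℝ)..s, g r) (g t) t := by
  have hn : Icc 0 L ∈ nhds t := Icc_mem_nhds ht.1 ht.2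
  refine intervalIntegral.integral_hasDerivAt_right ?_ ?_ (hg.continuousAt hn)
  · refine (hg.mono ?_).intervalIntegrable
    rw [uIcc_of_le ht.1.le]
    exact Icc_subset_Icc_right ht.2.le
  · exact (hg.mono Ioo_subset_Icc_self).stronglyMeasurableAtFilter isOpen_Ioo t ht

lemma continuousOn_primitive {g : ℝ → ℝ} (hL : 0 < L) (hg : ContinuousOn g (Icc 0 L)) :
    ContinuousOn (fun s => ∫ r in (0 : ℝ)..s, g r) (Icc 0 L) := by
  have := intervalIntegral.continuousOn_primitive_interval (μ := volume) (f := g) (a := 0) (b := L)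
    (by rw [uIcc_of_le hL.le]; exact hg.integrableOn_compact isCompact_Icc)
  rwa [uIcc_of_le hL.le] at this

/-- Bernoulli's law for the background solution. -/
lemma bernoulli (h : Background γ 𝔭 cv b₀ J₀ S₀ E₀ ρ₀ L ν₀ ρlow ρhigh ρb Eb) :
    ∀ t ∈ Icc 0 L, Bern0 γ 𝔭 cv S₀ J₀ ρ₀ + (∫ s in (0 : ℝ)..t, Eb s) - (J₀ / ρb t) ^ 2 / 2 =
      γ * 𝔭 * exp (S₀ / cv) * ρb t ^ (γ - 1) / (γ - 1) := by
  set F : ℝ → ℝ := fun t => (J₀ / ρb t) ^ 2 / 2 +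
    γ * 𝔭 * exp (S₀ / cv) * ρb t ^ (γ - 1) / (γ - 1) - ∫ s in (0 : ℝ)..t, Eb s with hF
  have hg : γ - 1 ≠ 0 := by linarith [h.hγ]
  have cF : ContinuousOn F (Icc 0 L) := by
    refine ContinuousOn.sub (ContinuousOn.add ?_ ?_)
      (continuousOn_primitive h.hL h.smooth_E.continuousOn)
    · exact (h.contDiffOn_velocity.continuousOn.pow 2).div_const 2
    · exact (continuousOn_const.mul (h.smooth_rho.continuousOn.rpow_const
        fun t ht => Or.inl (h.pos_rho ht).ne')).div_const _
  have dF : ∀ t ∈ Ioo 0 L, HasDerivAt F 0 t := by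
    intro t ht
    have ht' := Ioo_subset_Icc_self ht
    have hn : Icc 0 L ∈ nhds t := Icc_mem_nhds ht.1 ht.2
    have pos := h.pos_rho ht'
    have dρ : HasDerivAt ρb (derivWithin ρb (Icc 0 L) t) t := by
      have := ((h.smooth_rho.differentiableOn (by simp)) t ht').hasDerivWithinAt.hasDerivAt hn
      exact this
    rw [h.ode_rho t ht'] at dρ
    have hsub := h.subsonic t ht'
    have hne : γ * 𝔭 * exp (S₀ / cv) * ρb t ^ (γ - 1) - J₀ ^ 2 / ρb t ^ 2 ≠ 0 :=
      (h.hν₀.trans_le hsub).ne'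
    have d1 := ((((hasDerivAt_const t J₀).div dρ pos.ne').pow 2).div_const 2).add
      (((dρ.rpow_const (p := γ - 1) (Or.inl pos.ne')).const_mul
        (γ * 𝔭 * exp (S₀ / cv))).div_const (γ - 1)) |>.sub
      (hasDerivAt_primitive h.smooth_E.continuousOn ht)
    refine d1.congr_deriv ?_
    have hr : ρb t ^ (γ - 1 - 1) = ρb t ^ (γ - 1) / ρb t := by
      rw [rpow_sub_one pos.ne']
    rw [hr]
    set X := γ * 𝔭 * exp (S₀ / cv) * ρb t ^ (γ - 1) - J₀ ^ 2 / ρb t ^ 2 with hX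
    have hE : Eb t = (γ * 𝔭 * exp (S₀ / cv) * ρb t ^ (γ - 1) - J₀ ^ 2 / ρb t ^ 2) *
      (Eb t / X) := by rw [← hX]; field_simp
    have hY : ρb t * Eb t / X = ρb t * (Eb t / X) := by ring
    rw [hY]
    generalize Eb t / X = Y at *
    rw [hE]
    generalize ρb t ^ (γ - 1) = R
    have hp := pos.ne'
    simp only [Nat.cast_ofNat, Pi.div_apply, Nat.add_one_sub_one, pow_one]
    field_simp
    ring
  intro t ht
  have key : F t = F 0 := by
    rcases ht.1.eq_or_lt with rfl | h0
    · rfl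
    · obtain ⟨c, hc, hs⟩ := exists_hasDerivAt_eq_slope F (fun _ => 0) h0
        (cF.mono (Icc_subset_Icc_right ht.2)) fun s hs => dF s ⟨hs.1, hs.2.trans_le ht.2⟩
      have := (div_eq_zero_iff.1 hs.symm).resolve_right (by linarith)
      linarith
  have e0 : F 0 = Bern0 γ 𝔭 cv S₀ J₀ ρ₀ := by
    simp [hF, Bern0, h.init_rho]
  rw [e0] at key
  simp only [hF] at key
  linarith

lemma exists_bounds (h : Background γ 𝔭 cv b₀ J₀ S₀ E₀ ρ₀ L ν₀ ρlow ρhigh ρb Eb) :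
    ∃ D > 0, (∀ t ∈ Icc 0 L, J₀ / ρb t ≤ D ∧ |Eb t| ≤ D ∧ |∫ s in (0 : ℝ)..t, Eb s| ≤ D) ∧
      ∀ t ∈ Ioo 0 L, |deriv (fun s => J₀ / ρb s) t| ≤ D := by
  have hu := h.contDiffOn_velocity
  obtain ⟨D₁, h₁⟩ := isCompact_Icc.exists_bound_of_continuousOn hu.continuousOn
  obtain ⟨D₂, h₂⟩ := isCompact_Icc.exists_bound_of_continuousOn h.smooth_E.continuousOn
  obtain ⟨D₃, h₃⟩ := isCompact_Icc.exists_bound_of_continuousOn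
    (continuousOn_primitive h.hL h.smooth_E.continuousOn)
  obtain ⟨D₄, h₄⟩ := isCompact_Icc.exists_bound_of_continuousOn
    (hu.continuousOn_derivWithin (uniqueDiffOn_Icc h.hL) le_rfl)
  refine ⟨|D₁| + |D₂| + |D₃| + |D₄| + 1, by positivity, fun t ht => ⟨?_, ?_, ?_⟩, fun t ht => ?_⟩
  · have := (le_abs_self _).trans (h₁ t ht)
    linarith [le_abs_self D₁, abs_nonneg D₂, abs_nonneg D₃, abs_nonneg D₄]
  · have := h₂ t ht
    rw [Real.norm_eq_abs] at this
    linarith [le_abs_self D₂, abs_nonneg D₁, abs_nonneg D₃, abs_nonneg D₄]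
  · have := h₃ t ht
    rw [Real.norm_eq_abs] at this
    linarith [le_abs_self D₃, abs_nonneg D₁, abs_nonneg D₂, abs_nonneg D₄]
  · have := h₄ t (Ioo_subset_Icc_self ht)
    rw [derivWithin_of_mem_nhds (Icc_mem_nhds ht.1 ht.2), Real.norm_eq_abs] at this
    linarith [le_abs_self D₄, abs_nonneg D₁, abs_nonneg D₂, abs_nonneg D₃]

end Background

/-! ### Solutions close to the background -/

lemma primitive_fst {L : ℝ} {g : ℝ → ℝ} (hg : ContinuousOn g (Icc 0 L)) {x : Pt} (hx : x ∈ Noz L) :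
    DifferentiableAt ℝ (fun y : Pt => ∫ t in (0 : ℝ)..y.1, g t) x ∧
      pd1 (fun y : Pt => ∫ t in (0 : ℝ)..y.1, g t) x = g x.1 ∧
      pd2 (fun y : Pt => ∫ t in (0 : ℝ)..y.1, g t) x = 0 := by
  have d := Background.hasDerivAt_primitive hg hx.1
  refine ⟨?_, (pd1_fst (φ := fun s => ∫ t in (0 : ℝ)..s, g t) d.differentiableAt).trans d.deriv,
    pd2_fst (φ := fun s => ∫ t in (0 : ℝ)..s, g t) d.differentiableAt⟩
  exact (d.comp_hasFDerivAt x
    (hasFDerivAt_fst (𝕜 := ℝ) (E := ℝ) (F := ℝ) (p := x))).differentiableAt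

/-- Pointwise `e`-closeness to the background solution. -/
structure NearBackground (κ : FlowConst) (J₀ ρ₀ : ℝ) (ρb Eb : ℝ → ℝ) (e : ℝ) (U : Fld) : Prop where
  φ : PointwiseSmall κ.α κ.L e (fun x => U.φ x - phi0 J₀ ρb x)
  ψ : PointwiseSmall κ.α κ.L e U.ψ
  Φ : PointwiseSmall κ.α κ.L e (fun x => U.Φ x - Phi0 Eb x)
  S : ∀ x ∈ Noz κ.L, |U.S x - κ.S₀| ≤ e ∧ |pd1 U.S x| ≤ e ∧ |pd2 U.S x| ≤ e
  K : ∀ x ∈ Noz κ.L, |U.K x - Bern0 κ.γ κ.𝔭 κ.cv κ.S₀ J₀ ρ₀| ≤ e ∧ |pd1 U.K x| ≤ e ∧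
    |pd2 U.K x| ≤ e

lemma nearBackground_of_refEst {κ : FlowConst} {J₀ ρ₀ C e : ℝ} {ρb Eb : ℝ → ℝ} {U : Fld}
    {ω : ℝ≥0∞} (hα : κ.α < 1) (he : 0 ≤ e) (hω : ENNReal.ofReal C * ω ≤ ENNReal.ofReal e)
    (h : RefEst κ.γ κ.𝔭 κ.cv J₀ κ.S₀ ρ₀ κ.L κ.α C ρb Eb U.φ U.ψ U.Φ U.S U.K ω) :
    NearBackground κ J₀ ρ₀ ρb Eb e U := by
  have hα0 : 0 < κ.α := by linarith [κ.hα]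
  have h := h.trans hω
  have h4 := le_self_add.trans h
  have h3 := le_self_add.trans h4
  have h2 := le_self_add.trans h3
  have sub_const : ∀ (f : Pt → ℝ) (k : ℝ) (x : Pt), pd1 (fun y => f y - k) x = pd1 f x ∧
      pd2 (fun y => f y - k) x = pd2 f x := by
    intro f k x
    simp [pd1, pd2, fderiv_sub_const]
  refine ⟨pointwiseSmall_of_whNorm hα0 hα he (le_self_add.trans h2),
    pointwiseSmall_of_whNorm hα0 hα he (le_add_self.trans h2),
    pointwiseSmall_of_whNorm hα0 hα he (le_add_self.trans h3), fun x hx => ?_, fun x hx => ?_⟩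
  · have := bound_of_hNorm he (le_add_self.trans h4) x hx
    rwa [(sub_const _ _ x).1, (sub_const _ _ x).2] at this
  · have := bound_of_hNorm he (le_add_self.trans h) x hx
    rwa [(sub_const _ _ x).1, (sub_const _ _ x).2] at this

namespace NearBackground
variable {κ : FlowConst} {J₀ b₀ E₀ ρ₀ ν₀ ρlow ρhigh e D : ℝ} {ρb Eb : ℝ → ℝ} {U : Fld}

lemma velocity_inside (h : NearBackground κ J₀ ρ₀ ρb Eb e U)
    (hg : ContinuousOn (fun t => J₀ / ρb t) (Icc 0 κ.L)) (hφ : UpTo 1 U.φ (Rect κ.L)) {x : Pt}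
    (hx : x ∈ Noz κ.L) : |U.u x - J₀ / ρb x.1| ≤ 2 * e ∧ |U.v x| ≤ 2 * e := by
  obtain ⟨d, p1, p2⟩ := primitive_fst hg hx
  have dφ := hφ.differentiableAt (Noz_subset_Rect _ hx)
  have a1 := h.φ.one x hx
  have a2 := h.φ.two x hx
  unfold phi0 at a1 a2
  rw [pd1_sub dφ d, p1] at a1
  rw [pd2_sub dφ d, p2] at a2
  have a3 := h.ψ.one x hx
  have a4 := h.ψ.two x hx
  rw [abs_le] at a1 a2 a3 a4
  rw [Fld.u, Fld.v]
  exact ⟨abs_le.2 ⟨by linarith, by linarith⟩, abs_le.2 ⟨by linarith, by linarith⟩⟩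

lemma grad_velocity (h : NearBackground κ J₀ ρ₀ ρb Eb e U)
    (hg : ContDiffOn ℝ 1 (fun t => J₀ / ρb t) (Icc 0 κ.L))
    (hD : ∀ t ∈ Ioo 0 κ.L, |deriv (fun s => J₀ / ρb s) t| ≤ D)
    (hφ : ContDiffOn ℝ 2 U.φ (Noz κ.L)) (hψ : ContDiffOn ℝ 2 U.ψ (Noz κ.L)) {x : Pt}
    (hx : x ∈ Noz κ.L) : ‖fderiv ℝ U.u x‖ ≤ (4 * e + D) * wt κ.α x.2 ∧
      ‖fderiv ℝ U.v x‖ ≤ 4 * e * wt κ.α x.2 := by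
  have ho := isOpen_Noz κ.L
  have hn := ho.mem_nhds hx
  have dφ1 := ((contDiffOn_pd1 (m := 1) ho hφ (by norm_num)).contDiffAt hn).differentiableAt
    (by norm_num)
  have dφ2 := ((contDiffOn_pd2 (m := 1) ho hφ (by norm_num)).contDiffAt hn).differentiableAt
    (by norm_num)
  have dψ1 := ((contDiffOn_pd1 (m := 1) ho hψ (by norm_num)).contDiffAt hn).differentiableAt
    (by norm_num)
  have dψ2 := ((contDiffOn_pd2 (m := 1) ho hψ (by norm_num)).contDiffAt hn).differentiableAt
    (by norm_num)
  have dg : DifferentiableAt ℝ (fun t => J₀ / ρb t) x.1 :=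
    (hg.contDiffAt (Icc_mem_nhds hx.1.1 hx.1.2)).differentiableAt (by norm_num)
  have dg' : DifferentiableAt ℝ (fun y : Pt => J₀ / ρb y.1) x :=
    dg.comp x (f := fun y : Pt => y.1) differentiableAt_fst
  have e1 : EqOn (pd1 fun y => U.φ y - phi0 J₀ ρb y) (fun y => pd1 U.φ y - J₀ / ρb y.1)
      (Noz κ.L) := by
    intro y hy
    obtain ⟨d, p1, -⟩ := primitive_fst hg.continuousOn hy
    have dφ : DifferentiableAt ℝ U.φ y :=
      (hφ.contDiffAt (ho.mem_nhds hy)).differentiableAt (by norm_num)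
    unfold phi0
    rw [pd1_sub dφ d, p1]
  have e2 : EqOn (pd2 fun y => U.φ y - phi0 J₀ ρb y) (pd2 U.φ) (Noz κ.L) := by
    intro y hy
    obtain ⟨d, -, p2⟩ := primitive_fst hg.continuousOn hy
    have dφ : DifferentiableAt ℝ U.φ y :=
      (hφ.contDiffAt (ho.mem_nhds hy)).differentiableAt (by norm_num)
    unfold phi0
    rw [pd2_sub dφ d, p2, sub_zero]
  have a11 := h.φ.one_one x hx
  have a12 := h.φ.one_two x hx
  have a22 := h.φ.two_two x hx
  rw [pd1_congr ho e1 hx, pd1_sub dφ1 dg', pd1_fst (φ := fun t => J₀ / ρb t) dg] at a11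
  rw [pd1_congr ho e2 hx] at a12
  rw [pd2_congr ho e2 hx] at a22
  have b11 := h.ψ.one_one x hx
  have b12 := h.ψ.one_two x hx
  have b22 := h.ψ.two_two x hx
  have hd := hD x.1 hx.1
  have hDw : D ≤ D * wt κ.α x.2 :=
    le_mul_of_one_le_right ((abs_nonneg _).trans hd) (one_le_wt hx.2)
  have u1 : pd1 U.u x = pd1 (pd1 U.φ) x + pd1 (pd2 U.ψ) x := pd1_add dφ1 dψ2
  have u2 : pd2 U.u x = pd1 (pd2 U.φ) x + pd2 (pd2 U.ψ) x := by
    rw [← pd_comm ho hφ hx]; exact pd2_add dφ1 dψ2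
  have v1 : pd1 U.v x = pd1 (pd2 U.φ) x - pd1 (pd1 U.ψ) x := pd1_sub dφ2 dψ1
  have v2 : pd2 U.v x = pd2 (pd2 U.φ) x - pd1 (pd2 U.ψ) x := by
    rw [← pd_comm ho hψ hx]; exact pd2_sub dφ2 dψ1
  rw [abs_le] at a11 a12 a22 b11 b12 b22 hd
  constructor
  · refine norm_fderiv_le.trans ?_
    have i1 : |pd1 U.u x| ≤ 2 * (e * wt κ.α x.2) + D := by
      rw [u1]; exact abs_le.2 ⟨by linarith, by linarith⟩
    have i2 : |pd2 U.u x| ≤ 2 * (e * wt κ.α x.2) := by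
      rw [u2]; exact abs_le.2 ⟨by linarith, by linarith⟩
    linarith
  · refine norm_fderiv_le.trans ?_
    have i1 : |pd1 U.v x| ≤ 2 * (e * wt κ.α x.2) := by
      rw [v1]; exact abs_le.2 ⟨by linarith, by linarith⟩
    have i2 : |pd2 U.v x| ≤ 2 * (e * wt κ.α x.2) := by
      rw [v2]; exact abs_le.2 ⟨by linarith, by linarith⟩
    linarith

end NearBackground

/-- The bounds `κ` and the radius `e` are admissible for the background with a priori bound `D`. -/
structure Admissible (κ : FlowConst) (J₀ ρ₀ ν₀ ρhigh D e : ℝ) : Prop where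
  ν_eq : κ.ν = ν₀ / 2
  m_eq : κ.m = J₀ / ρhigh / 2
  le_M : D + |κ.S₀| + |Bern0 κ.γ κ.𝔭 κ.cv κ.S₀ J₀ ρ₀| + 4 ≤ κ.M
  nonneg : 0 ≤ e
  le_one : 4 * e ≤ 1
  velocity : 2 * e ≤ J₀ / ρhigh / 2
  subsonic : (κ.γ - 1) * (2 * e) + (κ.γ + 1) / 2 * (2 * e * (2 * D + 2) + 4 * e) ≤ ν₀ / 2

namespace NearBackground
variable {κ : FlowConst} {J₀ b₀ E₀ ρ₀ ν₀ ρlow ρhigh e D : ℝ} {ρb Eb : ℝ → ℝ} {U : Fld}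

lemma state_of_near
    (hbg : Background κ.γ κ.𝔭 κ.cv b₀ J₀ κ.S₀ E₀ ρ₀ κ.L ν₀ ρlow ρhigh ρb Eb)
    (ha : Admissible κ J₀ ρ₀ ν₀ ρhigh D e) {t S K Φ u v : ℝ} (ht : t ∈ Icc 0 κ.L)
    (hD : J₀ / ρb t ≤ D ∧ |Eb t| ≤ D ∧ |∫ s in (0 : ℝ)..t, Eb s| ≤ D)
    (hS : |S - κ.S₀| ≤ e) (hK : |K - Bern0 κ.γ κ.𝔭 κ.cv κ.S₀ J₀ ρ₀| ≤ e)
    (hΦ : |Φ - ∫ s in (0 : ℝ)..t, Eb s| ≤ e) (hu : |u - J₀ / ρb t| ≤ 2 * e) (hv : |v| ≤ 2 * e) :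
    SubsonicState κ.γ κ.S₀ κ.ν κ.m κ.M S K Φ u v (K + Φ - (u ^ 2 + v ^ 2) / 2) := by
  have he := ha.nonneg
  have he1 := ha.le_one
  have pos := hbg.pos_rho ht
  have low : J₀ / ρhigh ≤ J₀ / ρb t :=
    div_le_div_of_nonneg_left hbg.hJ₀.le pos (hbg.bound_hi t ht)
  have upos : 0 < J₀ / ρb t := div_pos hbg.hJ₀ pos
  have hM := ha.le_M
  have hb := hbg.bernoulli t ht
  have hsub := hbg.subsonic t ht
  have hg : 0 < κ.γ - 1 := by linarith [hbg.hγ]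
  rw [← div_pow] at hsub
  obtain ⟨hD1, hD2, hD3⟩ := hD
  have n1 := abs_nonneg κ.S₀
  have n2 := le_abs_self (Bern0 κ.γ κ.𝔭 κ.cv κ.S₀ J₀ ρ₀)
  have n3 := abs_nonneg (Bern0 κ.γ κ.𝔭 κ.cv κ.S₀ J₀ ρ₀)
  rw [abs_le] at hK hΦ hu hD3
  have hvel := ha.velocity
  have hsm := ha.subsonic
  refine ⟨rfl, hS.trans (by linarith), ?_, by linarith, ?_, by linarith, by linarith⟩
  · set w := J₀ / ρb t with hw
    set B := Bern0 κ.γ κ.𝔭 κ.cv κ.S₀ J₀ ρ₀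
    set P := ∫ s in (0 : ℝ)..t, Eb s
    have hb' : (κ.γ - 1) * (B + P - w ^ 2 / 2) =
        κ.γ * κ.𝔭 * exp (κ.S₀ / κ.cv) * ρb t ^ (κ.γ - 1) := by
      rw [hb]; field_simp
    have q1 : u ^ 2 - w ^ 2 ≤ 2 * e * (2 * D + 2) := by
      have : u ^ 2 - w ^ 2 = (u - w) * (u + w) := by ring
      rw [this]
      have hp : 0 ≤ u + w := by linarith
      calc (u - w) * (u + w) ≤ 2 * e * (u + w) := mul_le_mul_of_nonneg_right hu.2 hp
        _ ≤ _ := mul_le_mul_of_nonneg_left (by linarith) (by linarith)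
    have q2 : v ^ 2 ≤ 4 * e := by
      have : v ^ 2 ≤ (2 * e) ^ 2 := by
        rw [← sq_abs v]; exact pow_le_pow_left₀ (abs_nonneg _) hv 2
      nlinarith
    have q3 : (κ.γ + 1) / 2 * (u ^ 2 - w ^ 2 + v ^ 2) ≤
        (κ.γ + 1) / 2 * (2 * e * (2 * D + 2) + 4 * e) :=
      mul_le_mul_of_nonneg_left (by linarith) (by linarith)
    have q4 : (κ.γ - 1) * (B + P - 2 * e) ≤ (κ.γ - 1) * (K + Φ) :=
      mul_le_mul_of_nonneg_left (by linarith) hg.le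
    rw [ha.ν_eq]
    nlinarith
  · rw [ha.m_eq]; linarith

/-- A solution close to the background is a subsonic flow. -/
lemma subsonicFlow
    (hbg : Background κ.γ κ.𝔭 κ.cv b₀ J₀ κ.S₀ E₀ ρ₀ κ.L ν₀ ρlow ρhigh ρb Eb)
    (ha : Admissible κ J₀ ρ₀ ν₀ ρhigh D e)
    (hD : ∀ t ∈ Icc 0 κ.L, J₀ / ρb t ≤ D ∧ |Eb t| ≤ D ∧ |∫ s in (0 : ℝ)..t, Eb s| ≤ D)
    (hD' : ∀ t ∈ Ioo 0 κ.L, |deriv (fun s => J₀ / ρb s) t| ≤ D)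
    (h : NearBackground κ J₀ ρ₀ ρb Eb e U) {b : Pt → ℝ} {Sen Ben Φbd0 ΦbdL pex : ℝ → ℝ}
    (hs : RefSol κ.γ κ.𝔭 κ.cv κ.L b Sen Ben Φbd0 ΦbdL pex U.φ U.ψ U.Φ U.S U.K) :
    SubsonicFlow κ (4 * e) U := by
  have hL := κ.hL
  obtain ⟨φu, ψu, Φu, φs, ψs, Φs, Su, Ku, eqs, ends, walls⟩ := hs
  rw [closure_Noz hL] at φu ψu Φu Su Ku
  have he := ha.nonneg
  have he1 := ha.le_one
  have hM := ha.le_M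
  have ho := isOpen_Noz κ.L
  have D0 : 0 ≤ D := (abs_nonneg _).trans (hD 0 ⟨le_rfl, hL.le⟩).2.1
  have n1 := abs_nonneg κ.S₀
  have n2 := abs_nonneg (Bern0 κ.γ κ.𝔭 κ.cv κ.S₀ J₀ ρ₀)
  have hvel := hbg.contDiffOn_velocity
  have cE := hbg.smooth_E.continuousOn
  have fst_maps : MapsTo (fun x : Pt => x.1) (Rect κ.L) (Icc 0 κ.L) := fun x hx => hx.1
  have cu : ContinuousOn U.u (Rect κ.L) := φu.continuousOn_pd1.add ψu.continuousOn_pd2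
  have cv : ContinuousOn U.v (Rect κ.L) := φu.continuousOn_pd2.sub ψu.continuousOn_pd1
  have cw : ContinuousOn (fun x : Pt => J₀ / ρb x.1) (Rect κ.L) :=
    hvel.continuousOn.comp continuousOn_fst fst_maps
  have cP : ContinuousOn (fun x : Pt => ∫ s in (0 : ℝ)..x.1, Eb s) (Rect κ.L) :=
    (Background.continuousOn_primitive hL cE).comp continuousOn_fst fst_maps
  have near_u := abs_le_on_Rect hL (cu.sub cw) fun x hx =>
    (h.velocity_inside hvel.continuousOn φu hx).1
  have near_v := abs_le_on_Rect hL cv fun x hx => (h.velocity_inside hvel.continuousOn φu hx).2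
  have near_Φ : ∀ x ∈ Rect κ.L, |U.Φ x - ∫ s in (0 : ℝ)..x.1, Eb s| ≤ e :=
    abs_le_on_Rect hL (Φu.continuousOn.sub cP) h.Φ.val
  have near_S := abs_le_on_Rect hL (Su.continuousOn.sub continuousOn_const) fun x hx => (h.S x hx).1
  have near_K := abs_le_on_Rect hL (Ku.continuousOn.sub continuousOn_const) fun x hx => (h.K x hx).1
  have state : ∀ x ∈ Rect κ.L,
      SubsonicState κ.γ κ.S₀ κ.ν κ.m κ.M (U.S x) (U.K x) (U.Φ x) (U.u x) (U.v x) (U.z x) :=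
    fun x hx => state_of_near hbg ha hx.1 (hD x.1 hx.1) (near_S x hx) (near_K x hx) (near_Φ x hx)
      (near_u x hx) (near_v x hx)
  have grad_bound : ∀ {f : Pt → ℝ} {x : Pt}, x ∈ Noz κ.L → |pd1 f x| ≤ D + 1 → |pd2 f x| ≤ 1 →
      ‖fderiv ℝ f x‖ ≤ κ.M * wt κ.α x.2 := fun {f x} hx h1 h2 =>
    calc ‖fderiv ℝ f x‖ ≤ |pd1 f x| + |pd2 f x| := norm_fderiv_le
      _ ≤ κ.M := by linarith
      _ ≤ _ := le_mul_of_one_le_right (by linarith) (one_le_wt hx.2)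
  have v_wall : ∀ x ∈ GamW κ.L, U.v x = 0 := by
    have hsub : GamW κ.L ⊆ Rect κ.L := fun x hx =>
      ⟨Ioo_subset_Icc_self hx.1, by rcases hx.2 with h0 | h0 <;> rw [h0] <;> simp⟩
    intro x hx
    rw [Fld.v, (walls x hx).1, pd1_wall (fun y hy => ψu.differentiableAt (hsub hy))
      (fun y hy => (walls y hy).2.2) x hx, sub_zero]
  have Φ_wall := fun x hx => (walls x hx).2.1
  have ψ_wall := fun x hx => (walls x hx).2.2
  have zero_mem : (0 : ℝ) ∈ ({0, 1} : Set ℝ) := by simp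
  have one_mem : (1 : ℝ) ∈ ({0, 1} : Set ℝ) := by simp
  have le4 : e ≤ 4 * e := by linarith
  exact {
    φ_up := φu
    ψ_up := ψu
    Φ_up := Φu
    S_up := Su
    K_up := Ku
    φ_smooth := φs
    ψ_smooth := ψs
    Φ_smooth := Φs
    mass := fun x hx => (eqs x hx).1
    S_transport := fun x hx => (eqs x hx).2.2.2.1
    K_transport := fun x hx => (eqs x hx).2.2.2.2
    vorticity := fun x hx => by
      have st := state x (Noz_subset_Rect _ hx)
      have zpos : 0 < U.z x :=
        (div_pos κ.hν (by linarith [κ.hγ])).trans_le (st.le_z κ.hγ)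
      have hT := Tfun_Hfun (cv := κ.cv) (S := U.S x) κ.hγ κ.h𝔭 zpos
      have := (eqs x hx).2.2.1
      change lap U.ψ x = -(Tfun κ.γ κ.𝔭 κ.cv (Hfun κ.γ κ.𝔭 κ.cv (U.S x) (U.z x)) (U.S x) *
        pd2 U.S x - pd2 U.K x) / U.u x at this
      rw [this, hT]
      ring
    state := state
    S_grad := fun x hx =>
      ⟨(abs_le_on_Rect hL Su.continuousOn_pd1 (fun y hy => (h.S y hy).2.1) x hx).trans le4,
        (abs_le_on_Rect hL Su.continuousOn_pd2 (fun y hy => (h.S y hy).2.2) x hx).trans le4⟩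
    K_grad := fun x hx =>
      ⟨(abs_le_on_Rect hL Ku.continuousOn_pd1 (fun y hy => (h.K y hy).2.1) x hx).trans le4,
        (abs_le_on_Rect hL Ku.continuousOn_pd2 (fun y hy => (h.K y hy).2.2) x hx).trans le4⟩
    u_reg := by
      refine ⟨cu, (contDiffOn_pd1 ho φs (by norm_num)).add (contDiffOn_pd2 ho ψs (by norm_num)),
        fun x hx => ?_, fun x hx => (h.grad_velocity hvel hD' φs ψs hx).1.trans
          (mul_le_mul_of_nonneg_right (by linarith) (zero_le_one.trans (one_le_wt hx.2)))⟩
      have st := state x (Noz_subset_Rect _ hx)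
      rw [abs_of_pos (κ.hm.trans_le st.le_u)]
      exact st.u_le
    v_reg := ⟨cv, (contDiffOn_pd2 ho φs (by norm_num)).sub (contDiffOn_pd1 ho ψs (by norm_num)),
      fun x hx => (near_v x (Noz_subset_Rect _ hx)).trans (by linarith),
      fun x hx => (h.grad_velocity hvel hD' φs ψs hx).2⟩
    Φ_reg := by
      refine ⟨Φu.continuousOn, Φs.of_le (by norm_num), fun x hx => ?_, fun x hx => ?_⟩
      · have a := near_Φ x (Noz_subset_Rect _ hx)
        have a' := (hD x.1 (Ioo_subset_Icc_self hx.1)).2.2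
        rw [abs_le] at a a' ⊢
        constructor <;> linarith
      · obtain ⟨d, p1, p2⟩ := primitive_fst cE hx
        have dΦ := Φu.differentiableAt (Noz_subset_Rect _ hx)
        have a1 := h.Φ.one x hx
        have a2 := h.Φ.two x hx
        unfold Phi0 at a1 a2
        rw [pd1_sub dΦ d, p1] at a1
        rw [pd2_sub dΦ d, p2, sub_zero] at a2
        have a' := (hD x.1 (Ioo_subset_Icc_self hx.1)).2.1
        refine grad_bound hx ?_ (by linarith)
        rw [abs_le] at a1 a' ⊢
        constructor <;> linarith
    S_reg := by
      refine ⟨Su.continuousOn, Su.contDiffOn.mono (Noz_subset_Rect _), fun x hx => ?_,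
        fun x hx => grad_bound hx (by linarith [(h.S x hx).2.1]) (by linarith [(h.S x hx).2.2])⟩
      have := abs_sub_abs_le_abs_sub (U.S x) κ.S₀
      linarith [(h.S x hx).1]
    K_reg := by
      refine ⟨Ku.continuousOn, Ku.contDiffOn.mono (Noz_subset_Rect _), fun x hx => ?_,
        fun x hx => grad_bound hx (by linarith [(h.K x hx).2.1]) (by linarith [(h.K x hx).2.2])⟩
      have := abs_sub_abs_le_abs_sub (U.K x) (Bern0 κ.γ κ.𝔭 κ.cv κ.S₀ J₀ ρ₀)
      linarith [(h.K x hx).1]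
    v_bot := eq_zero_on_walls hL cv zero_mem v_wall
    v_top := eq_zero_on_walls hL cv one_mem v_wall
    ψ_bot := eq_zero_on_walls hL ψu.continuousOn zero_mem ψ_wall
    ψ_top := eq_zero_on_walls hL ψu.continuousOn one_mem ψ_wall
    Φ_bot := eq_zero_on_walls hL Φu.continuousOn_pd2 zero_mem Φ_wall
    Φ_top := eq_zero_on_walls hL Φu.continuousOn_pd2 one_mem Φ_wall
    φ_in := fun t ht => (ends t ht).1
    ψ_in := fun t ht => (ends t ht).2.2.2.2.1
    ψ_out := fun t ht => (ends t ht).2.2.2.2.2.1 }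

end NearBackground

/-! ### Uniqueness -/

lemma StateComparison.mono {c C C' S K Φ u v z r S' K' Φ' u' v' z' r' : ℝ}
    (h : StateComparison c C S K Φ u v z r S' K' Φ' u' v' z' r') (hC : C ≤ C') :
    StateComparison c C' S K Φ u v z r S' K' Φ' u' v' z' r' where
  le_r := h.le_r
  r_le := h.r_le.trans hC
  le_r' := h.le_r'
  r'_le := h.r'_le.trans hC
  monotone := le_trans (sub_le_sub_left (mul_le_mul_of_nonneg_right hC (by positivity)) _)
    h.monotone
  flux₁ := h.flux₁.trans (mul_le_mul_of_nonneg_right hC (by positivity))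
  flux₂ := h.flux₂.trans (mul_le_mul_of_nonneg_right hC (by positivity))
  quot := h.quot.trans (mul_le_mul_of_nonneg_right hC (by positivity))
  inv := h.inv.trans (mul_le_mul_of_nonneg_right hC (by positivity))

lemma exists_flowConst {γ 𝔭 cv α L S₀ ν m M : ℝ} (hγ : 1 < γ) (h𝔭 : 0 < 𝔭) (hcv : 0 < cv)
    (hα : 1 / 2 < α) (hL : 0 < L) (hν : 0 < ν) (hm : 0 < m) (hM : 1 ≤ M) :
    ∃ κ : FlowConst, (κ.γ = γ ∧ κ.𝔭 = 𝔭 ∧ κ.cv = cv ∧ κ.α = α ∧ κ.L = L ∧ κ.S₀ = S₀ ∧ κ.ν = ν ∧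
      κ.m = m ∧ κ.M = M) ∧ ∀ S K Φ u v z S' K' Φ' u' v' z',
      SubsonicState γ S₀ ν m M S K Φ u v z → SubsonicState γ S₀ ν m M S' K' Φ' u' v' z' →
      ((γ - 1) * |K - K'| ≤ ν / 2 →
        StateComparison κ.c κ.C S K Φ u v z (Hfun γ 𝔭 cv S z) S' K' Φ' u' v' z'
          (Hfun γ 𝔭 cv S' z')) ∧
      (Φ = Φ' →
        𝔭 * exp (S / cv) * Hfun γ 𝔭 cv S z ^ γ = 𝔭 * exp (S' / cv) * Hfun γ 𝔭 cv S' z' ^ γ →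
        |Hfun γ 𝔭 cv S z * u - Hfun γ 𝔭 cv S' z' * u' +
          Hfun γ 𝔭 cv S' z' * (v + v') * (u + u')⁻¹ * (v - v')| ≤
            κ.C * (|S - S'| + |K - K'|)) := by
  obtain ⟨c, hc, C₁, hC₁, h₁⟩ := exists_stateComparison (cv := cv) hγ h𝔭 S₀ hν hm hM
  obtain ⟨C₂, hC₂, h₂⟩ := exists_exit_flux_bound hγ h𝔭 hcv S₀ hν hm hM
  refine ⟨⟨γ, 𝔭, cv, α, L, S₀, ν, m, M, c, max C₁ C₂, hγ, h𝔭, hcv, hα, hL, hν, hm, hM, hc,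
    lt_max_of_lt_left hC₁⟩, ⟨rfl, rfl, rfl, rfl, rfl, rfl, rfl, rfl, rfl⟩, ?_⟩
  intro S K Φ u v z S' K' Φ' u' v' z' P P'
  exact ⟨fun h => (h₁ _ _ _ _ _ _ _ _ _ _ _ _ P P' h).mono (le_max_left _ _), fun h h' =>
    (h₂ _ _ _ _ _ _ _ _ _ _ _ _ P P' h h').trans
      (mul_le_mul_of_nonneg_right (le_max_right _ _) (by positivity))⟩

/-- A positive real number below finitely many linear thresholds. -/
lemma exists_radius {ε₀ q A B ν : ℝ} (hε : 0 < ε₀) (hq : 0 < q) (hA : 0 < A) (hB : 0 < B)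
    (hν : 0 < ν) : ∃ e > 0, 4 * e ≤ ε₀ ∧ 4 * e ≤ 1 ∧ 2 * e ≤ q ∧ A * e ≤ ν ∧ B * e ≤ ν := by
  refine ⟨min (min (ε₀ / 4) (1 / 4)) (min (q / 2) (min (ν / A) (ν / B))), by positivity,
    ?_, ?_, ?_, ?_, ?_⟩
  · have := (min_le_left (min (ε₀ / 4) (1 / 4)) (min (q / 2) (min (ν / A) (ν / B)))).trans
      (min_le_left _ _)
    linarith
  · have := (min_le_left (min (ε₀ / 4) (1 / 4)) (min (q / 2) (min (ν / A) (ν / B)))).trans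
      (min_le_right _ _)
    linarith
  · have := (min_le_right (min (ε₀ / 4) (1 / 4)) (min (q / 2) (min (ν / A) (ν / B)))).trans
      (min_le_left _ _)
    linarith
  · rw [mul_comm, ← le_div_iff₀ hA]
    exact (min_le_right _ _).trans ((min_le_right _ _).trans (min_le_left _ _))
  · rw [mul_comm, ← le_div_iff₀ hB]
    exact (min_le_right _ _).trans ((min_le_right _ _).trans (min_le_right _ _))

/-- Theorem 3.1, uniqueness for the reformulated problem. Let
`(ρ̄,(ū,0),p̄,Φ₀)` be the subsonic background solution on `N`, fix `α ∈ (1/2,1)` and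
`μ ∈ (2,∞)`, and suppose `Φ_bd` satisfies the compatibility condition at the corner
points. Then, for the constant `C > 0` of the existence estimate, there exists `σ₄ > 0`,
depending only on the data, `α` and `μ`, such that if `ω₁ + ω₂ + ω₃ + ω₄ ≤ σ₄`, then the
solution `U = (φ,ψ,Φ,S,K)` of the reformulated boundary value problem satisfying the
existence estimate is unique. -/
theorem stmt4 (γ 𝔭 cv b₀ J₀ S₀ E₀ ρ₀ L ν₀ ρlow ρhigh α μ C : ℝ) (ρb Eb : ℝ → ℝ)
    (hbg : Background γ 𝔭 cv b₀ J₀ S₀ E₀ ρ₀ L ν₀ ρlow ρhigh ρb Eb)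
    (hα : α ∈ Ioo (1/2 : ℝ) 1) (hμ : 2 < μ) (hC : 0 < C) :
    ∃ σ₄ > (0:ℝ), ∀ b : Pt → ℝ, ∀ Sen Ben Φbd0 ΦbdL pex : ℝ → ℝ,
      -- compatibility condition `∂_{x₂}Φ_bd = 0` on `Γ̄_w ∩ (Γ̄₀ ∪ Γ̄_L)`
      deriv Φbd0 0 = 0 → deriv Φbd0 1 = 0 → deriv ΦbdL 0 = 0 → deriv ΦbdL 1 = 0 →
      om1 α b₀ L b + om2 α S₀ (Bern0 γ 𝔭 cv S₀ J₀ ρ₀) Sen Ben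
        + om3 γ 𝔭 cv S₀ α L ρb Eb Φbd0 ΦbdL pex
        + ENNReal.ofReal (om4 μ S₀ (Bern0 γ 𝔭 cv S₀ J₀ ρ₀) Sen Ben Φbd0)
        ≤ ENNReal.ofReal σ₄ →
      ∀ φ ψ Φ S K φ' ψ' Φ' S' K' : Pt → ℝ,
        RefSol γ 𝔭 cv L b Sen Ben Φbd0 ΦbdL pex φ ψ Φ S K →
        RefEst γ 𝔭 cv J₀ S₀ ρ₀ L α C ρb Eb φ ψ Φ S K
          (om1 α b₀ L b + om2 α S₀ (Bern0 γ 𝔭 cv S₀ J₀ ρ₀) Sen Ben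
            + om3 γ 𝔭 cv S₀ α L ρb Eb Φbd0 ΦbdL pex) →
        RefSol γ 𝔭 cv L b Sen Ben Φbd0 ΦbdL pex φ' ψ' Φ' S' K' →
        RefEst γ 𝔭 cv J₀ S₀ ρ₀ L α C ρb Eb φ' ψ' Φ' S' K'
          (om1 α b₀ L b + om2 α S₀ (Bern0 γ 𝔭 cv S₀ J₀ ρ₀) Sen Ben
            + om3 γ 𝔭 cv S₀ α L ρb Eb Φbd0 ΦbdL pex) →
        EqOn φ φ' (closure (Noz L)) ∧ EqOn ψ ψ' (closure (Noz L)) ∧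
        EqOn Φ Φ' (closure (Noz L)) ∧ EqOn S S' (closure (Noz L)) ∧
        EqOn K K' (closure (Noz L)) := by
  obtain ⟨D, hD0, hD, hD'⟩ := hbg.exists_bounds
  have hg : 0 < γ - 1 := by linarith [hbg.hγ]
  have hν := hbg.hν₀
  have zero_mem : (0 : ℝ) ∈ Icc 0 L := ⟨le_rfl, hbg.hL.le⟩
  have hq : 0 < J₀ / ρhigh :=
    div_pos hbg.hJ₀ ((hbg.pos_rho zero_mem).trans_le (hbg.bound_hi 0 zero_mem))
  have hM : 1 ≤ D + |S₀| + |Bern0 γ 𝔭 cv S₀ J₀ ρ₀| + 4 := by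
    linarith [abs_nonneg S₀, abs_nonneg (Bern0 γ 𝔭 cv S₀ J₀ ρ₀)]
  obtain ⟨κ, ⟨rfl, rfl, rfl, rfl, rfl, rfl, κν, κm, κM⟩, hκ⟩ :=
    exists_flowConst (S₀ := S₀) hbg.hγ hbg.h𝔭 hbg.hcv hα.1 hbg.hL (half_pos hν) (half_pos hq) hM
  rw [← κν, ← κm, ← κM] at hκ
  obtain ⟨ε₀, hε₀, huniq⟩ := FlowPair.exists_eqOn κ
  obtain ⟨e, he, e1, e2, e3, e4, e5⟩ := exists_radius (q := J₀ / ρhigh / 2)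
    (A := (κ.γ - 1) * 2 + (κ.γ + 1) / 2 * (2 * (2 * D + 2) + 4)) (B := (κ.γ - 1) * 4)
    hε₀ (half_pos hq) (by have := κ.hγ; positivity) (by positivity) (half_pos hν)
  have ha : Admissible κ J₀ ρ₀ ν₀ ρhigh D e :=
    ⟨κν, κm, κM.ge, he.le, e2, e3, by linarith⟩
  refine ⟨e / C, div_pos he hC, ?_⟩
  intro b Sen Ben Φbd0 ΦbdL pex _ _ _ _ hω φ ψ Φ S K φ' ψ' Φ' S' K' sA eA sB eB
  have hω' : ENNReal.ofReal C * (om1 κ.α b₀ κ.L b +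
      om2 κ.α κ.S₀ (Bern0 κ.γ κ.𝔭 κ.cv κ.S₀ J₀ ρ₀) Sen Ben +
      om3 κ.γ κ.𝔭 κ.cv κ.S₀ κ.α κ.L ρb Eb Φbd0 ΦbdL pex) ≤ ENNReal.ofReal e := by
    refine (mul_le_mul_right (le_self_add.trans hω) _).trans_eq ?_
    rw [← ENNReal.ofReal_mul hC.le, mul_div_cancel₀ _ hC.ne']
  set A : Fld := ⟨φ, ψ, Φ, S, K⟩
  set B : Fld := ⟨φ', ψ', Φ', S', K'⟩
  have nA : NearBackground κ J₀ ρ₀ ρb Eb e A := nearBackground_of_refEst hα.2 he.le hω' eA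
  have nB : NearBackground κ J₀ ρ₀ ρb Eb e B := nearBackground_of_refEst hα.2 he.le hω' eB
  have fA : SubsonicFlow κ (4 * e) A := nA.subsonicFlow hbg ha hD hD' sA
  have fB : SubsonicFlow κ (4 * e) B := nB.subsonicFlow hbg ha hD hD' sB
  obtain ⟨-, -, -, -, -, -, -, -, eqsA, endsA, -⟩ := sA
  obtain ⟨-, -, -, -, -, -, -, -, eqsB, endsB, -⟩ := sB
  have hK : ∀ x ∈ Rect κ.L, |A.K x - B.K x| ≤ 2 * e := by
    refine abs_le_on_Rect κ.hL (fA.K_reg.cont.sub fB.K_reg.cont) fun x hx => ?_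
    have a := (nA.K x hx).1
    have a' := (nB.K x hx).1
    rw [abs_le] at a a' ⊢
    constructor <;> linarith
  have pair : FlowPair κ (4 * e) A B := {
    nonneg := by linarith
    le_one := e2
    fst := fA
    snd := fB
    poisson := fun x hx => by
      have a : lap A.Φ x = A.r κ x - b x := (eqsA x hx).2.1
      have a' : lap B.Φ x = B.r κ x - b x := (eqsB x hx).2.1
      rw [a, a']; ring
    Φ_in := fun t ht => (endsA t ht).2.2.1.trans (endsB t ht).2.2.1.symm
    Φ_out := fun t ht => (endsA t ht).2.2.2.1.trans (endsB t ht).2.2.2.1.symm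
    S_in := fun t ht => (endsA t ht).2.2.2.2.2.2.1.trans (endsB t ht).2.2.2.2.2.2.1.symm
    K_in := fun t ht => (endsA t ht).2.2.2.2.2.2.2.trans (endsB t ht).2.2.2.2.2.2.2.symm
    comparison := fun x hx => (hκ _ _ _ _ _ _ _ _ _ _ _ _ (fA.state x hx) (fB.state x hx)).1 (by
      have := mul_le_mul_of_nonneg_left (hK x hx) hg.le
      linarith)
    exit_flux := fun t ht => by
      have hx := mem_Rect_right κ.hL ht
      exact (hκ _ _ _ _ _ _ _ _ _ _ _ _ (fA.state _ hx) (fB.state _ hx)).2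
        ((endsA t ht).2.2.2.1.trans (endsB t ht).2.2.2.1.symm)
        ((endsA t ht).2.1.trans (endsB t ht).2.1.symm) }
  rw [closure_Noz κ.hL]
  exact huniq _ _ _ e1 pair
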